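/- Under condition [A], the following local theorem in the regions of normal, moderate and large deviations holds: there exists Δ > 0 such that for any sequence x = x_n ∈ ℕ∪{0} with lim_{n→∞} x/n = α0 and |α0 − a| ≤ Δ, there is a constant K(α0) > 0 (equal to ψ1(λ(α0),μ(α0)) C_H(1,α0) I(α0), where C_H is the positive function of Mogulskii's local renewal theorem, continuous in a neighborhood of (1,α0), and I(α0) := Σ_{l=1}^∞ e^{λ(α0) l} E(e^{μ(α0) R(l)}; τ ≥ l | Y(0) = y0)) such that P(R(n) = x) = (K(α0)/√n) e^{−n D(x/n)} (1 + o(1)) as n → ∞. -/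

import Mathlib

noncomputable section

/-- A chain with unbounded variable length memory over the binary alphabet `{0,1}`,
with memory parameter `v ≥ 1`.  For `k ∈ ℕ ∪ {0}` (the distance from the current
position to the nearest `1`) and a word `w` of `v - 1` letters (the letters standing
to the left of that `1`), `p k w` is the probability of appending the character `1`.
The structure records the sample space, the appended characters `X n = r_n(n)`,
the full configuration `cfg`, the position `mpos ω n` of the rightmost `1` among the
coordinates `≤ n`, and the Markov transition rule `htrans`. -/
structure VLMC (v : ℕ) (p : ℕ → (Fin (v - 1) → Bool) → ℝ) where
  /-- the sample space -/
  Ω : Type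
  [mΩ : MeasurableSpace Ω]
  /-- the underlying probability measure -/
  P : MeasureTheory.Measure Ω
  hprob : MeasureTheory.IsProbabilityMeasure P
  hv : 0 < v
  /-- the (fixed) initial configuration; only the coordinates `i ≤ 0` are relevant -/
  r0 : ℤ → Bool
  /-- `X n` is the random character appended at step `n`, for `n ≥ 1` -/
  X : ℕ → Ω → Bool
  hXmeas : ∀ n, Measurable (X n)
  /-- the full configuration (it does not change in time: at time `n` only the
  coordinates `≤ n` are relevant) -/
  cfg : Ω → ℤ → Bool
  hcfg : ∀ ω i, cfg ω i = if i ≤ 0 then r0 i else X i.toNat ω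
  /-- `mpos ω n` is the position of the rightmost `1` among the coordinates `≤ n` -/
  mpos : Ω → ℕ → ℤ
  hmpos : ∀ ω n, mpos ω n ≤ (n : ℤ) ∧ cfg ω (mpos ω n) = true ∧
    ∀ i : ℤ, mpos ω n < i → i ≤ (n : ℤ) → cfg ω i = false
  /-- the transition rule: on any cylinder (in the appended characters) on which the
  distance from `n` to the nearest `1` equals `k` and the word of the `v - 1` letters
  standing to the left of that `1` equals `w`, the conditional probability that the
  character appended at step `n + 1` equals `1` is `p k w`. -/
  htrans : ∀ (n : ℕ) (b : Fin n → Bool) (k : ℕ) (w : Fin (v - 1) → Bool),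
    (∀ ω, (∀ i : Fin n, X (i.1 + 1) ω = b i) →
      ((n : ℤ) - mpos ω n = (k : ℤ) ∧
        ∀ j : Fin (v - 1), cfg ω (mpos ω n - ((v : ℤ) - 1) + (j.1 : ℤ)) = w j)) →
    P {ω | (∀ i : Fin n, X (i.1 + 1) ω = b i) ∧ X (n + 1) ω = true}
      = ENNReal.ofReal (p k w) * P {ω | ∀ i : Fin n, X (i.1 + 1) ω = b i}

open MeasureTheory Filter

namespace VLMC

variable {v : ℕ} {p : ℕ → (Fin (v - 1) → Bool) → ℝ}

/-- Condition [A]: the initial configuration contains at least one `1`, and all the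
transition probabilities lie between `δ2` and `δ1`, where `0 < δ2 < δ1 < 1`. -/
def CondA (S : VLMC v p) (δ1 δ2 : ℝ) : Prop :=
  (∃ i : ℤ, i ≤ 0 ∧ S.r0 i = true) ∧
  0 < δ2 ∧ δ2 < δ1 ∧ δ1 < 1 ∧
  ∀ (k : ℕ) (w : Fin (v - 1) → Bool), δ2 ≤ p k w ∧ p k w ≤ δ1

/-- `R n`, the number of `1`s appended during the first `n` steps -/
def R (S : VLMC v p) (n : ℕ) (ω : S.Ω) : ℕ :=
  ∑ k ∈ Finset.Icc 1 n, (S.X k ω).toNat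

/-- `Y(n) = y₀ = (0,(0,…,0,1))`, i.e. the character at position `n` is `1` and the
`v - 1` letters to its left are all `0` -/
def hitY0 (S : VLMC v p) (ω : S.Ω) (n : ℕ) : Prop :=
  S.mpos ω n = (n : ℤ) ∧
    ∀ j : Fin (v - 1), S.cfg ω ((n : ℤ) - ((v : ℤ) - 1) + (j.1 : ℤ)) = false

/-- `T k`, the time of the `k`-th visit of the chain `Y` to the state `y₀`
(`T 0 = 0`) -/
def T (S : VLMC v p) : ℕ → S.Ω → ℕ
  | 0, _ => 0
  | k + 1, ω => sInf {n | T S k ω < n ∧ S.hitY0 ω n}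

/-- `τ_k = T_k - T_{k-1}`, the spacings between consecutive visits to `y₀` -/
def tau (S : VLMC v p) (k : ℕ) (ω : S.Ω) : ℕ := S.T k ω - S.T (k - 1) ω

/-- `ζ_k`, the number of `1`s appended at the times `n ∈ (T_{k-1}, T_k]` -/
def zeta (S : VLMC v p) (k : ℕ) (ω : S.Ω) : ℕ :=
  ∑ n ∈ Finset.Ioc (S.T (k - 1) ω) (S.T k ω), (S.X n ω).toNat

/-- `ν(n) = max {k ≥ 0 : T_k < n}` -/
def nu (S : VLMC v p) (n : ℕ) (ω : S.Ω) : ℕ := sSup {k | S.T k ω < n}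

/-- the generalized renewal process `Z(n) = Σ_{k=0}^{ν(n)} ζ_k` (with `ζ_0 = 0`) -/
def Z (S : VLMC v p) (n : ℕ) (ω : S.Ω) : ℕ :=
  ∑ k ∈ Finset.range (S.nu n ω + 1), S.zeta k ω

/-- `a = E ζ / E τ`, where `(τ, ζ) = (τ_2, ζ_2)` has the common distribution of the
regeneration vectors `ξ_k = (τ_k, ζ_k)`, `k ≥ 2` -/
def a (S : VLMC v p) : ℝ :=
  (∫ ω, (S.zeta 2 ω : ℝ) ∂S.P) / (∫ ω, (S.tau 2 ω : ℝ) ∂S.P)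

/-- `σ² = E (ζ - aτ)² / E τ` -/
def sigma2 (S : VLMC v p) : ℝ :=
  (∫ ω, ((S.zeta 2 ω : ℝ) - S.a * (S.tau 2 ω : ℝ)) ^ 2 ∂S.P) /
    (∫ ω, (S.tau 2 ω : ℝ) ∂S.P)

/-- `ψ(λ,μ) = E e^{λτ + μζ}` (as an extended nonnegative real number) -/
def psi (S : VLMC v p) (l m : ℝ) : ENNReal :=
  ∫⁻ ω, ENNReal.ofReal (Real.exp (l * S.tau 2 ω + m * S.zeta 2 ω)) ∂S.P

/-- `ψ₁(λ,μ) = E e^{λτ₁ + μζ₁}` -/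
def psi1 (S : VLMC v p) (l m : ℝ) : ℝ :=
  ∫ ω, Real.exp (l * S.tau 1 ω + m * S.zeta 1 ω) ∂S.P

/-- the deviation function `D(θ,α) = sup {λθ + μα : A(λ,μ) ≤ 0}` where `A = ln ψ`,
so that `A(λ,μ) ≤ 0 ↔ ψ(λ,μ) ≤ 1` -/
def D2 (S : VLMC v p) (θ α : ℝ) : ℝ :=
  sSup {x | ∃ l m : ℝ, S.psi l m ≤ 1 ∧ x = l * θ + m * α}

/-- `D(α) = D(1,α)` -/
def D (S : VLMC v p) (α : ℝ) : ℝ := S.D2 1 α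

/-- the chain starts from the state `y₀ = (0,(0,…,0,1))`, i.e. `Y(0) = y₀`: the
initial configuration has a `1` at position `0` preceded by `v - 1` zeros -/
def StartsAtY0 (S : VLMC v p) : Prop :=
  S.r0 0 = true ∧ ∀ i : ℤ, 1 - (v : ℤ) ≤ i → i < 0 → S.r0 i = false

end VLMC

open scoped Topology

/-- A Markov chain driven by bits: from the state `y` the bit `c` is emitted with probability
`pr y c` and the state becomes `step y c`.  The word `u`, read from any state, leads to `y0`. -/
structure BitChain (Y : Type) where
  step : Y → Bool → Y
  pr : Y → Bool → ℝ
  y0 : Y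
  u : List Bool
  δ : ℝ
  δ_pos : 0 < δ
  le_pr : ∀ y c, δ ≤ pr y c
  sum_pr : ∀ y, ∑ c, pr y c = 1
  u_ne : u ≠ []
  foldl_u : ∀ y, u.foldl step y = y0

namespace BitChain

variable {Y : Type} (C : BitChain Y) {𝕜 : Type*} [RCLike 𝕜]

lemma pr_pos (y : Y) (c : Bool) : 0 < C.pr y c := C.δ_pos.trans_le (C.le_pr y c)

lemma pr_nonneg (y : Y) (c : Bool) : 0 ≤ C.pr y c := (C.pr_pos y c).le

/-- The transfer operator in which the bit `c` carries the weight `a c`. -/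
def T (a : Bool → 𝕜) (f : Y → 𝕜) (y : Y) : 𝕜 :=
  ∑ c, (C.pr y c : 𝕜) * (a c * f (C.step y c))

lemma T_add (a : Bool → 𝕜) (f g : Y → 𝕜) : C.T a (f + g) = C.T a f + C.T a g := by
  ext y; simp only [T, Pi.add_apply, ← Finset.sum_add_distrib]
  exact Finset.sum_congr rfl fun c _ => by ring

lemma T_smul (a : Bool → 𝕜) (k : 𝕜) (f : Y → 𝕜) : C.T a (k • f) = k • C.T a f := by
  ext y; simp only [T, Pi.smul_apply, smul_eq_mul, Finset.mul_sum]
  exact Finset.sum_congr rfl fun c _ => by ring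

lemma iterate_T_add (a : Bool → 𝕜) (n : ℕ) (f g : Y → 𝕜) :
    (C.T a)^[n] (f + g) = (C.T a)^[n] f + (C.T a)^[n] g := by
  induction n generalizing f g with
  | zero => rfl
  | succ n ih => simp only [Function.iterate_succ_apply, T_add, ih]

lemma iterate_T_smul (a : Bool → 𝕜) (n : ℕ) (k : 𝕜) (f : Y → 𝕜) :
    (C.T a)^[n] (k • f) = k • (C.T a)^[n] f := by
  induction n generalizing f with
  | zero => rfl
  | succ n ih => simp only [Function.iterate_succ_apply, T_smul, ih]

lemma iterate_T_sub (a : Bool → 𝕜) (n : ℕ) (f g : Y → 𝕜) :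
    (C.T a)^[n] (f - g) = (C.T a)^[n] f - (C.T a)^[n] g := by
  rw [sub_eq_add_neg, iterate_T_add, ← neg_one_smul 𝕜 g, iterate_T_smul, neg_one_smul,
    sub_eq_add_neg]

lemma norm_T_le {a : Bool → 𝕜} {b : Bool → ℝ} (hab : ∀ c, ‖a c‖ ≤ b c) {f : Y → 𝕜} {g : Y → ℝ}
    (hfg : ∀ y, ‖f y‖ ≤ g y) (y : Y) : ‖C.T a f y‖ ≤ C.T b g y := by
  refine (norm_sum_le _ _).trans (Finset.sum_le_sum fun c _ => ?_)
  rw [norm_mul, norm_mul, RCLike.norm_ofReal, abs_of_nonneg (C.pr_nonneg y c)]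
  have := C.pr_nonneg y c
  have := (norm_nonneg _).trans (hab c)
  simp only [RCLike.ofReal_real_eq_id, id]
  gcongr
  exacts [hab c, hfg _]

lemma norm_iterate_T_le {a : Bool → 𝕜} {b : Bool → ℝ} (hab : ∀ c, ‖a c‖ ≤ b c) (n : ℕ)
    {f : Y → 𝕜} {g : Y → ℝ} (hfg : ∀ y, ‖f y‖ ≤ g y) (y : Y) :
    ‖(C.T a)^[n] f y‖ ≤ (C.T b)^[n] g y := by
  induction n generalizing f g y with
  | zero => exact hfg y
  | succ n ih => exact ih (fun y => C.norm_T_le hab hfg y) y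

/-- The weight of a word read from the state `y`. -/
def wt (a : Bool → 𝕜) : Y → List Bool → 𝕜
  | _, [] => 1
  | y, c :: b => C.pr y c * (a c * wt a (C.step y c) b)

lemma norm_wt (a : Bool → 𝕜) (y : Y) (b : List Bool) :
    ‖C.wt a y b‖ = C.wt (fun c => ‖a c‖) y b := by
  induction b generalizing y with
  | nil => simp [wt]
  | cons c b ih => simp [wt, ih, abs_of_nonneg (C.pr_nonneg y c)]

lemma le_wt {a : Bool → ℝ} {r : ℝ} (hr : 0 ≤ r) (ha : ∀ c, r ≤ a c) (y : Y) (b : List Bool) :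
    (C.δ * r) ^ b.length ≤ C.wt a y b := by
  induction b generalizing y with
  | nil => simp [wt]
  | cons c b ih =>
    have := C.δ_pos
    have := C.pr_nonneg y c
    have := hr.trans (ha c)
    simp only [wt, List.length_cons, pow_succ', RCLike.ofReal_real_eq_id, id]
    rw [← mul_assoc]
    gcongr
    exacts [C.le_pr y c, ha c, ih _]

lemma wt_one_le (y : Y) (b : List Bool) : C.wt (fun _ => (1 : ℝ)) y b ≤ 1 := by
  induction b generalizing y with
  | nil => simp [wt]
  | cons c b ih =>
    have h1 : C.pr y c ≤ 1 := by
      rw [← C.sum_pr y]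
      exact Finset.single_le_sum (fun c _ => C.pr_nonneg y c) (Finset.mem_univ c)
    have h2 := le_wt C zero_le_one (fun _ => le_rfl) (C.step y c) b (a := fun _ => (1 : ℝ))
    have := C.δ_pos
    simp only [wt, RCLike.ofReal_real_eq_id, id, one_mul]
    exact mul_le_one₀ h1 (by refine le_trans ?_ h2; positivity) (ih _)

lemma sum_bool_eq (c : Bool) (f : Bool → 𝕜) : ∑ d, f d = f c + f (!c) := by
  cases c <;> simp [add_comm]

/-- The contribution of a single word to an iterated transfer operator is split off. -/
lemma norm_iterate_T_sub_wt_le (a : Bool → 𝕜) (b : List Bool)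
    {f : Y → 𝕜} {g : Y → ℝ} (hfg : ∀ y, ‖f y‖ ≤ g y) (y : Y) :
    ‖(C.T a)^[b.length] f y - C.wt a y b * f (b.foldl C.step y)‖ ≤
      (C.T fun c => ‖a c‖)^[b.length] g y - ‖C.wt a y b‖ * g (b.foldl C.step y) := by
  induction b generalizing y with
  | nil => simp [wt]
  | cons c b ih =>
    have h1 := ih (C.step y c)
    have h2 := C.norm_iterate_T_le (a := a) (fun c => le_rfl) b.length hfg (C.step y !c)
    simp only [List.length_cons, Function.iterate_succ_apply', List.foldl_cons, wt]
    rw [T, T, sum_bool_eq c, sum_bool_eq (𝕜 := ℝ) c]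
    simp only [norm_mul, RCLike.norm_ofReal, abs_of_nonneg (C.pr_nonneg y c),
      RCLike.ofReal_real_eq_id, id]
    set A := (C.T a)^[b.length] f
    set B := (C.T fun c => ‖a c‖)^[b.length] g
    calc _ = ‖(C.pr y c : 𝕜) * (a c * (A (C.step y c) -
              C.wt a (C.step y c) b * f (b.foldl C.step (C.step y c)))) +
            (C.pr y (!c) : 𝕜) * (a (!c) * A (C.step y !c))‖ := by congr 1; ring
      _ ≤ C.pr y c * (‖a c‖ * ‖(A (C.step y c) -
              C.wt a (C.step y c) b * f (b.foldl C.step (C.step y c)))‖) +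
            C.pr y (!c) * (‖a (!c)‖ * ‖A (C.step y !c)‖) := by
          refine (norm_add_le _ _).trans_eq ?_
          simp only [norm_mul, RCLike.norm_ofReal, abs_of_nonneg (C.pr_nonneg y _)]
      _ ≤ C.pr y c * (‖a c‖ * (B (C.step y c) - ‖C.wt a (C.step y c) b‖ *
              g (b.foldl C.step (C.step y c)))) +
            C.pr y (!c) * (‖a (!c)‖ * B (C.step y !c)) := by
          have := C.pr_nonneg y c
          have := C.pr_nonneg y !c
          gcongr
      _ = _ := by ring

open Classical in
/-- The function `f`, set to zero at the state `y0`. -/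
def kill (f : Y → 𝕜) (y : Y) : 𝕜 := if y = C.y0 then 0 else f y

open Classical in
/-- The indicator function of the state `y0`. -/
def ind (y : Y) : 𝕜 := if y = C.y0 then 1 else 0

/-- The weighted probability that the first hitting time of `y0` equals `n + 1`. -/
def G (a : Bool → 𝕜) (n : ℕ) : Y → 𝕜 := (fun f => C.T a (C.kill f))^[n] (C.T a C.ind)

/-- The probability that `y0` is not visited at the times `1, …, n`. -/
def tail (n : ℕ) : Y → ℝ := (fun f => C.T (fun _ => (1 : ℝ)) (C.kill f))^[n] 1

lemma G_zero (a : Bool → 𝕜) : C.G a 0 = C.T a C.ind := rfl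

lemma G_succ (a : Bool → 𝕜) (n : ℕ) : C.G a (n + 1) = C.T a (C.kill (C.G a n)) := by
  rw [G, Function.iterate_succ_apply']; rfl

lemma tail_succ (n : ℕ) : C.tail (n + 1) = C.T (fun _ => (1 : ℝ)) (C.kill (C.tail n)) := by
  rw [tail, Function.iterate_succ_apply']; rfl

lemma T_real_apply (a : Bool → ℝ) (f : Y → ℝ) (y : Y) :
    C.T a f y = ∑ c, C.pr y c * (a c * f (C.step y c)) := rfl

lemma T_mono {a : Bool → ℝ} (ha : ∀ c, 0 ≤ a c) {f g : Y → ℝ} (h : ∀ y, f y ≤ g y) (y : Y) :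
    C.T a f y ≤ C.T a g y := by
  simp only [T_real_apply]
  refine Finset.sum_le_sum fun c _ => ?_
  have := C.pr_nonneg y c
  have := ha c
  gcongr
  exact h _

lemma T_nonneg {a : Bool → ℝ} (ha : ∀ c, 0 ≤ a c) {f : Y → ℝ} (h : ∀ y, 0 ≤ f y) (y : Y) :
    0 ≤ C.T a f y := by
  simp only [T_real_apply]
  refine Finset.sum_nonneg fun c _ => ?_
  exact mul_nonneg (C.pr_nonneg y c) (mul_nonneg (ha c) (h _))

lemma T_one_one : C.T (fun _ => (1 : ℝ)) 1 = 1 := by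
  ext y; simp only [T_real_apply, Pi.one_apply, mul_one]; exact C.sum_pr y

lemma kill_mono {f g : Y → ℝ} (h : ∀ y, f y ≤ g y) (y : Y) : C.kill f y ≤ C.kill g y := by
  unfold kill; split_ifs; exacts [le_rfl, h y]

lemma kill_le {f : Y → ℝ} (h : ∀ y, 0 ≤ f y) (y : Y) : C.kill f y ≤ f y := by
  unfold kill; split_ifs; exacts [h y, le_rfl]

lemma kill_nonneg {f : Y → ℝ} (h : ∀ y, 0 ≤ f y) (y : Y) : 0 ≤ C.kill f y := by
  unfold kill; split_ifs; exacts [le_rfl, h y]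

lemma ind_nonneg (y : Y) : (0 : ℝ) ≤ C.ind y := by
  unfold ind; split_ifs <;> simp

lemma tail_nonneg (n : ℕ) (y : Y) : 0 ≤ C.tail n y := by
  induction n generalizing y with
  | zero => simp [tail]
  | succ n ih =>
    rw [tail_succ]
    exact C.T_nonneg (fun _ => zero_le_one) (C.kill_nonneg ih) y

lemma tail_le_one (n : ℕ) (y : Y) : C.tail n y ≤ 1 := by
  induction n generalizing y with
  | zero => simp [tail]
  | succ n ih =>
    rw [tail_succ]
    refine (C.T_mono (fun _ => zero_le_one)
      (fun y => (C.kill_le (C.tail_nonneg n) y).trans (ih y)) y).trans_eq ?_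
    exact congrFun C.T_one_one y

lemma tail_add_length_le (b : List Bool) (hb : b ≠ []) (y : Y) (hy : b.foldl C.step y = C.y0)
    {n : ℕ} {B : ℝ} (hB : ∀ y, C.tail n y ≤ B) :
    C.tail (b.length + n) y ≤ (1 - C.wt (fun _ => (1 : ℝ)) y b) * B := by
  have hB0 : 0 ≤ B := (C.tail_nonneg n C.y0).trans (hB C.y0)
  have hmono : ∀ m y, C.tail (m + n) y ≤ B := by
    intro m
    induction m with
    | zero => simpa using hB
    | succ m ih =>
      intro y
      rw [show m + 1 + n = m + n + 1 by ring, tail_succ]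
      refine (C.T_mono (fun _ => zero_le_one)
        (fun y => (C.kill_le (C.tail_nonneg _) y).trans (ih y)) y).trans_eq ?_
      simp only [T_real_apply, one_mul, ← Finset.sum_mul, C.sum_pr]
  induction b generalizing y with
  | nil => exact absurd rfl hb
  | cons c b ih =>
    have hs := C.sum_pr y
    rw [sum_bool_eq (𝕜 := ℝ) c] at hs
    rw [show (c :: b).length + n = (b.length + n) + 1 by simp; ring, tail_succ, T_real_apply,
      sum_bool_eq (𝕜 := ℝ) c]
    have h2 : C.kill (C.tail (b.length + n)) (C.step y !c) ≤ B :=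
      (C.kill_le (C.tail_nonneg _) _).trans (hmono _ _)
    have h1 : C.kill (C.tail (b.length + n)) (C.step y c) ≤
        (1 - C.wt (fun _ => (1 : ℝ)) (C.step y c) b) * B := by
      rcases eq_or_ne b [] with rfl | hb'
      · have : C.step y c = C.y0 := hy
        simp [kill, this, wt]
      · exact (C.kill_le (C.tail_nonneg _) _).trans (ih hb' _ hy)
    simp only [wt, one_mul, RCLike.ofReal_real_eq_id, id]
    have := C.pr_nonneg y c
    have := C.pr_nonneg y !c
    calc _ ≤ C.pr y c * ((1 - C.wt (fun _ => (1 : ℝ)) (C.step y c) b) * B)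
          + C.pr y (!c) * B := by gcongr
      _ = _ := by rw [eq_sub_of_add_eq' hs]; ring

/-- The first hitting time of `y0` has exponentially small tails, uniformly in the
initial state. -/
lemma exists_tail_le : ∃ K ρ : ℝ, 0 < K ∧ 0 < ρ ∧ ρ < 1 ∧ ∀ n y, C.tail n y ≤ K * ρ ^ n := by
  set N := C.u.length with hN
  have hN0 : N ≠ 0 := by simpa [hN] using C.u_ne
  have hδ := C.δ_pos
  set q : ℝ := 1 - (C.δ ^ N) / 2 with hq
  have hδN : 0 < C.δ ^ N := by positivity
  have hle : C.δ ^ N ≤ 1 := by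
    have := (C.le_wt zero_le_one (fun _ => le_rfl) C.y0 C.u).trans (C.wt_one_le C.y0 C.u)
    simpa using this
  have hq0 : 0 < q := by linarith
  have hq1 : q < 1 := by linarith
  set ρ : ℝ := q ^ (1 / (N : ℝ)) with hρ
  have hρN : ρ ^ N = q := by
    rw [hρ, ← Real.rpow_natCast, ← Real.rpow_mul hq0.le]
    simp [hN0]
  have hρ0 : 0 < ρ := Real.rpow_pos_of_pos hq0 _
  have hρ1 : ρ < 1 := Real.rpow_lt_one hq0.le hq1 (by positivity)
  refine ⟨(ρ ^ N)⁻¹, ρ, by positivity, hρ0, hρ1, fun n => ?_⟩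
  induction n using Nat.strong_induction_on with
  | _ n ih =>
    intro y
    rcases lt_or_ge n N with hn | hn
    · refine (C.tail_le_one n y).trans ?_
      rw [inv_mul_eq_div, one_le_div (by positivity)]
      exact pow_le_pow_of_le_one hρ0.le hρ1.le hn.le
    · obtain ⟨m, rfl⟩ := Nat.exists_eq_add_of_le hn
      have h := C.tail_add_length_le C.u C.u_ne y (C.foldl_u y) (ih m (by omega))
      refine h.trans ?_
      rw [pow_add, hρN]
      have h2 := C.le_wt zero_le_one (fun _ => le_rfl) y C.u (a := fun _ => (1 : ℝ))
      rw [mul_one, ← hN] at h2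
      calc _ ≤ q * (q⁻¹ * ρ ^ m) := by gcongr; linarith
        _ = _ := by ring

lemma G_one_le_tail (n : ℕ) (y : Y) : C.G (fun _ => (1 : ℝ)) n y ≤ C.tail n y := by
  induction n generalizing y with
  | zero =>
    refine (C.T_mono (g := 1) (fun _ => zero_le_one) (fun y => ?_) y).trans_eq
      (congrFun C.T_one_one y)
    unfold ind; split_ifs <;> simp
  | succ n ih =>
    rw [G_succ, tail_succ]
    exact C.T_mono (fun _ => zero_le_one) (C.kill_mono ih) y

lemma norm_kill_le {f : Y → 𝕜} {g : Y → ℝ} (h : ∀ y, ‖f y‖ ≤ g y) (y : Y) :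
    ‖C.kill f y‖ ≤ C.kill g y := by
  unfold kill; split_ifs; exacts [by simp, h y]

lemma norm_ind (y : Y) : ‖(C.ind y : 𝕜)‖ = C.ind y := by
  unfold ind; split_ifs <;> simp

lemma kill_smul (k : 𝕜) (f : Y → 𝕜) : C.kill (k • f) = k • C.kill f := by
  ext y; simp only [kill, Pi.smul_apply]; split_ifs <;> simp

lemma kill_sub (f g : Y → 𝕜) : C.kill (f - g) = C.kill f - C.kill g := by
  ext y; simp only [kill, Pi.sub_apply]; split_ifs <;> simp

lemma T_const (r : ℝ) (f : Y → ℝ) : C.T (fun _ => r) f = r • C.T (fun _ => (1 : ℝ)) f := by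
  ext y; simp only [T_real_apply, Pi.smul_apply, smul_eq_mul, Finset.mul_sum]
  exact Finset.sum_congr rfl fun c _ => by ring

lemma norm_G_le {a : Bool → 𝕜} {r : ℝ} (ha : ∀ c, ‖a c‖ ≤ r) (n : ℕ) (y : Y) :
    ‖C.G a n y‖ ≤ r ^ (n + 1) * C.G (fun _ => (1 : ℝ)) n y := by
  induction n generalizing y with
  | zero =>
    refine (C.norm_T_le ha (fun y => (C.norm_ind y).le) y).trans_eq ?_
    rw [T_const]; simp [G_zero]
  | succ n ih =>
    rw [G_succ]
    refine (C.norm_T_le ha (C.norm_kill_le ih) y).trans_eq ?_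
    change C.T _ (C.kill (r ^ (n + 1) • C.G (fun _ => (1 : ℝ)) n)) y = _
    rw [T_const, kill_smul, T_smul, ← G_succ]
    simp only [Pi.smul_apply, smul_eq_mul]; ring

lemma T_sub_T (a b : Bool → 𝕜) (f g : Y → 𝕜) :
    C.T a f - C.T b g = C.T a (f - g) + C.T (a - b) g := by
  ext y
  simp only [T, Pi.sub_apply, Pi.add_apply, ← Finset.sum_sub_distrib, ← Finset.sum_add_distrib]
  exact Finset.sum_congr rfl fun c _ => by ring

lemma norm_G_sub_G_le {a b : Bool → 𝕜} {r d : ℝ} (ha : ∀ c, ‖a c‖ ≤ r) (hb : ∀ c, ‖b c‖ ≤ r)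
    (hd : ∀ c, ‖a c - b c‖ ≤ d) (n : ℕ) (y : Y) :
    ‖C.G a n y - C.G b n y‖ ≤ d * ((n + 1) * r ^ n * C.G (fun _ => (1 : ℝ)) n y) := by
  induction n generalizing y with
  | zero =>
    have h := congrFun (C.T_sub_T a b (C.ind : Y → 𝕜) C.ind) y
    simp only [Pi.sub_apply, Pi.add_apply, sub_self] at h
    rw [G_zero, G_zero, h]
    have h0 : C.T a (0 : Y → 𝕜) y = 0 := by simp [T]
    rw [h0, zero_add]
    refine (C.norm_T_le (b := fun _ => d) hd (fun y => (C.norm_ind y).le) y).trans_eq ?_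
    rw [T_const]; simp [G_zero]
  | succ n ih =>
    have h := congrFun (C.T_sub_T a b (C.kill (C.G a n)) (C.kill (C.G b n))) y
    rw [← kill_sub] at h
    rw [G_succ, G_succ, ← Pi.sub_apply, h]
    refine (norm_add_le _ _).trans ?_
    have h1 := C.norm_T_le ha (C.norm_kill_le (f := C.G a n - C.G b n) ih) y
    have h2 := C.norm_T_le (a := a - b) (b := fun _ => d) hd
      (C.norm_kill_le (C.norm_G_le hb n)) y
    refine (add_le_add h1 h2).trans_eq ?_
    have e1 : (fun y => d * ((n + 1) * r ^ n * C.G (fun _ => (1 : ℝ)) n y)) =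
        (d * ((n + 1) * r ^ n)) • C.G (fun _ => (1 : ℝ)) n := by
      ext y; simp [mul_assoc]
    have e2 : (fun y => r ^ (n + 1) * C.G (fun _ => (1 : ℝ)) n y) =
        (r ^ (n + 1)) • C.G (fun _ => (1 : ℝ)) n := by
      ext y; simp
    rw [e1, e2, T_const, T_const C d, kill_smul, kill_smul, T_smul, T_smul, ← G_succ]
    simp only [Pi.smul_apply, smul_eq_mul]; push_cast; ring

/-- The geometric rate of the tails of the hitting time of `y0`. -/
def rate : ℝ := C.exists_tail_le.choose_spec.choose

/-- The constant in the geometric bound for the tails of the hitting time of `y0`. -/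
def rateConst : ℝ := C.exists_tail_le.choose

lemma rateConst_pos : 0 < C.rateConst := C.exists_tail_le.choose_spec.choose_spec.1

lemma rate_pos : 0 < C.rate := C.exists_tail_le.choose_spec.choose_spec.2.1

lemma rate_lt_one : C.rate < 1 := C.exists_tail_le.choose_spec.choose_spec.2.2.1

lemma tail_le (n : ℕ) (y : Y) : C.tail n y ≤ C.rateConst * C.rate ^ n :=
  C.exists_tail_le.choose_spec.choose_spec.2.2.2 n y

/-- The admissible size of the weights: for weights bounded by `rad`, the weighted hitting
probabilities are summable. -/
def rad : ℝ := 1 / Real.sqrt C.rate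

lemma one_lt_rad : 1 < C.rad := by
  rw [rad, lt_div_iff₀ (Real.sqrt_pos.2 C.rate_pos), one_mul, Real.sqrt_lt' one_pos]
  simpa using C.rate_lt_one

lemma rad_pos : 0 < C.rad := zero_lt_one.trans C.one_lt_rad

lemma rad_mul_rate_lt_one : C.rad * C.rate < 1 := by
  have h := C.rate_pos
  rw [rad, one_div, inv_mul_eq_div, Real.div_sqrt, Real.sqrt_lt' one_pos]
  simpa using C.rate_lt_one

lemma rad_mul_rate_nonneg : 0 ≤ C.rad * C.rate := (mul_pos C.rad_pos C.rate_pos).le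

/-- A summable bound for the weighted hitting probabilities. -/
def bd (n : ℕ) : ℝ := C.rateConst * C.rad * (C.rad * C.rate) ^ n

lemma summable_bd : Summable C.bd :=
  (summable_geometric_of_lt_one C.rad_mul_rate_nonneg C.rad_mul_rate_lt_one).mul_left _

lemma norm_G_le_bd {a : Bool → 𝕜} (ha : ∀ c, ‖a c‖ ≤ C.rad) (n : ℕ) (y : Y) :
    ‖C.G a n y‖ ≤ C.bd n := by
  refine (C.norm_G_le ha n y).trans ?_
  have := C.rad_pos
  calc _ ≤ C.rad ^ (n + 1) * (C.rateConst * C.rate ^ n) := by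
        gcongr; exact (C.G_one_le_tail n y).trans (C.tail_le n y)
    _ = C.bd n := by rw [bd, mul_pow]; ring

lemma summable_G {a : Bool → 𝕜} (ha : ∀ c, ‖a c‖ ≤ C.rad) (y : Y) :
    Summable fun n => C.G a n y :=
  C.summable_bd.of_norm_bounded fun n => C.norm_G_le_bd ha n y

/-- The generating function of the hitting time of `y0`. -/
def h (a : Bool → 𝕜) (y : Y) : 𝕜 := ∑' n, C.G a n y

lemma norm_h_le {a : Bool → 𝕜} (ha : ∀ c, ‖a c‖ ≤ C.rad) (y : Y) :
    ‖C.h a y‖ ≤ ∑' n, C.bd n :=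
  tsum_of_norm_bounded C.summable_bd.hasSum fun n => C.norm_G_le_bd ha n y

lemma norm_h_sub_h_le : ∃ K : ℝ, 0 ≤ K ∧ ∀ (a b : Bool → 𝕜) (d : ℝ), (∀ c, ‖a c‖ ≤ C.rad) →
    (∀ c, ‖b c‖ ≤ C.rad) → (∀ c, ‖a c - b c‖ ≤ d) → ∀ y, ‖C.h a y - C.h b y‖ ≤ d * K := by
  have hs : Summable fun n : ℕ => C.rateConst * ((n + 1 : ℝ) * (C.rad * C.rate) ^ n) := by
    refine Summable.mul_left _ ?_
    have h1 := summable_pow_mul_geometric_of_norm_lt_one 1 (r := C.rad * C.rate)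
      (by rw [Real.norm_eq_abs, abs_of_nonneg C.rad_mul_rate_nonneg]; exact C.rad_mul_rate_lt_one)
    have h2 := summable_geometric_of_lt_one C.rad_mul_rate_nonneg C.rad_mul_rate_lt_one
    refine (h1.add h2).congr fun n => by simp; ring
  have h0 : ∀ n : ℕ, 0 ≤ C.rateConst * ((n + 1 : ℝ) * (C.rad * C.rate) ^ n) := fun n => by
    have := C.rateConst_pos; have := C.rad_mul_rate_nonneg; positivity
  refine ⟨∑' n : ℕ, C.rateConst * ((n + 1 : ℝ) * (C.rad * C.rate) ^ n), tsum_nonneg h0,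
    fun a b d ha hb hd y => ?_⟩
  have hd0 : 0 ≤ d := (norm_nonneg _).trans (hd true)
  rw [h, h, ← (C.summable_G ha y).tsum_sub (C.summable_G hb y)]
  refine tsum_of_norm_bounded (hs.hasSum.mul_left d) fun n => ?_
  refine (C.norm_G_sub_G_le ha hb hd n y).trans ?_
  have := C.rad_pos
  calc _ ≤ d * ((n + 1) * C.rad ^ n * (C.rateConst * C.rate ^ n)) := by
        gcongr; exact (C.G_one_le_tail n y).trans (C.tail_le n y)
    _ = _ := by rw [mul_pow]; ring

/-- The fixed point equation of the generating function. -/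
lemma h_eq {a : Bool → 𝕜} (ha : ∀ c, ‖a c‖ ≤ C.rad) :
    C.h a = C.T a (C.h a) + (1 - C.h a C.y0) • C.T a C.ind := by
  have hk : C.h a + (1 - C.h a C.y0) • C.ind = C.ind + C.kill (C.h a) := by
    ext y
    simp only [Pi.add_apply, Pi.smul_apply, ind, kill]
    split_ifs with hy
    · subst hy; simp
    · simp
  rw [← T_smul, ← T_add, hk, T_add]
  ext y
  rw [h, (C.summable_G ha y).tsum_eq_zero_add, Pi.add_apply, G_zero]
  congr 1
  simp only [G_succ, T]
  rw [Summable.tsum_finsetSum]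
  · refine Finset.sum_congr rfl fun c _ => ?_
    rw [tsum_mul_left, tsum_mul_left]
    congr 2
    unfold kill
    split_ifs
    · simp
    · rfl
  · intro c _
    refine Summable.mul_left _ (Summable.mul_left _ ?_)
    unfold kill
    split_ifs
    · exact summable_zero
    · exact C.summable_G ha _

/-- The generating function is almost a fixed point of the iterated transfer operator. -/
lemma norm_iterate_T_h_sub_h_le {a : Bool → 𝕜} (ha : ∀ c, ‖a c‖ ≤ C.rad) {B : ℝ} {n : ℕ}
    (hB : ∀ j ≤ n, ∀ y, ‖(C.T a)^[j] C.ind y‖ ≤ B) (y : Y) :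
    ‖(C.T a)^[n] (C.h a) y - C.h a y‖ ≤ n * (‖1 - C.h a C.y0‖ * B) := by
  induction n with
  | zero => simp
  | succ n ih =>
    have e : (C.T a)^[n + 1] (C.h a) =
        (C.T a)^[n] (C.h a) - (1 - C.h a C.y0) • (C.T a)^[n + 1] C.ind := by
      have h1 : C.T a (C.h a) = C.h a - (1 - C.h a C.y0) • C.T a C.ind :=
        eq_sub_of_add_eq (C.h_eq ha).symm
      rw [Function.iterate_succ_apply, h1, iterate_T_sub, iterate_T_smul,
        ← Function.iterate_succ_apply]
    rw [e]
    have h2 := ih fun j hj => hB j (by omega)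
    have h3 : ‖(1 - C.h a C.y0) * (C.T a)^[n + 1] C.ind y‖ ≤ ‖1 - C.h a C.y0‖ * B := by
      rw [norm_mul]; gcongr; exact hB _ le_rfl y
    simp only [Pi.sub_apply, Pi.smul_apply, smul_eq_mul]
    calc _ = ‖((C.T a)^[n] (C.h a) y - C.h a y) - (1 - C.h a C.y0) * (C.T a)^[n + 1] C.ind y‖ := by
          congr 1; ring
      _ ≤ _ := (norm_sub_le _ _).trans (add_le_add h2 h3)
      _ = _ := by push_cast; ring

lemma T_ofReal (a : Bool → ℝ) (f : Y → ℝ) :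
    C.T (fun c => (a c : ℂ)) (fun y => (f y : ℂ)) = fun y => ((C.T a f y : ℝ) : ℂ) := by
  ext y; simp [T]

lemma iterate_T_ofReal (a : Bool → ℝ) (n : ℕ) (f : Y → ℝ) :
    (C.T fun c => (a c : ℂ))^[n] (fun y => (f y : ℂ)) =
      fun y => (((C.T a)^[n] f y : ℝ) : ℂ) := by
  induction n generalizing f with
  | zero => rfl
  | succ n ih => rw [Function.iterate_succ_apply, T_ofReal, ih]; rfl

lemma G_ofReal (a : Bool → ℝ) (n : ℕ) :
    C.G (fun c => (a c : ℂ)) n = fun y => ((C.G a n y : ℝ) : ℂ) := by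
  induction n with
  | zero =>
    rw [G_zero, G_zero, ← T_ofReal]; congr 1; ext y; simp only [ind]; split_ifs <;> simp
  | succ n ih =>
    rw [G_succ, G_succ, ih, ← T_ofReal]; congr 1; ext y; simp only [kill]; split_ifs <;> simp

lemma h_ofReal (a : Bool → ℝ) (y : Y) : C.h (fun c => (a c : ℂ)) y = (C.h a y : ℝ) := by
  simp only [h, G_ofReal, Complex.ofReal_tsum]

lemma T_h_eq {a : Bool → 𝕜} (ha : ∀ c, ‖a c‖ ≤ C.rad) (h1 : C.h a C.y0 = 1) :
    C.T a (C.h a) = C.h a := by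
  conv_rhs => rw [C.h_eq ha]
  simp [h1]

lemma iterate_T_h_eq {a : Bool → 𝕜} (ha : ∀ c, ‖a c‖ ≤ C.rad) (h1 : C.h a C.y0 = 1) (n : ℕ) :
    (C.T a)^[n] (C.h a) = C.h a :=
  Function.iterate_fixed (C.T_h_eq ha h1) n

lemma G_nonneg {a : Bool → ℝ} (ha : ∀ c, 0 ≤ a c) (n : ℕ) (y : Y) : 0 ≤ C.G a n y := by
  induction n generalizing y with
  | zero => exact C.T_nonneg ha C.ind_nonneg y
  | succ n ih => rw [G_succ]; exact C.T_nonneg ha (C.kill_nonneg ih) y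

lemma h_nonneg {a : Bool → ℝ} (ha : ∀ c, 0 ≤ a c) (y : Y) : 0 ≤ C.h a y :=
  tsum_nonneg fun n => C.G_nonneg ha n y

lemma wt_mul_le_iterate_T {a : Bool → ℝ} (ha : ∀ c, 0 ≤ a c) {f : Y → ℝ} (hf : ∀ y, 0 ≤ f y)
    (y : Y) : C.wt a y C.u * f C.y0 ≤ (C.T a)^[C.u.length] f y := by
  have hn : ∀ c, ‖a c‖ = a c := fun c => by rw [Real.norm_eq_abs, abs_of_nonneg (ha c)]
  have h2 := C.norm_iterate_T_sub_wt_le a C.u (f := f) (g := f)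
    (fun y => by rw [Real.norm_eq_abs, abs_of_nonneg (hf y)]) y
  have h3 := (norm_nonneg _).trans h2
  simp only [C.norm_wt, hn, C.foldl_u] at h3
  linarith

/-- A uniform lower bound for the generating function. -/
lemma le_h {a : Bool → ℝ} {r : ℝ} (hr : 0 ≤ r) (hra : ∀ c, r ≤ a c) (ha : ∀ c, a c ≤ C.rad)
    (h1 : C.h a C.y0 = 1) (y : Y) : (C.δ * r) ^ C.u.length ≤ C.h a y := by
  have ha0 : ∀ c, 0 ≤ a c := fun c => hr.trans (hra c)
  have h3 := C.wt_mul_le_iterate_T ha0 (C.h_nonneg ha0) y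
  rw [C.iterate_T_h_eq (fun c => by rw [Real.norm_eq_abs, abs_of_nonneg (ha0 c)]; exact ha c) h1,
    h1, mul_one] at h3
  exact (C.le_wt hr hra y C.u).trans h3

lemma wt_mul (a : Bool → ℝ) (e : Bool → ℂ) (y : Y) (b : List Bool) :
    C.wt (fun c => (a c : ℂ) * e c) y b = (C.wt a y b : ℝ) * (b.map e).prod := by
  induction b generalizing y with
  | nil => simp [wt]
  | cons c b ih => simp [wt, ih]; ring

lemma norm_one_add_exp_le {θ : ℝ} (hθ : |θ| ≤ Real.pi) :
    ‖1 + Complex.exp (θ * Complex.I)‖ ≤ 2 - θ ^ 2 / Real.pi ^ 2 := by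
  have h1 : 1 + Complex.exp (θ * Complex.I) =
      Complex.exp ((θ / 2 : ℝ) * Complex.I) * (2 * Real.cos (θ / 2) : ℝ) := by
    push_cast
    rw [Complex.two_cos, mul_add, ← Complex.exp_add, ← Complex.exp_add]
    ring_nf
    simp [add_comm]
  have h2 := abs_le.1 hθ
  have h3 : 0 ≤ Real.cos (θ / 2) :=
    Real.cos_nonneg_of_mem_Icc ⟨by linarith, by linarith⟩
  have h4 : Real.cos (θ / 2) ≤ 1 - 2 / Real.pi ^ 2 * (θ / 2) ^ 2 :=
    Real.cos_le_one_sub_mul_cos_sq (by rw [abs_div, abs_two]; linarith [abs_nonneg θ])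
  rw [h1, norm_mul, Complex.norm_exp_ofReal_mul_I, one_mul, Complex.norm_real, Real.norm_eq_abs,
    abs_of_nonneg (by positivity)]
  calc 2 * Real.cos (θ / 2) ≤ 2 * (1 - 2 / Real.pi ^ 2 * (θ / 2) ^ 2) := by gcongr
    _ = _ := by ring

lemma norm_add_mul_exp_le {θ m x y : ℝ} (hθ : |θ| ≤ Real.pi) (hm : 0 ≤ m) (hx : m ≤ x)
    (hy : m ≤ y) :
    ‖(x : ℂ) + y * Complex.exp (θ * Complex.I)‖ ≤ x + y - m * (θ ^ 2 / Real.pi ^ 2) := by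
  have e : (x : ℂ) + y * Complex.exp (θ * Complex.I) =
      ((x - m : ℝ) : ℂ) + ((y - m : ℝ) : ℂ) * Complex.exp (θ * Complex.I) +
        (m : ℂ) * (1 + Complex.exp (θ * Complex.I)) := by push_cast; ring
  rw [e]
  refine (norm_add₃_le).trans ?_
  rw [norm_mul, norm_mul, Complex.norm_exp_ofReal_mul_I, Complex.norm_real, Complex.norm_real,
    Complex.norm_real, Real.norm_eq_abs, Real.norm_eq_abs, Real.norm_eq_abs,
    abs_of_nonneg (sub_nonneg.2 hx), abs_of_nonneg (sub_nonneg.2 hy), abs_of_nonneg hm]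
  have := mul_le_mul_of_nonneg_left (norm_one_add_exp_le hθ) hm
  linarith

/-- The weights `a`, with the bit `1` twisted by the phase `θ`. -/
def twist (a : Bool → ℝ) (θ : ℝ) (c : Bool) : ℂ :=
  (a c : ℂ) * (if c then Complex.exp (θ * Complex.I) else 1)

lemma norm_twist {a : Bool → ℝ} (ha : ∀ c, 0 ≤ a c) (θ : ℝ) (c : Bool) :
    ‖twist a θ c‖ = a c := by
  cases c <;> simp [twist, Complex.norm_exp_ofReal_mul_I, abs_of_nonneg (ha _)]

lemma norm_prod_phase (θ : ℝ) (b : List Bool) :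
    ‖(b.map fun c => if c then Complex.exp (θ * Complex.I) else 1).prod‖ = 1 := by
  induction b with
  | nil => simp
  | cons c b ih => cases c <;> simp [ih, Complex.norm_exp_ofReal_mul_I]

/-- The constant `(δ r) ^ (|u| + 1)`, a lower bound for the weights of the words
`c :: u`. -/
def lowerWt (r : ℝ) : ℝ := (C.δ * r) ^ (C.u.length + 1)

/-- Over a block of length `|u| + 1` the twisted operator contracts. -/
lemma norm_iterate_T_twist_block_le {a : Bool → ℝ} {r : ℝ} (hr : 0 < r) (hra : ∀ c, r ≤ a c)
    (ha : ∀ c, a c ≤ C.rad) (h1 : C.h a C.y0 = 1) {θ : ℝ} (hθ : |θ| ≤ Real.pi) {f : Y → ℂ}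
    {B : ℝ} (hf : ∀ y, ‖f y‖ ≤ B * C.h a y) (y : Y) :
    ‖(C.T (twist a θ))^[C.u.length + 1] f y‖ ≤
      B * (C.h a y - C.lowerWt r * (θ ^ 2 / Real.pi ^ 2)) := by
  have ha0 : ∀ c, 0 ≤ a c := fun c => hr.le.trans (hra c)
  have han : ∀ c, ‖a c‖ ≤ C.rad := fun c => by
    rw [Real.norm_eq_abs, abs_of_nonneg (ha0 c)]; exact ha c
  have hB : 0 ≤ B := by
    have := (norm_nonneg _).trans (hf C.y0)
    rwa [h1, mul_one] at this
  have hfy : ‖f C.y0‖ ≤ B := by simpa [h1] using hf C.y0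
  set ω : Bool → ℝ := fun c => C.wt a (C.step y c) C.u with hω
  set ph : ℂ := (C.u.map fun c => if c then Complex.exp (θ * Complex.I) else 1).prod with hph
  have hwt : ∀ c, C.wt (twist a θ) (C.step y c) C.u = (ω c : ℂ) * ph := fun c =>
    C.wt_mul a _ _ _
  have hω0 : ∀ c, (C.δ * r) ^ C.u.length ≤ ω c := fun c => C.le_wt hr.le hra _ _
  have hδ := C.δ_pos
  have hωnn : ∀ c, 0 ≤ ω c := fun c => le_trans (by positivity) (hω0 c)
  have herr : ∀ c, ‖(C.T (twist a θ))^[C.u.length] f (C.step y c) - (ω c : ℂ) * ph * f C.y0‖ ≤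
      B * C.h a (C.step y c) - ω c * B := by
    intro c
    have h := C.norm_iterate_T_sub_wt_le (twist a θ) C.u (f := f) (g := B • C.h a) hf (C.step y c)
    rw [C.foldl_u, hwt, iterate_T_smul] at h
    simp only [norm_twist ha0] at h
    rw [C.iterate_T_h_eq han h1] at h
    simpa [h1, hph, norm_prod_phase, abs_of_nonneg (hωnn c)] using h
  set β : Bool → ℝ := fun c => C.pr y c * (a c * ω c) with hβ
  have hβm : ∀ c, C.lowerWt r ≤ β c := by
    intro c
    have := C.pr_nonneg y c
    have := ha0 c
    calc C.lowerWt r = C.δ * (r * (C.δ * r) ^ C.u.length) := by rw [lowerWt]; ring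
      _ ≤ β c := by
        rw [hβ]; dsimp only
        gcongr
        exacts [C.le_pr y c, hra c, hω0 c]
  have hm0 : 0 ≤ C.lowerWt r := by rw [lowerWt]; positivity
  have hT : C.h a y = ∑ c, C.pr y c * (a c * C.h a (C.step y c)) := by
    conv_lhs => rw [← C.T_h_eq han h1]
    rfl
  have e : (C.T (twist a θ))^[C.u.length + 1] f y =
      ((β false : ℂ) + β true * Complex.exp (θ * Complex.I)) * (ph * f C.y0) +
      ∑ c, (C.pr y c : ℂ) * (twist a θ c * ((C.T (twist a θ))^[C.u.length] f (C.step y c) -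
        (ω c : ℂ) * ph * f C.y0)) := by
    rw [Function.iterate_succ_apply', T]
    simp only [Fintype.sum_bool, twist, hβ]
    push_cast
    simp only [Complex.coe_algebraMap]
    ring
  rw [e]
  refine (norm_add_le _ _).trans ?_
  have h2 : ‖((β false : ℂ) + β true * Complex.exp (θ * Complex.I)) * (ph * f C.y0)‖ ≤
      (β false + β true - C.lowerWt r * (θ ^ 2 / Real.pi ^ 2)) * B := by
    have h3 := norm_add_mul_exp_le hθ hm0 (hβm false) (hβm true)
    rw [norm_mul, norm_mul, hph, norm_prod_phase, one_mul]
    exact mul_le_mul h3 hfy (norm_nonneg _) ((norm_nonneg _).trans h3)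
  have h4 : ‖∑ c, (C.pr y c : ℂ) * (twist a θ c * ((C.T (twist a θ))^[C.u.length] f (C.step y c) -
        (ω c : ℂ) * ph * f C.y0))‖ ≤
      ∑ c, C.pr y c * (a c * (B * C.h a (C.step y c) - ω c * B)) := by
    refine (norm_sum_le _ _).trans (Finset.sum_le_sum fun c _ => ?_)
    rw [norm_mul, norm_mul, norm_twist ha0, Complex.norm_real, Real.norm_eq_abs,
      abs_of_nonneg (C.pr_nonneg y c)]
    have := C.pr_nonneg y c
    have := ha0 c
    gcongr
    exact herr c
  refine (add_le_add h2 h4).trans_eq ?_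
  rw [hT]
  simp only [Fintype.sum_bool, hβ]
  ring

lemma tsum_bd_pos : 0 < ∑' n, C.bd n := by
  have h1 := C.rateConst_pos
  have h2 := C.rad_pos
  have h3 := C.rate_pos
  refine C.summable_bd.tsum_pos (fun n => ?_) 0 ?_ <;> rw [bd] <;> positivity

/-- Gaussian domination of the twisted moment generating functions. -/
lemma exists_norm_iterate_T_twist_le {r : ℝ} (hr : 0 < r) : ∃ K κ : ℝ, 0 < K ∧ 0 < κ ∧
    ∀ a : Bool → ℝ, (∀ c, r ≤ a c) → (∀ c, a c ≤ C.rad) → C.h a C.y0 = 1 →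
    ∀ θ : ℝ, |θ| ≤ Real.pi → ∀ (n : ℕ) (y : Y),
      ‖(C.T (twist a θ))^[n] 1 y‖ ≤ K * Real.exp (-κ * n * θ ^ 2) := by
  set H := ∑' n, C.bd n with hH
  have hH0 : 0 < H := C.tsum_bd_pos
  have hδ := C.δ_pos
  have hpi := Real.pi_pos
  set N := C.u.length + 1 with hN
  have hN0 : (0 : ℝ) < N := by positivity
  set m : ℝ := C.lowerWt r with hm
  have hm0 : 0 < m := by rw [hm, lowerWt]; positivity
  set m' : ℝ := (C.δ * r) ^ C.u.length with hm'
  have hm'0 : 0 < m' := by positivity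
  set k : ℝ := m / (Real.pi ^ 2 * H) with hk
  have hk0 : 0 < k := by positivity
  refine ⟨m'⁻¹ * Real.exp (k * Real.pi ^ 2) * H, k / N, by positivity, by positivity,
    fun a hra ha h1 θ hθ n y => ?_⟩
  have ha0 : ∀ c, 0 ≤ a c := fun c => hr.le.trans (hra c)
  have hhH : ∀ y, C.h a y ≤ H := fun y => (le_abs_self _).trans (C.norm_h_le (fun c => by
    rw [Real.norm_eq_abs, abs_of_nonneg (ha0 c)]; exact ha c) y)
  have hh0 : ∀ y, m' ≤ C.h a y := C.le_h hr.le hra ha h1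
  set q : ℝ := k * θ ^ 2 with hq
  have hq0 : 0 ≤ q := by positivity
  have key : ∀ n y, ‖(C.T (twist a θ))^[n] 1 y‖ ≤
      m'⁻¹ * Real.exp (q * (1 - n / N)) * C.h a y := by
    intro n
    induction n using Nat.strong_induction_on with
    | _ n ih =>
      intro y
      rcases lt_or_ge n N with hn | hn
      · have h2 : ‖(C.T (twist a θ))^[n] 1 y‖ ≤ (C.T a)^[n] (m'⁻¹ • C.h a) y := by
          refine C.norm_iterate_T_le (fun c => (norm_twist ha0 θ c).le) n (fun y => ?_) y
          simp only [Pi.one_apply, norm_one, Pi.smul_apply, smul_eq_mul, inv_mul_eq_div]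
          rw [one_le_div hm'0]; exact hh0 y
        rw [iterate_T_smul, C.iterate_T_h_eq (fun c => by
          rw [Real.norm_eq_abs, abs_of_nonneg (ha0 c)]; exact ha c) h1] at h2
        refine h2.trans ?_
        have h3 : (1 : ℝ) ≤ Real.exp (q * (1 - n / N)) := by
          apply Real.one_le_exp
          have : (n : ℝ) / N ≤ 1 := by rw [div_le_one hN0]; exact_mod_cast hn.le
          have : 0 ≤ 1 - (n : ℝ) / N := by linarith
          positivity
        have h4 := hm'0.le.trans (hh0 y)
        simp only [Pi.smul_apply, smul_eq_mul]
        gcongr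
        exact le_mul_of_one_le_right (by positivity) h3
      · obtain ⟨j, rfl⟩ := Nat.exists_eq_add_of_le hn
        rw [Function.iterate_add_apply]
        refine (C.norm_iterate_T_twist_block_le hr hra ha h1 hθ (ih j (by omega)) y).trans ?_
        have h5 : C.h a y - m * (θ ^ 2 / Real.pi ^ 2) ≤ Real.exp (-q) * C.h a y := by
          have h6 : 1 - q ≤ Real.exp (-q) := by linarith [Real.add_one_le_exp (-q)]
          have h7 := hm'0.le.trans (hh0 y)
          have h8 : q * C.h a y ≤ m * (θ ^ 2 / Real.pi ^ 2) := by
            calc q * C.h a y ≤ q * H := by gcongr; exact hhH y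
              _ = _ := by rw [hq, hk]; field_simp
          nlinarith [mul_le_mul_of_nonneg_right h6 h7]
        have h9 : Real.exp (q * (1 - ((N + j : ℕ) : ℝ) / N)) =
            Real.exp (q * (1 - j / N)) * Real.exp (-q) := by
          rw [← Real.exp_add]; congr 1; push_cast; field_simp; ring
        rw [h9]
        calc _ ≤ m'⁻¹ * Real.exp (q * (1 - j / N)) * (Real.exp (-q) * C.h a y) := by gcongr
          _ = _ := by ring
  refine (key n y).trans ?_
  have h10 : Real.exp (q * (1 - n / N)) ≤
      Real.exp (k * Real.pi ^ 2) * Real.exp (-(k / N) * n * θ ^ 2) := by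
    rw [← Real.exp_add, Real.exp_le_exp]
    have : θ ^ 2 ≤ Real.pi ^ 2 := sq_le_sq' (by linarith [(abs_le.1 hθ).1]) (abs_le.1 hθ).2
    calc q * (1 - n / N) = k * θ ^ 2 + -(k / N) * n * θ ^ 2 := by rw [hq]; field_simp; ring
      _ ≤ _ := by gcongr
  calc _ ≤ m'⁻¹ * (Real.exp (k * Real.pi ^ 2) * Real.exp (-(k / N) * n * θ ^ 2)) * H := by
        have := hm'0.le.trans (hh0 y)
        gcongr
        exact hhH y
    _ = _ := by ring

lemma iterate_T_mono {a : Bool → ℝ} (ha : ∀ c, 0 ≤ a c) (n : ℕ) {f g : Y → ℝ}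
    (h : ∀ y, f y ≤ g y) (y : Y) : (C.T a)^[n] f y ≤ (C.T a)^[n] g y := by
  induction n generalizing f g with
  | zero => exact h y
  | succ n ih => exact ih (C.T_mono ha h)

/-- Mixing: the iterates of the critical transfer operator at the constant function converge
uniformly to a multiple of the eigenfunction. -/
lemma exists_abs_iterate_T_one_sub_le {r : ℝ} (hr : 0 < r) {a : Bool → ℝ} (hra : ∀ c, r ≤ a c)
    (ha : ∀ c, a c ≤ C.rad) (h1 : C.h a C.y0 = 1) :
    ∃ κ : ℝ, 0 < κ ∧ ∀ ε > 0, ∃ k, ∀ y, |(C.T a)^[k] 1 y - κ * C.h a y| ≤ ε := by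
  set H := ∑' n, C.bd n with hH
  have hH0 : 0 < H := C.tsum_bd_pos
  have hδ := C.δ_pos
  set m : ℝ := (C.δ * r) ^ C.u.length with hm
  have hm0 : 0 < m := by positivity
  have ha0 : ∀ c, 0 ≤ a c := fun c => hr.le.trans (hra c)
  have han : ∀ c, ‖a c‖ ≤ C.rad := fun c => by
    rw [Real.norm_eq_abs, abs_of_nonneg (ha0 c)]; exact ha c
  have hhH : ∀ y, C.h a y ≤ H := fun y => (le_abs_self _).trans (C.norm_h_le han y)
  have hh0 : ∀ y, m ≤ C.h a y := C.le_h hr.le hra ha h1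
  have hmH : m ≤ H := (hh0 C.y0).trans (hhH C.y0)
  set f : ℕ → Y → ℝ := fun k => (C.T a)^[k] 1 with hf
  have hlo : ∀ (lo : ℝ) (j k : ℕ), (∀ y, lo * C.h a y ≤ f k y) →
      ∀ y, lo * C.h a y ≤ f (j + k) y := by
    intro lo j k h y
    have := C.iterate_T_mono ha0 j (f := lo • C.h a) h y
    rwa [iterate_T_smul, C.iterate_T_h_eq han h1, ← Function.iterate_add_apply] at this
  have hhi : ∀ (hi : ℝ) (j k : ℕ), (∀ y, f k y ≤ hi * C.h a y) →
      ∀ y, f (j + k) y ≤ hi * C.h a y := by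
    intro hi j k h y
    have := C.iterate_T_mono ha0 j (g := hi • C.h a) h y
    rwa [iterate_T_smul, C.iterate_T_h_eq han h1, ← Function.iterate_add_apply] at this
  have hle : ∀ lo hi j k, (∀ y, lo * C.h a y ≤ f j y) → (∀ y, f k y ≤ hi * C.h a y) →
      lo ≤ hi := by
    intro lo hi j k hl hh
    have h2 := hlo lo k j hl C.y0
    have h3 := hhi hi j k hh C.y0
    rw [add_comm j k] at h3
    simpa [h1] using h2.trans h3
  set A : Set ℝ := {lo | ∃ k, ∀ y, lo * C.h a y ≤ f k y} with hA
  have hH0A : H⁻¹ ∈ A := ⟨0, fun y => by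
    simp only [hf, Function.iterate_zero, id, Pi.one_apply, inv_mul_eq_div]
    exact (div_le_one hH0).2 (hhH y)⟩
  have hinit : ∀ y, f 0 y ≤ m⁻¹ * C.h a y := fun y => by
    simp only [hf, Function.iterate_zero, id, Pi.one_apply, inv_mul_eq_div]
    exact (one_le_div hm0).2 (hh0 y)
  have hAb : BddAbove A := ⟨m⁻¹, fun lo ⟨k, hk⟩ => hle _ _ _ _ hk hinit⟩
  refine ⟨sSup A, (inv_pos.2 hH0).trans_le (le_csSup hAb hH0A), fun ε hε => ?_⟩
  set γ : ℝ := m / H with hγ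
  have hγ0 : 0 < γ := by positivity
  have hγ1 : γ ≤ 1 := (div_le_one hH0).2 hmH
  have hγh : ∀ y, ∀ t : ℝ, 0 ≤ t → γ * t * C.h a y ≤ C.wt a y C.u * t := by
    intro y t ht
    have h2 : m ≤ C.wt a y C.u := C.le_wt hr.le hra y C.u
    calc γ * t * C.h a y ≤ γ * t * H := by gcongr; exact hhH y
      _ = m * t := by rw [hγ]; field_simp
      _ ≤ _ := by gcongr
  have key : ∀ j : ℕ, ∃ k lo hi, (∀ y, lo * C.h a y ≤ f k y) ∧ (∀ y, f k y ≤ hi * C.h a y) ∧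
      hi - lo ≤ (1 - γ) ^ j * m⁻¹ := by
    intro j
    induction j with
    | zero => exact ⟨0, H⁻¹, m⁻¹, fun y => by
        simp only [hf, Function.iterate_zero, id, Pi.one_apply, inv_mul_eq_div]
        exact (div_le_one hH0).2 (hhH y), hinit, by
        rw [pow_zero, one_mul]; linarith [inv_pos.2 hH0]⟩
    | succ j ih =>
      obtain ⟨k, lo, hi, hl, hh, hd⟩ := ih
      have tl : lo ≤ f k C.y0 := by simpa [h1] using hl C.y0
      have th : f k C.y0 ≤ hi := by simpa [h1] using hh C.y0
      refine ⟨C.u.length + k, lo + γ * (f k C.y0 - lo), hi - γ * (hi - f k C.y0),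
        fun y => ?_, fun y => ?_, ?_⟩
      · have h2 := C.wt_mul_le_iterate_T ha0 (f := f k - lo • C.h a)
          (fun y => sub_nonneg.2 (hl y)) y
        rw [iterate_T_sub, iterate_T_smul, C.iterate_T_h_eq han h1] at h2
        have h3 := hγh y (f k C.y0 - lo) (sub_nonneg.2 tl)
        simp only [Pi.sub_apply, Pi.smul_apply, smul_eq_mul, h1, mul_one] at h2
        simp only [hf, Function.iterate_add_apply] at h2 h3 ⊢
        linarith
      · have h2 := C.wt_mul_le_iterate_T ha0 (f := hi • C.h a - f k)
          (fun y => sub_nonneg.2 (hh y)) y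
        rw [iterate_T_sub, iterate_T_smul, C.iterate_T_h_eq han h1] at h2
        have h3 := hγh y (hi - f k C.y0) (sub_nonneg.2 th)
        simp only [Pi.sub_apply, Pi.smul_apply, smul_eq_mul, h1, mul_one] at h2
        simp only [hf, Function.iterate_add_apply] at h2 h3 ⊢
        linarith
      · calc _ = (1 - γ) * (hi - lo) := by ring
          _ ≤ (1 - γ) * ((1 - γ) ^ j * m⁻¹) := by gcongr
          _ = _ := by ring
  have hlim : Tendsto (fun j : ℕ => (1 - γ) ^ j * m⁻¹ * H) atTop (𝓝 0) := by
    have := tendsto_pow_atTop_nhds_zero_of_lt_one (r := 1 - γ) (by linarith) (by linarith)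
    simpa using (this.mul_const m⁻¹).mul_const H
  obtain ⟨j, hj⟩ := (hlim.eventually (gt_mem_nhds hε)).exists
  obtain ⟨k, lo, hi, hl, hh, hd⟩ := key j
  refine ⟨k, fun y => ?_⟩
  have hlκ : lo ≤ sSup A := le_csSup hAb ⟨k, hl⟩
  have hκh : sSup A ≤ hi := csSup_le ⟨_, hH0A⟩ fun lo' ⟨k', hk'⟩ => hle _ _ _ _ hk' hh
  have hpos := hm0.le.trans (hh0 y)
  have h5 : (hi - lo) * C.h a y ≤ ε := by
    refine le_trans ?_ hj.le
    calc (hi - lo) * C.h a y ≤ (hi - lo) * H :=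
          mul_le_mul_of_nonneg_left (hhH y) (by linarith)
      _ ≤ _ := mul_le_mul_of_nonneg_right hd hH0.le
  have h6 := mul_le_mul_of_nonneg_right hlκ hpos
  have h7 := mul_le_mul_of_nonneg_right hκh hpos
  have h8 := hl y
  have h9 := hh y
  simp only [hf] at h8 h9
  rw [abs_le]
  constructor <;> linarith

lemma T_const_const (r s : ℝ) : C.T (fun _ => r) (fun _ => s) = fun _ => r * s := by
  ext y
  rw [T_real_apply, ← Finset.sum_mul, C.sum_pr, one_mul]

lemma norm_iterate_T_one_le {a : Bool → 𝕜} (ha : ∀ c, ‖a c‖ ≤ C.rad) (n : ℕ) (y : Y) :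
    ‖(C.T a)^[n] 1 y‖ ≤ C.rad ^ n := by
  induction n generalizing y with
  | zero => simp
  | succ n ih =>
    rw [Function.iterate_succ_apply']
    refine (C.norm_T_le ha ih y).trans_eq ?_
    rw [T_const_const, pow_succ']

lemma norm_iterate_T_one_sub_le {a b : Bool → 𝕜} {d : ℝ} (ha : ∀ c, ‖a c‖ ≤ C.rad)
    (hb : ∀ c, ‖b c‖ ≤ C.rad) (hd : ∀ c, ‖a c - b c‖ ≤ d) (n : ℕ) (y : Y) :
    ‖(C.T a)^[n] 1 y - (C.T b)^[n] 1 y‖ ≤ d * (n * C.rad ^ n) := by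
  have hd0 : 0 ≤ d := (norm_nonneg _).trans (hd true)
  induction n generalizing y with
  | zero => simp
  | succ n ih =>
    rw [Function.iterate_succ_apply', Function.iterate_succ_apply', ← Pi.sub_apply, T_sub_T]
    refine (norm_add_le _ _).trans ?_
    have h1 := C.norm_T_le ha (f := (C.T a)^[n] 1 - (C.T b)^[n] 1) ih y
    have h2 := C.norm_T_le (a := a - b) (b := fun _ => d) hd (C.norm_iterate_T_one_le hb n) y
    rw [T_const_const] at h1
    rw [T_const_const] at h2
    dsimp only at h1 h2
    refine (add_le_add h1 h2).trans ?_
    have h3 := pow_le_pow_right₀ C.one_lt_rad.le (Nat.le_succ n)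
    calc _ ≤ C.rad * (d * (n * C.rad ^ n)) + d * C.rad ^ (n + 1) := by gcongr
      _ = _ := by push_cast; ring

lemma norm_iterate_T_le_mul {a : Bool → 𝕜} {B : ℝ} {j : ℕ}
    (hB : ∀ y, (C.T fun c => ‖a c‖)^[j] 1 y ≤ B) {f : Y → 𝕜} {ε : ℝ} (hε : 0 ≤ ε)
    (hf : ∀ y, ‖f y‖ ≤ ε) (y : Y) : ‖(C.T a)^[j] f y‖ ≤ ε * B := by
  have h := C.norm_iterate_T_le (a := a) (fun c => le_rfl) j (g := ε • 1)
    (fun y => by simpa using hf y) y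
  rw [iterate_T_smul] at h
  exact h.trans (mul_le_mul_of_nonneg_left (hB y) hε)

/-- Asymptotics of the iterated transfer operators along weights which approach critical
weights and which are themselves almost critical. -/
lemma exists_tendsto_iterate_T_one {r : ℝ} (hr : 0 < r) {a0 : Bool → ℝ} (hra : ∀ c, r ≤ a0 c)
    (ha0 : ∀ c, a0 c ≤ C.rad) (h1 : C.h a0 C.y0 = 1) :
    ∃ κ : ℝ, 0 < κ ∧ ∀ (a : ℕ → Bool → ℂ) (B : ℝ), (∀ᶠ n in atTop, ∀ c, ‖a n c‖ ≤ C.rad) →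
      (∀ c, Tendsto (fun n => a n c) atTop (𝓝 (a0 c : ℂ))) →
      (∀ᶠ n in atTop, ∀ j ≤ n, ∀ y, (C.T fun c => ‖a n c‖)^[j] 1 y ≤ B) →
      Tendsto (fun n : ℕ => n * ‖1 - C.h (a n) C.y0‖) atTop (𝓝 0) →
      ∀ y, Tendsto (fun n => (C.T (a n))^[n] 1 y) atTop (𝓝 ((κ * C.h a0 y : ℝ) : ℂ)) := by
  obtain ⟨κ, hκ, hmix⟩ := C.exists_abs_iterate_T_one_sub_le hr hra ha0 h1
  refine ⟨κ, hκ, fun a B hrad hlim hB hψ y => ?_⟩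
  obtain ⟨K, hK0, hK⟩ := C.norm_h_sub_h_le (𝕜 := ℂ)
  have ha0n : ∀ c, ‖(a0 c : ℂ)‖ ≤ C.rad := fun c => by
    rw [Complex.norm_real, Real.norm_eq_abs, abs_of_nonneg (hr.le.trans (hra c))]; exact ha0 c
  set d : ℕ → ℝ := fun n => ∑ c, ‖a n c - a0 c‖ with hd
  have hdc : ∀ n c, ‖a n c - a0 c‖ ≤ d n := fun n c =>
    Finset.single_le_sum (f := fun c => ‖a n c - a0 c‖) (fun c _ => norm_nonneg _)
      (Finset.mem_univ c)
  have hd0 : ∀ n, 0 ≤ d n := fun n => Finset.sum_nonneg fun c _ => norm_nonneg _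
  have hdl : Tendsto d atTop (𝓝 0) := by
    have : Tendsto d atTop (𝓝 (∑ c : Bool, (0 : ℝ))) :=
      tendsto_finsetSum _ fun c _ => by
        have := ((hlim c).sub_const (a0 c : ℂ)).norm
        simpa using this
    simpa using this
  have hB0 : 0 ≤ B := by
    obtain ⟨n, hn⟩ := hB.exists
    have := hn 0 (Nat.zero_le n) C.y0
    simp only [Function.iterate_zero, id, Pi.one_apply] at this
    linarith
  rw [Metric.tendsto_atTop']
  intro ε hε
  obtain ⟨k, hk⟩ := hmix (ε / (2 * (B + 1))) (by positivity)
  set e : ℕ → ℝ := fun n => d n * (k * C.rad ^ k) * B + κ * (d n * K * B) +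
    κ * (n * ‖1 - C.h (a n) C.y0‖ * B) + κ * (d n * K) with he
  have hel : Tendsto e atTop (𝓝 0) := by
    have := ((((hdl.mul_const (k * C.rad ^ k)).mul_const B).add
      (((hdl.mul_const K).mul_const B).const_mul κ)).add
      ((hψ.mul_const B).const_mul κ)).add ((hdl.mul_const K).const_mul κ)
    simpa using this
  obtain ⟨n0, hn0⟩ := eventually_atTop.1 ((hrad.and (hB.and (eventually_ge_atTop k))).and
    (hel.eventually (gt_mem_nhds (half_pos hε))))
  refine ⟨n0, fun n hn => ?_⟩
  obtain ⟨⟨hradn, hBn, hkn⟩, hen⟩ := hn0 n hn.le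
  obtain ⟨j, rfl⟩ := Nat.exists_eq_add_of_le' hkn
  set n := j + k with hn'
  set A := C.T (a n) with hA
  set hc : Y → ℂ := C.h (fun c => (a0 c : ℂ)) with hhc
  set one0 : Y → ℂ := (C.T fun c => (a0 c : ℂ))^[k] 1 with hone0
  have hone : one0 = fun y => (((C.T a0)^[k] 1 y : ℝ) : ℂ) := by
    rw [hone0, ← iterate_T_ofReal]; congr 1
  have hBj : ∀ y, (C.T fun c => ‖a n c‖)^[j] 1 y ≤ B := hBn j (by omega)
  have t1 : ‖A^[j] (A^[k] 1 - one0) y‖ ≤ d n * (k * C.rad ^ k) * B := by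
    refine C.norm_iterate_T_le_mul hBj ?_ (fun y => ?_) y
    · have := C.rad_pos; have := hd0 n; positivity
    · exact C.norm_iterate_T_one_sub_le hradn ha0n (hdc n) k y
  have t2 : ‖A^[j] (one0 - (κ : ℂ) • hc) y‖ ≤ ε / (2 * (B + 1)) * B := by
    refine C.norm_iterate_T_le_mul hBj (by positivity) (fun y => ?_) y
    simp only [Pi.sub_apply, Pi.smul_apply, smul_eq_mul, hone, hhc, h_ofReal]
    rw [← Complex.ofReal_mul, ← Complex.ofReal_sub, Complex.norm_real]
    exact hk y
  have t3 : ‖A^[j] (hc - C.h (a n)) y‖ ≤ d n * K * B := by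
    refine C.norm_iterate_T_le_mul hBj (mul_nonneg (hd0 n) hK0) (fun y => ?_) y
    rw [Pi.sub_apply, norm_sub_rev]
    exact hK _ _ _ hradn ha0n (hdc n) y
  have t4 : ‖A^[j] (C.h (a n)) y - C.h (a n) y‖ ≤ n * ‖1 - C.h (a n) C.y0‖ * B := by
    refine (C.norm_iterate_T_h_sub_h_le hradn (B := B) (fun i hi y => ?_) y).trans ?_
    · have := C.norm_iterate_T_le_mul (hBn i (by omega)) (f := (C.ind : Y → ℂ)) zero_le_one
        (fun y => by rw [norm_ind]; unfold ind; split_ifs <;> simp) y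
      simpa using this
    · rw [mul_assoc]
      gcongr
      omega
  have t5 : ‖C.h (a n) y - hc y‖ ≤ d n * K := hK _ _ _ hradn ha0n (hdc n) y
  have esum : A^[n] 1 y - ((κ * C.h a0 y : ℝ) : ℂ) =
      A^[j] (A^[k] 1 - one0) y + A^[j] (one0 - (κ : ℂ) • hc) y +
      (κ : ℂ) * A^[j] (hc - C.h (a n)) y +
      (κ : ℂ) * (A^[j] (C.h (a n)) y - C.h (a n) y) + (κ : ℂ) * (C.h (a n) y - hc y) := by
    simp only [hA, iterate_T_sub, iterate_T_smul, Pi.sub_apply, Pi.smul_apply, smul_eq_mul]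
    rw [hn', Function.iterate_add_apply, hhc, h_ofReal]
    push_cast
    ring
  have hκn : ‖(κ : ℂ)‖ = κ := by simp [abs_of_pos hκ]
  rw [dist_eq_norm, esum]
  have hεB : ε / (2 * (B + 1)) * B ≤ ε / 2 := by
    rw [div_mul_eq_mul_div, div_le_div_iff₀ (by positivity) (by positivity)]
    nlinarith
  calc _ ≤ d n * (k * C.rad ^ k) * B + ε / (2 * (B + 1)) * B + κ * (d n * K * B) +
        κ * (n * ‖1 - C.h (a n) C.y0‖ * B) + κ * (d n * K) := by
        refine (norm_add_le _ _).trans (add_le_add ((norm_add_le _ _).trans (add_le_add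
          ((norm_add_le _ _).trans (add_le_add ((norm_add_le _ _).trans (add_le_add t1 t2))
          ?_)) ?_)) ?_)
        all_goals rw [norm_mul, hκn]; gcongr
    _ < ε := by simp only [he] at hen; linarith

/-- The expectation of a functional of the first `n` bits of the chain. -/
def Ex : ℕ → (List Bool → 𝕜) → Y → 𝕜
  | 0, f, _ => f []
  | n + 1, f, y => ∑ c, (C.pr y c : 𝕜) * Ex n (fun b => f (c :: b)) (C.step y c)

lemma Ex_zero (f : List Bool → 𝕜) (y : Y) : C.Ex 0 f y = f [] := rfl

lemma Ex_succ (n : ℕ) (f : List Bool → 𝕜) (y : Y) :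
    C.Ex (n + 1) f y = ∑ c, (C.pr y c : 𝕜) * C.Ex n (fun b => f (c :: b)) (C.step y c) := rfl

lemma Ex_congr {n : ℕ} {f g : List Bool → 𝕜} (h : ∀ b, b.length = n → f b = g b) (y : Y) :
    C.Ex n f y = C.Ex n g y := by
  induction n generalizing f g y with
  | zero => exact h [] rfl
  | succ n ih =>
    simp only [Ex_succ]
    refine Finset.sum_congr rfl fun c _ => ?_
    rw [ih fun b hb => h (c :: b) (by simp [hb])]

lemma Ex_const_mul (n : ℕ) (k : 𝕜) (f : List Bool → 𝕜) (y : Y) :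
    C.Ex n (fun b => k * f b) y = k * C.Ex n f y := by
  induction n generalizing f y with
  | zero => rfl
  | succ n ih =>
    simp only [Ex_succ, ih, Finset.mul_sum]
    exact Finset.sum_congr rfl fun c _ => by ring

lemma Ex_ofReal (n : ℕ) (f : List Bool → ℝ) (y : Y) :
    C.Ex n (fun b => (f b : ℂ)) y = (C.Ex n f y : ℝ) := by
  induction n generalizing f y with
  | zero => rfl
  | succ n ih => simp [Ex_succ, ih]

lemma iterate_T_one_eq_Ex (a : Bool → 𝕜) (n : ℕ) (y : Y) :
    (C.T a)^[n] 1 y = C.Ex n (fun b => (b.map a).prod) y := by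
  induction n generalizing y with
  | zero => simp [Ex_zero]
  | succ n ih =>
    rw [Function.iterate_succ_apply', T, Ex_succ]
    refine Finset.sum_congr rfl fun c _ => ?_
    simp only [List.map_cons, List.prod_cons, Ex_const_mul, ih]

lemma continuous_Ex {n : ℕ} {f : ℝ → List Bool → ℂ} (h : ∀ b, Continuous fun θ => f θ b) (y : Y) :
    Continuous fun θ => C.Ex n (f θ) y := by
  induction n generalizing f y with
  | zero => exact h []
  | succ n ih =>
    simp only [Ex_succ]
    exact continuous_finsetSum _ fun c _ =>
      continuous_const.mul (ih (fun b => h (c :: b)) (C.step y c))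

lemma intervalIntegral_Ex {n : ℕ} {f : ℝ → List Bool → ℂ} (h : ∀ b, Continuous fun θ => f θ b)
    (s t : ℝ) (y : Y) :
    ∫ θ in s..t, C.Ex n (f θ) y = C.Ex n (fun b => ∫ θ in s..t, f θ b) y := by
  induction n generalizing f y with
  | zero => rfl
  | succ n ih =>
    simp only [Ex_succ]
    rw [intervalIntegral.integral_finsetSum]
    swap
    · exact fun c _ => (continuous_const.mul
        (C.continuous_Ex (fun b => h (c :: b)) (C.step y c))).intervalIntegrable s t
    refine Finset.sum_congr rfl fun c _ => ?_
    rw [intervalIntegral.integral_const_mul, ih fun b => h (c :: b)]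

/-- The weights `e^l` and `e^{l + m}` of the bits `0` and `1`. -/
def ew (l m : ℝ) (c : Bool) : ℝ := Real.exp (l + if c then m else 0)

/-- The complex weights `e^l` and `e^{l + w}` of the bits `0` and `1`. -/
def cw (l w : ℂ) (c : Bool) : ℂ := Complex.exp (l + if c then w else 0)

lemma ew_pos (l m : ℝ) (c : Bool) : 0 < ew l m c := Real.exp_pos _

lemma prod_map_twist_ew (l m θ : ℝ) (b : List Bool) :
    (b.map (twist (ew l m) θ)).prod =
      Real.exp (l * b.length + m * b.count true) * Complex.exp (b.count true * θ * Complex.I) := by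
  induction b with
  | nil => simp
  | cons c b ih =>
    rw [List.map_cons, List.prod_cons, ih]
    cases c
    · simp only [twist, ew, Complex.ofReal_exp, if_false, Bool.false_eq_true, mul_one,
        ← Complex.exp_add]
      congr 1
      simp
      ring
    · simp only [twist, ew, Complex.ofReal_exp, if_true, ← Complex.exp_add]
      congr 1
      simp
      ring

lemma integral_exp_int_mul (k : ℤ) :
    ∫ θ in (-Real.pi)..Real.pi, Complex.exp (k * θ * Complex.I) =
      if k = 0 then 2 * (Real.pi : ℂ) else 0 := by
  split_ifs with hk
  · subst hk; simp; ring
  · have hk' : (k : ℂ) * Complex.I ≠ 0 := by simp [hk]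
    have : ∀ θ : ℝ, Complex.exp (k * θ * Complex.I) = Complex.exp (k * Complex.I * θ) :=
      fun θ => by ring_nf
    simp only [this]
    rw [integral_exp_mul_complex hk', div_eq_zero_iff]
    left
    rw [sub_eq_zero, Complex.exp_eq_exp_iff_exists_int]
    exact ⟨k, by push_cast; ring⟩

lemma integral_iterate_T_twist (l m : ℝ) (n x : ℕ) (y : Y) :
    ∫ θ in (-Real.pi)..Real.pi,
        (C.T (twist (ew l m) θ))^[n] 1 y * Complex.exp (-(θ * x * Complex.I)) =
      ((2 * Real.pi * (Real.exp (n * l + m * x) *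
        C.Ex n (fun b => if b.count true = x then 1 else 0) y) : ℝ) : ℂ) := by
  have e : ∀ θ : ℝ, (C.T (twist (ew l m) θ))^[n] 1 y * Complex.exp (-(θ * x * Complex.I)) =
      C.Ex n (fun b => (Real.exp (l * b.length + m * b.count true) : ℂ) *
        Complex.exp (((b.count true : ℤ) - (x : ℤ) : ℤ) * θ * Complex.I)) y := by
    intro θ
    rw [iterate_T_one_eq_Ex, mul_comm, ← Ex_const_mul]
    congr 1
    ext b
    rw [prod_map_twist_ew, mul_left_comm, ← Complex.exp_add]
    congr 2
    push_cast
    ring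
  simp only [e]
  rw [intervalIntegral_Ex]
  · rw [← mul_assoc, ← Ex_const_mul, ← Ex_ofReal]
    refine C.Ex_congr (fun b hb => ?_) y
    rw [intervalIntegral.integral_const_mul, integral_exp_int_mul]
    by_cases hx : b.count true = x
    · rw [if_pos (by simp [hx]), if_pos hx, hb, hx]
      push_cast
      ring_nf
    · rw [if_neg (by simpa [sub_eq_zero] using hx), if_neg hx]
      simp
  · intro b
    fun_prop

lemma iterate_T_const_mul (k : 𝕜) (a : Bool → 𝕜) (n : ℕ) (f : Y → 𝕜) :
    (C.T fun c => k * a c)^[n] f = k ^ n • (C.T a)^[n] f := by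
  have h1 : ∀ f, (C.T fun c => k * a c) f = k • C.T a f := fun f => by
    ext y
    simp only [T, Pi.smul_apply, smul_eq_mul, Finset.mul_sum]
    exact Finset.sum_congr rfl fun c _ => by ring
  induction n with
  | zero => simp
  | succ n ih =>
    rw [Function.iterate_succ_apply', ih, h1, T_smul, smul_smul, Function.iterate_succ_apply',
      pow_succ']

lemma cw_eq (l m θ : ℝ) (z : ℂ) (c : Bool) :
    cw (l + z) (m + θ * Complex.I) c = Complex.exp z * twist (ew l m) θ c := by
  cases c
  · simp [cw, twist, ew, Complex.exp_add, mul_comm]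
  · simp [cw, twist, ew, Complex.exp_add]; ring

lemma continuous_ew (c : Bool) : Continuous fun q : ℝ × ℝ => ew q.1 q.2 c := by
  cases c <;> simp only [ew, if_true, if_false, Bool.false_eq_true] <;> fun_prop

lemma iterate_T_ew_le {l m K : ℝ} {n : ℕ} {y : Y}
    (h : ‖(C.T (twist (ew l m) 0))^[n] 1 y‖ ≤ K) : (C.T (ew l m))^[n] 1 y ≤ K := by
  have e : twist (ew l m) 0 = fun c => (ew l m c : ℂ) := by
    ext c; simp [twist]
  have e1 : (1 : Y → ℂ) = fun y => (((1 : Y → ℝ) y : ℝ) : ℂ) := by ext; simp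
  rw [e, e1, iterate_T_ofReal, Complex.norm_real] at h
  exact (le_abs_self _).trans h

/-- The scaling identity for the integrand of the inversion formula. -/
lemma iterate_T_twist_mul_exp {l m α sg s : ℝ} {n x : ℕ} (hn : 0 < n) (hα : α = x / n) (y : Y) :
    (C.T (twist (ew l m) (s / √n)))^[n] 1 y * Complex.exp (-((s / √n : ℝ) * x * Complex.I)) =
      Complex.exp (-(sg * s ^ 2 / 2)) *
        (C.T (cw (l + (-(α * (s / √n : ℝ) * Complex.I) + sg * (s / √n : ℝ) ^ 2 / 2))
          (m + (s / √n : ℝ) * Complex.I)))^[n] 1 y := by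
  have hn' : (n : ℂ) ≠ 0 := by exact_mod_cast hn.ne'
  have hs : ((s / √n : ℝ) : ℂ) ^ 2 = s ^ 2 / n := by
    rw [← Complex.ofReal_pow, div_pow, Real.sq_sqrt (Nat.cast_nonneg n)]
    push_cast; ring
  have ha : (n : ℂ) * α = x := by rw [hα]; push_cast; field_simp
  rw [show cw _ _ = _ from funext fun c => cw_eq l m (s / √n) (-(α * (s / √n : ℝ) * Complex.I) +
    sg * (s / √n : ℝ) ^ 2 / 2) c, iterate_T_const_mul, Pi.smul_apply, smul_eq_mul, ← mul_assoc,
    ← Complex.exp_nat_mul,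
    ← Complex.exp_add, mul_comm]
  congr 2
  rw [hs, mul_add, ← ha]
  field_simp
  ring

/-- The local limit theorem along a sequence of exponential tilts. -/
theorem exists_tendsto_sqrt_mul_Ex {lam mu sg : ℕ → ℝ} {lam0 mu0 sg0 α0 : ℝ} {x : ℕ → ℕ}
    (hlam : Tendsto lam atTop (𝓝 lam0)) (hmu : Tendsto mu atTop (𝓝 mu0))
    (hsg : Tendsto sg atTop (𝓝 sg0)) (hx : Tendsto (fun n => (x n : ℝ) / n) atTop (𝓝 α0))
    (hrad : ∀ c, ew lam0 mu0 c < C.rad) (h0 : C.h (ew lam0 mu0) C.y0 = 1)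
    (hn : ∀ᶠ n in atTop, C.h (ew (lam n) (mu n)) C.y0 = 1)
    (hψ : ∀ s : ℝ, Tendsto (fun n : ℕ => n * ‖1 - C.h (cw
      (lam n + (-(((x n : ℝ) / n : ℝ) * (s / √n : ℝ) * Complex.I) +
        sg n * (s / √n : ℝ) ^ 2 / 2)) (mu n + (s / √n : ℝ) * Complex.I)) C.y0‖) atTop (𝓝 0))
    (y : Y) :
    ∃ K : ℝ, 0 < K ∧ Tendsto (fun n : ℕ => √n * (Real.exp (n * lam n + mu n * x n) *
      C.Ex n (fun b => if b.count true = x n then 1 else 0) y)) atTop (𝓝 K) := by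
  have hew : ∀ c, Tendsto (fun n => ew (lam n) (mu n) c) atTop (𝓝 (ew lam0 mu0 c)) := fun c =>
    ((continuous_ew c).tendsto (lam0, mu0)).comp (hlam.prodMk_nhds hmu)
  obtain ⟨r, hr, hrlt⟩ : ∃ r, 0 < r ∧ ∀ c, r < ew lam0 mu0 c :=
    ⟨min (ew lam0 mu0 false) (ew lam0 mu0 true) / 2,
      half_pos (lt_min (ew_pos _ _ _) (ew_pos _ _ _)),
      fun c => (half_lt_self (lt_min (ew_pos _ _ _) (ew_pos _ _ _))).trans_le
        (by cases c; exacts [min_le_left _ _, min_le_right _ _])⟩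
  obtain ⟨K, κ, hK, hκ, hdom⟩ := C.exists_norm_iterate_T_twist_le hr
  obtain ⟨k, hk, hlim⟩ := C.exists_tendsto_iterate_T_one hr (fun c => (hrlt c).le)
    (fun c => (hrad c).le) h0
  have hge : ∀ᶠ n in atTop, ∀ c, r ≤ ew (lam n) (mu n) c :=
    eventually_all.2 fun c => ((hew c).eventually (lt_mem_nhds (hrlt c))).mono fun _ h => h.le
  have hle : ∀ᶠ n in atTop, ∀ c, ew (lam n) (mu n) c ≤ C.rad :=
    eventually_all.2 fun c => ((hew c).eventually (gt_mem_nhds (hrad c))).mono fun _ h => h.le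
  have hdomn : ∀ᶠ n in atTop, ∀ θ, |θ| ≤ Real.pi → ∀ j y,
      ‖(C.T (twist (ew (lam n) (mu n)) θ))^[j] 1 y‖ ≤ K * Real.exp (-κ * j * θ ^ 2) := by
    filter_upwards [hge, hle, hn] with n h1 h2 h3
    exact hdom _ h1 h2 h3
  set F : ℕ → ℝ → ℂ := fun n s => (Set.Ioc (-(Real.pi * √n)) (Real.pi * √n)).indicator
    (fun s => (C.T (twist (ew (lam n) (mu n)) (s / √n)))^[n] 1 y *
      Complex.exp (-((s / √n : ℝ) * x n * Complex.I))) s with hF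
  set f : ℝ → ℝ := fun s => Real.exp (-(sg0 * s ^ 2 / 2)) * (k * C.h (ew lam0 mu0) y) with hf
  have hcont : ∀ n, Continuous fun s : ℝ => (C.T (twist (ew (lam n) (mu n)) (s / √n)))^[n] 1 y *
      Complex.exp (-((s / √n : ℝ) * x n * Complex.I)) := by
    intro n
    simp only [iterate_T_one_eq_Ex, prod_map_twist_ew]
    refine Continuous.mul (C.continuous_Ex (fun b => ?_) y) (by fun_prop)
    fun_prop
  have hpt : ∀ s, Tendsto (fun n => F n s) atTop (𝓝 ((f s : ℝ) : ℂ)) := by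
    intro s
    have hsn : Tendsto (fun n : ℕ => s / √n) atTop (𝓝 0) :=
      (Real.tendsto_sqrt_atTop.comp tendsto_natCast_atTop_atTop).const_div_atTop s
    have hsnc : Tendsto (fun n : ℕ => ((s / √n : ℝ) : ℂ)) atTop (𝓝 0) := by
      exact_mod_cast (Complex.continuous_ofReal.tendsto 0).comp hsn
    set z : ℕ → ℂ := fun n => -(((x n : ℝ) / n : ℝ) * (s / √n : ℝ) * Complex.I) +
        sg n * (s / √n : ℝ) ^ 2 / 2 with hz
    have hz0 : Tendsto z atTop (𝓝 0) := by
      have h1 := (((Complex.continuous_ofReal.tendsto α0).comp hx).mul hsnc).mul_const Complex.I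
      have h2 := (((Complex.continuous_ofReal.tendsto sg0).comp hsg).mul (hsnc.pow 2)).div_const 2
      have := h1.neg.add h2
      simpa [hz] using this
    have hreal : ∀ n, ‖Complex.exp (z n)‖ = Real.exp (sg n * (s / √n) ^ 2 / 2) := by
      intro n
      rw [Complex.norm_exp]
      congr 1
      simp only [hz]
      rw [← Complex.ofReal_mul, ← Complex.ofReal_pow, ← Complex.ofReal_mul]
      simp [-Complex.ofReal_pow, -Complex.ofReal_mul, -Complex.ofReal_div]
    have hnorm : ∀ n c, ‖cw (lam n + z n) (mu n + (s / √n : ℝ) * Complex.I) c‖ =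
        Real.exp (sg n * (s / √n) ^ 2 / 2) * ew (lam n) (mu n) c := fun n c => by
      rw [cw_eq, norm_mul, hreal, norm_twist fun c => (ew_pos _ _ c).le]
    have hcw : ∀ c, Tendsto (fun n => cw (lam n + z n) (mu n + (s / √n : ℝ) * Complex.I) c) atTop
        (𝓝 (ew lam0 mu0 c : ℂ)) := by
      intro c
      have h1 := ((Complex.continuous_ofReal.tendsto lam0).comp hlam).add hz0
      have h2 := ((Complex.continuous_ofReal.tendsto mu0).comp hmu).add (hsnc.mul_const Complex.I)
      have h3 : Tendsto (fun n => if c then (mu n : ℂ) + (s / √n : ℝ) * Complex.I else 0) atTop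
          (𝓝 (if c then (mu0 : ℂ) else 0)) := by
        cases c
        · simp
        · simpa using h2
      have := (Complex.continuous_exp.tendsto _).comp (h1.add h3)
      have hlast : ((ew lam0 mu0 c : ℝ) : ℂ) =
          Complex.exp (lam0 + 0 + if c then (mu0 : ℂ) else 0) := by
        cases c <;> simp [ew]
      rw [hlast]
      exact this
    have hradn : ∀ᶠ n in atTop, ∀ c,
        ‖cw (lam n + z n) (mu n + (s / √n : ℝ) * Complex.I) c‖ ≤ C.rad := by
      refine eventually_all.2 fun c => ?_
      have h1 := (hcw c).norm
      rw [Complex.norm_real, Real.norm_eq_abs, abs_of_pos (ew_pos _ _ _)] at h1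
      exact (h1.eventually (gt_mem_nhds (hrad c))).mono fun _ h => h.le
    have hB : ∀ᶠ n in atTop, ∀ j ≤ n, ∀ y, (C.T fun c =>
        ‖cw (lam n + z n) (mu n + (s / √n : ℝ) * Complex.I) c‖)^[j] 1 y ≤
          Real.exp ((|sg0| + 1) * s ^ 2 / 2) * K := by
      filter_upwards [hdomn, hsg.abs.eventually (gt_mem_nhds (lt_add_one _)),
        eventually_gt_atTop 0] with n h1 h2 h3 j hj y
      simp only [hnorm]
      rw [iterate_T_const_mul, Pi.smul_apply, smul_eq_mul]
      have h4 : (C.T (ew (lam n) (mu n)))^[j] 1 y ≤ K := by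
        refine C.iterate_T_ew_le ?_
        simpa using h1 0 (by simp [Real.pi_pos.le]) j y
      have h5 : Real.exp (sg n * (s / √n) ^ 2 / 2) ^ j ≤ Real.exp ((|sg0| + 1) * s ^ 2 / 2) := by
        rw [← Real.exp_nat_mul, Real.exp_le_exp, div_pow, Real.sq_sqrt (Nat.cast_nonneg n)]
        have h6 : (j : ℝ) / n ≤ 1 := div_le_one_of_le₀ (by exact_mod_cast hj) (Nat.cast_nonneg n)
        have h7 : 0 ≤ (j : ℝ) / n := by positivity
        calc (j : ℝ) * (sg n * (s ^ 2 / n) / 2) = (j / n) * (sg n * (s ^ 2 / 2)) := by ring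
          _ ≤ (j / n) * ((|sg0| + 1) * (s ^ 2 / 2)) := by
            gcongr; exact (le_abs_self _).trans h2.le
          _ ≤ 1 * ((|sg0| + 1) * (s ^ 2 / 2)) := by gcongr
          _ = _ := by ring
      exact (mul_le_mul_of_nonneg_left h4 (by positivity)).trans
        (mul_le_mul_of_nonneg_right h5 hK.le)
    have hT := hlim _ _ hradn hcw hB (hψ s) y
    have hE : Tendsto (fun n => Complex.exp (-(sg n * s ^ 2 / 2))) atTop
        (𝓝 (Complex.exp (-(sg0 * s ^ 2 / 2)))) := by
      refine (Complex.continuous_exp.tendsto _).comp ?_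
      exact ((((Complex.continuous_ofReal.tendsto sg0).comp hsg).mul_const _).div_const _).neg
    have hprod := hE.mul hT
    have hfs : ((f s : ℝ) : ℂ) = Complex.exp (-(sg0 * s ^ 2 / 2)) *
        ((k * C.h (ew lam0 mu0) y : ℝ) : ℂ) := by simp [hf]
    rw [hfs]
    refine hprod.congr' ?_
    have hbig : ∀ᶠ n : ℕ in atTop, |s| < Real.pi * √n :=
      ((Real.tendsto_sqrt_atTop.comp tendsto_natCast_atTop_atTop).const_mul_atTop
        Real.pi_pos).eventually_gt_atTop _
    filter_upwards [eventually_gt_atTop 0, hbig] with n hn0 hb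
    rw [abs_lt] at hb
    simp only [hF]
    rw [Set.indicator_of_mem (show s ∈ Set.Ioc _ _ from ⟨hb.1, hb.2.le⟩)]
    exact (C.iterate_T_twist_mul_exp hn0 rfl y).symm
  have hbound : ∀ᶠ n in atTop, ∀ s, ‖F n s‖ ≤ K * Real.exp (-κ * s ^ 2) := by
    filter_upwards [hdomn, eventually_gt_atTop 0] with n h1 hn0 s
    have hn' : 0 < √(n : ℝ) := Real.sqrt_pos.2 (by exact_mod_cast hn0)
    simp only [hF]
    by_cases hs : s ∈ Set.Ioc (-(Real.pi * √n)) (Real.pi * √n)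
    · rw [Set.indicator_of_mem hs, norm_mul]
      have h2 : |s / √n| ≤ Real.pi := by
        rw [abs_div, abs_of_pos hn', div_le_iff₀ hn', abs_le]
        exact ⟨hs.1.le, hs.2⟩
      have h3 : ‖Complex.exp (-((s / √n : ℝ) * x n * Complex.I))‖ = 1 := by
        have : -(((s / √n : ℝ) : ℂ) * x n * Complex.I) =
            ((-(s / √n * x n) : ℝ) : ℂ) * Complex.I := by
          push_cast; ring
        rw [this, Complex.norm_exp_ofReal_mul_I]
      rw [h3, mul_one]
      refine (h1 _ h2 n y).trans_eq ?_
      congr 2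
      rw [div_pow, Real.sq_sqrt (Nat.cast_nonneg n)]
      have : (n : ℝ) ≠ 0 := by exact_mod_cast hn0.ne'
      field_simp
    · rw [Set.indicator_of_notMem hs]
      simp only [norm_zero]
      positivity
  have hintegral : Integrable fun s : ℝ => K * Real.exp (-κ * s ^ 2) :=
    (integrable_exp_neg_mul_sq hκ).const_mul K
  have hDCT : Tendsto (fun n => ∫ s, F n s) atTop (𝓝 (∫ s, ((f s : ℝ) : ℂ))) := by
    refine tendsto_integral_filter_of_dominated_convergence _ (Eventually.of_forall fun n => ?_)
      (hbound.mono fun n h => ae_of_all _ h) hintegral (ae_of_all _ hpt)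
    exact (hcont n).aestronglyMeasurable.indicator measurableSet_Ioc
  have hfc : Continuous f := by simp only [hf]; fun_prop
  have hfpos : ∀ s, 0 < f s := fun s => by
    have h1 := C.le_h hr.le (fun c => (hrlt c).le) (fun c => (hrad c).le) h0 y
    have h2 : 0 < (C.δ * r) ^ C.u.length := pow_pos (mul_pos C.δ_pos hr) _
    have := h2.trans_le h1
    simp only [hf]; positivity
  have hfint : Integrable f := by
    refine hintegral.mono' hfc.aestronglyMeasurable (ae_of_all _ fun s => ?_)
    have h1 := (hpt s).norm
    rw [Complex.norm_real] at h1
    exact le_of_tendsto h1 (hbound.mono fun n h => h s)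
  have hposint : 0 < ∫ s, f s := by
    rw [integral_pos_iff_support_of_nonneg (fun s => (hfpos s).le) hfint]
    have : Function.support f = Set.univ := by
      ext s; simpa using (hfpos s).ne'
    rw [this]; simp
  refine ⟨(∫ s, f s) / (2 * Real.pi), by positivity, ?_⟩
  rw [integral_complex_ofReal] at hDCT
  have hre := (Complex.continuous_re.tendsto _).comp hDCT
  rw [Complex.ofReal_re] at hre
  refine (hre.div_const (2 * Real.pi)).congr' ?_
  filter_upwards [eventually_gt_atTop 0] with n hn0
  have hn' : 0 < √(n : ℝ) := Real.sqrt_pos.2 (by exact_mod_cast hn0)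
  have e1 : ∫ s, F n s = √n * ((2 * Real.pi * (Real.exp (n * lam n + mu n * x n) *
        C.Ex n (fun b => if b.count true = x n then 1 else 0) y) : ℝ) : ℂ) := by
    rw [← integral_iterate_T_twist]
    simp only [hF]
    rw [integral_indicator measurableSet_Ioc, ← intervalIntegral.integral_of_le
      (by nlinarith [Real.pi_pos])]
    have := intervalIntegral.integral_comp_div (a := -(Real.pi * √n)) (b := Real.pi * √n)
      (fun θ : ℝ => (C.T (twist (ew (lam n) (mu n)) θ))^[n] 1 y *
        Complex.exp (-(θ * x n * Complex.I))) hn'.ne'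
    rw [this, neg_div, mul_div_cancel_right₀ _ hn'.ne', Complex.real_smul]
  simp only [Function.comp, e1]
  rw [← Complex.ofReal_mul, Complex.ofReal_re]
  field_simp

end BitChain

/-- A pair of counting variables `ζ ≤ τ` with exponential moments, not concentrated on a
line through the origin. -/
structure TiltPair {Ω : Type} [MeasurableSpace Ω] (P : Measure Ω) (τ ζ : Ω → ℕ) (η : ℝ) : Prop where
  measurable_fst : Measurable τ
  measurable_snd : Measurable ζ
  snd_le : ∀ ω, ζ ω ≤ τ ω
  fst_pos : ∀ᵐ ω ∂P, 0 < τ ω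
  η_pos : 0 < η
  integrable_exp : Integrable (fun ω => Real.exp (η * τ ω)) P
  nondegenerate : ∃ k : ℕ, P {ω | τ ω = k ∧ ζ ω = 1} ≠ 0 ∧ P {ω | τ ω = k + 1 ∧ ζ ω = 1} ≠ 0

namespace TiltPair

variable {Ω : Type} {τ ζ : Ω → ℕ} {η : ℝ}

/-- The exponential density of the tilt with parameters `q`. -/
def dens (τ ζ : Ω → ℕ) (q : ℝ × ℝ) (ω : Ω) : ℝ := Real.exp (q.1 * τ ω + q.2 * ζ ω)

lemma dens_pos (q : ℝ × ℝ) (ω : Ω) : 0 < dens τ ζ q ω := Real.exp_pos _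

lemma dens_zero (ω : Ω) : dens τ ζ 0 ω = 1 := by simp [dens]

lemma continuous_dens (ω : Ω) : Continuous fun q => dens τ ζ q ω := by
  unfold dens; fun_prop

lemma closedBall_mem_nhds {q : ℝ × ℝ} (hq : ‖q‖ < η / 8) :
    {q : ℝ × ℝ | ‖q‖ ≤ η / 8} ∈ 𝓝 q :=
  (continuous_norm.continuousAt.eventually (gt_mem_nhds hq)).mono fun _ h => h.le

lemma abs_mul_fst_le {φ : Ω → ℝ} {k : ℕ} (hφ : ∀ ω, |φ ω| ≤ ((τ ω : ℝ) + 1) ^ k) (ω : Ω) :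
    |φ ω * τ ω| ≤ ((τ ω : ℝ) + 1) ^ (k + 1) := by
  rw [abs_mul, pow_succ, Nat.abs_cast]
  exact mul_le_mul (hφ ω) (by linarith) (by positivity) (by positivity)

lemma abs_fst_le (ω : Ω) : |(τ ω : ℝ)| ≤ ((τ ω : ℝ) + 1) ^ 1 := by
  rw [Nat.abs_cast]; linarith

variable [MeasurableSpace Ω] {P : Measure Ω}

/-- The tilted moment of `φ`. -/
def mom (P : Measure Ω) (τ ζ : Ω → ℕ) (φ : Ω → ℝ) (q : ℝ × ℝ) : ℝ :=
  ∫ ω, φ ω * dens τ ζ q ω ∂P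

lemma measurable_dens (H : TiltPair P τ ζ η) (q : ℝ × ℝ) : Measurable (dens τ ζ q) := by
  have h1 : Measurable fun ω => (τ ω : ℝ) := measurable_from_nat.comp H.measurable_fst
  have h2 : Measurable fun ω => (ζ ω : ℝ) := measurable_from_nat.comp H.measurable_snd
  exact ((h1.const_mul _).add (h2.const_mul _)).exp

lemma integrable_pow_mul_exp (H : TiltPair P τ ζ η) (k : ℕ) :
    Integrable (fun ω => ((τ ω : ℝ) + 1) ^ k * Real.exp (η / 2 * τ ω)) P := by
  have h1 : Measurable fun ω => (τ ω : ℝ) := measurable_from_nat.comp H.measurable_fst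
  have hη := H.η_pos
  refine (H.integrable_exp.const_mul (k.factorial * (2 / η) ^ k * Real.exp (η / 2))).mono'
    (by fun_prop) (ae_of_all _ fun ω => ?_)
  have h2 := Real.pow_div_factorial_le_exp (((τ ω : ℝ) + 1) * (η / 2)) (by positivity) k
  rw [div_le_iff₀ (by positivity), mul_pow] at h2
  have h3 : ((τ ω : ℝ) + 1) ^ k ≤
      k.factorial * (2 / η) ^ k * Real.exp (((τ ω : ℝ) + 1) * (η / 2)) := by
    calc ((τ ω : ℝ) + 1) ^ k = (((τ ω : ℝ) + 1) ^ k * (η / 2) ^ k) * (2 / η) ^ k := by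
          rw [mul_assoc, ← mul_pow, div_mul_div_comm, mul_comm 2 η, div_self (by positivity),
            one_pow, mul_one]
      _ ≤ (Real.exp (((τ ω : ℝ) + 1) * (η / 2)) * k.factorial) * (2 / η) ^ k := by gcongr
      _ = _ := by ring
  rw [Real.norm_of_nonneg (by positivity)]
  calc _ ≤ (k.factorial * (2 / η) ^ k * Real.exp (((τ ω : ℝ) + 1) * (η / 2))) *
        Real.exp (η / 2 * τ ω) := by gcongr
    _ = k.factorial * (2 / η) ^ k * (Real.exp (η / 2) * Real.exp (η * τ ω)) := by
      rw [mul_assoc, ← Real.exp_add, ← Real.exp_add]; ring_nf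
    _ = _ := by ring

lemma dens_le (H : TiltPair P τ ζ η) {q : ℝ × ℝ} (hq : ‖q‖ ≤ η / 8) (ω : Ω) :
    dens τ ζ q ω ≤ Real.exp (η / 4 * τ ω) := by
  have h1 := (le_abs_self q.1).trans ((norm_fst_le q).trans hq)
  have h2 := (le_abs_self q.2).trans ((norm_snd_le q).trans hq)
  have h3 : (ζ ω : ℝ) ≤ τ ω := by exact_mod_cast H.snd_le ω
  have hη := H.η_pos
  rw [dens, Real.exp_le_exp]
  calc q.1 * τ ω + q.2 * ζ ω ≤ η / 8 * τ ω + η / 8 * ζ ω := by gcongr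
    _ ≤ η / 8 * τ ω + η / 8 * τ ω := by gcongr
    _ = _ := by ring

lemma dens_le' (H : TiltPair P τ ζ η) {q : ℝ × ℝ} (hq : ‖q‖ ≤ η / 8) (ω : Ω) :
    dens τ ζ q ω ≤ Real.exp (η / 2 * τ ω) := by
  refine (H.dens_le hq ω).trans ?_
  have hη := H.η_pos
  gcongr
  norm_num

lemma abs_mul_dens_le (H : TiltPair P τ ζ η) {φ : Ω → ℝ} {k : ℕ}
    (hφ : ∀ ω, |φ ω| ≤ ((τ ω : ℝ) + 1) ^ k) {q : ℝ × ℝ}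
    (hq : ‖q‖ ≤ η / 8) (ω : Ω) :
    ‖φ ω * dens τ ζ q ω‖ ≤ ((τ ω : ℝ) + 1) ^ k * Real.exp (η / 2 * τ ω) := by
  rw [norm_mul, Real.norm_eq_abs, Real.norm_of_nonneg (dens_pos q ω).le]
  exact mul_le_mul (hφ ω) (H.dens_le' hq ω) (dens_pos q ω).le (by positivity)

lemma integrable_mul_dens (H : TiltPair P τ ζ η) {φ : Ω → ℝ} {k : ℕ} (hφm : Measurable φ)
    (hφ : ∀ ω, |φ ω| ≤ ((τ ω : ℝ) + 1) ^ k) {q : ℝ × ℝ} (hq : ‖q‖ ≤ η / 8) :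
    Integrable (fun ω => φ ω * dens τ ζ q ω) P :=
  (H.integrable_pow_mul_exp k).mono' (hφm.mul (H.measurable_dens q)).aestronglyMeasurable
    (ae_of_all _ fun ω => H.abs_mul_dens_le hφ hq ω)

lemma abs_mul_snd_le (H : TiltPair P τ ζ η) {φ : Ω → ℝ} {k : ℕ}
    (hφ : ∀ ω, |φ ω| ≤ ((τ ω : ℝ) + 1) ^ k) (ω : Ω) :
    |φ ω * ζ ω| ≤ ((τ ω : ℝ) + 1) ^ (k + 1) := by
  have h : (ζ ω : ℝ) ≤ τ ω := by exact_mod_cast H.snd_le ω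
  rw [abs_mul, pow_succ, Nat.abs_cast]
  exact mul_le_mul (hφ ω) (by linarith) (by positivity) (by positivity)

lemma continuousAt_mom (H : TiltPair P τ ζ η) {φ : Ω → ℝ} {k : ℕ} (hφm : Measurable φ)
    (hφ : ∀ ω, |φ ω| ≤ ((τ ω : ℝ) + 1) ^ k) {q : ℝ × ℝ} (hq : ‖q‖ < η / 8) :
    ContinuousAt (mom P τ ζ φ) q := by
  refine continuousAt_of_dominated (Eventually.of_forall fun q =>
    (hφm.mul (H.measurable_dens q)).aestronglyMeasurable) ?_ (H.integrable_pow_mul_exp k) ?_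
  · filter_upwards [closedBall_mem_nhds hq] with q' hq'
    exact ae_of_all _ fun ω => H.abs_mul_dens_le hφ hq' ω
  · exact ae_of_all _ fun ω => (continuous_const.mul (continuous_dens ω)).continuousAt

lemma hasFDerivAt_mom (H : TiltPair P τ ζ η) {φ : Ω → ℝ} {k : ℕ} (hφm : Measurable φ)
    (hφ : ∀ ω, |φ ω| ≤ ((τ ω : ℝ) + 1) ^ k) {q : ℝ × ℝ} (hq : ‖q‖ < η / 8) :
    HasFDerivAt (mom P τ ζ φ)
      (mom P τ ζ (fun ω => φ ω * τ ω) q • ContinuousLinearMap.fst ℝ ℝ ℝ +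
        mom P τ ζ (fun ω => φ ω * ζ ω) q • ContinuousLinearMap.snd ℝ ℝ ℝ) q := by
  have hτ : Measurable fun ω => (τ ω : ℝ) := measurable_from_nat.comp H.measurable_fst
  have hζ : Measurable fun ω => (ζ ω : ℝ) := measurable_from_nat.comp H.measurable_snd
  have hφ1 := abs_mul_fst_le hφ
  have hφ2 := H.abs_mul_snd_le hφ
  set F' : ℝ × ℝ → Ω → (ℝ × ℝ →L[ℝ] ℝ) := fun q ω =>
    (φ ω * τ ω * dens τ ζ q ω) • ContinuousLinearMap.fst ℝ ℝ ℝ +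
      (φ ω * ζ ω * dens τ ζ q ω) • ContinuousLinearMap.snd ℝ ℝ ℝ with hF'
  have i1 := H.integrable_mul_dens (hφm.mul hτ) hφ1 hq.le
  have i2 := H.integrable_mul_dens (hφm.mul hζ) hφ2 hq.le
  have key := hasFDerivAt_integral_of_dominated_of_fderiv_le (μ := P)
    (F := fun q ω => φ ω * dens τ ζ q ω) (F' := F') (𝕜 := ℝ)
    (bound := fun ω => 2 * (((τ ω : ℝ) + 1) ^ (k + 1) * Real.exp (η / 2 * τ ω)))
    (closedBall_mem_nhds hq)
    (Eventually.of_forall fun q => (hφm.mul (H.measurable_dens q)).aestronglyMeasurable)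
    (H.integrable_mul_dens hφm hφ hq.le)
    ((i1.aestronglyMeasurable.smul_const _).add (i2.aestronglyMeasurable.smul_const _))
    (ae_of_all _ fun ω q' hq' => ?_)
    ((H.integrable_pow_mul_exp (k + 1)).const_mul 2)
    (ae_of_all _ fun ω q' hq' => ?_)
  · refine key.congr_fderiv ?_
    refine (integral_add (i1.smul_const _) (i2.smul_const _)).trans ?_
    rw [integral_smul_const, integral_smul_const]
    rfl
  · simp only [hF']
    refine (norm_add_le _ _).trans ?_
    rw [norm_smul, norm_smul, two_mul]
    refine add_le_add ?_ ?_
    · exact (mul_le_of_le_one_right (norm_nonneg _) (ContinuousLinearMap.norm_fst_le ℝ ℝ ℝ)).trans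
        (H.abs_mul_dens_le hφ1 hq' ω)
    · exact (mul_le_of_le_one_right (norm_nonneg _) (ContinuousLinearMap.norm_snd_le ℝ ℝ ℝ)).trans
        (H.abs_mul_dens_le hφ2 hq' ω)
  · have h1 : HasFDerivAt (fun q : ℝ × ℝ => q.1 * (τ ω : ℝ) + q.2 * (ζ ω : ℝ))
        ((τ ω : ℝ) • ContinuousLinearMap.fst ℝ ℝ ℝ + (ζ ω : ℝ) • ContinuousLinearMap.snd ℝ ℝ ℝ)
        q' := (hasFDerivAt_fst.mul_const _).add (hasFDerivAt_snd.mul_const _)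
    have h2 := (h1.exp).const_mul (φ ω)
    refine h2.congr_fderiv ?_
    simp only [hF', dens, smul_add, smul_smul]
    congr 2 <;> ring

lemma hasStrictFDerivAt_mom (H : TiltPair P τ ζ η) {φ : Ω → ℝ} {k : ℕ} (hφm : Measurable φ)
    (hφ : ∀ ω, |φ ω| ≤ ((τ ω : ℝ) + 1) ^ k) :
    HasStrictFDerivAt (mom P τ ζ φ)
      (mom P τ ζ (fun ω => φ ω * τ ω) 0 • ContinuousLinearMap.fst ℝ ℝ ℝ +
        mom P τ ζ (fun ω => φ ω * ζ ω) 0 • ContinuousLinearMap.snd ℝ ℝ ℝ) 0 := by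
  have hη := H.η_pos
  have hτ : Measurable fun ω => (τ ω : ℝ) := measurable_from_nat.comp H.measurable_fst
  have hζ : Measurable fun ω => (ζ ω : ℝ) := measurable_from_nat.comp H.measurable_snd
  have hφ1 := abs_mul_fst_le hφ
  have hφ2 := H.abs_mul_snd_le hφ
  have h0 : ‖(0 : ℝ × ℝ)‖ < η / 8 := by simp [hη]
  refine hasStrictFDerivAt_of_hasFDerivAt_of_continuousAt (f' := fun q =>
    mom P τ ζ (fun ω => φ ω * τ ω) q • ContinuousLinearMap.fst ℝ ℝ ℝ +
        mom P τ ζ (fun ω => φ ω * ζ ω) q • ContinuousLinearMap.snd ℝ ℝ ℝ) ?_ ?_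
  · filter_upwards [continuous_norm.continuousAt.eventually (gt_mem_nhds h0)] with q hq
    exact H.hasFDerivAt_mom hφm hφ hq
  · exact ((H.continuousAt_mom (hφm.mul hτ) hφ1 h0).smul continuousAt_const).add
      ((H.continuousAt_mom (hφm.mul hζ) hφ2 h0).smul continuousAt_const)

end TiltPair

namespace TiltPair

variable {Ω : Type} {τ ζ : Ω → ℕ} {η : ℝ} [MeasurableSpace Ω] {P : Measure Ω}

lemma measurable_fst_real (H : TiltPair P τ ζ η) : Measurable fun ω => (τ ω : ℝ) :=
  measurable_from_nat.comp H.measurable_fst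

lemma measurable_snd_real (H : TiltPair P τ ζ η) : Measurable fun ω => (ζ ω : ℝ) :=
  measurable_from_nat.comp H.measurable_snd

lemma abs_snd_le (H : TiltPair P τ ζ η) (ω : Ω) : |(ζ ω : ℝ)| ≤ ((τ ω : ℝ) + 1) ^ 1 := by
  have h : (ζ ω : ℝ) ≤ τ ω := by exact_mod_cast H.snd_le ω
  rw [Nat.abs_cast]; linarith

lemma eq_zero_of_ae (H : TiltPair P τ ζ η) {c d : ℝ} (h : ∀ᵐ ω ∂P, c * τ ω + d * ζ ω = 0) :
    c = 0 ∧ d = 0 := by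
  obtain ⟨k, h1, h2⟩ := H.nondegenerate
  obtain ⟨ω1, ⟨e1, e1'⟩, f1⟩ := ((frequently_ae_mem_iff.2 h1).and_eventually h).exists
  obtain ⟨ω2, ⟨e2, e2'⟩, f2⟩ := ((frequently_ae_mem_iff.2 h2).and_eventually h).exists
  rw [e1, e1'] at f1
  rw [e2, e2'] at f2
  push_cast at f1 f2
  have hc : c = 0 := by linarith
  exact ⟨hc, by rw [hc] at f1; linarith⟩

lemma mom_fst_pos (H : TiltPair P τ ζ η) [IsProbabilityMeasure P] {q : ℝ × ℝ} (hq : ‖q‖ ≤ η / 8) :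
    0 < mom P τ ζ (fun ω => (τ ω : ℝ)) q := by
  have hi := H.integrable_mul_dens H.measurable_fst_real abs_fst_le hq
  refine lt_of_le_of_ne (integral_nonneg fun ω => mul_nonneg (Nat.cast_nonneg _) (dens_pos q ω).le)
    fun h0 => ?_
  have h1 := (integral_eq_zero_iff_of_nonneg (fun ω => mul_nonneg (Nat.cast_nonneg (τ ω))
    (dens_pos (τ := τ) (ζ := ζ) q ω).le) hi).1 h0.symm
  obtain ⟨ω, h2, h3⟩ := (h1.and H.fst_pos).exists
  have : (0 : ℝ) < τ ω * dens τ ζ q ω := mul_pos (Nat.cast_pos.2 h3) (dens_pos q ω)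
  exact this.ne' h2

lemma integrable_quadratic (H : TiltPair P τ ζ η) {q : ℝ × ℝ} (hq : ‖q‖ ≤ η / 8) :
    Integrable (fun ω => (ζ ω : ℝ) * ζ ω * dens τ ζ q ω) P ∧
      Integrable (fun ω => (τ ω : ℝ) * ζ ω * dens τ ζ q ω) P ∧
      Integrable (fun ω => (τ ω : ℝ) * τ ω * dens τ ζ q ω) P :=
  ⟨H.integrable_mul_dens (H.measurable_snd_real.mul H.measurable_snd_real)
    (H.abs_mul_snd_le H.abs_snd_le) hq,
  H.integrable_mul_dens (H.measurable_fst_real.mul H.measurable_snd_real)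
    (H.abs_mul_snd_le abs_fst_le) hq,
  H.integrable_mul_dens (H.measurable_fst_real.mul H.measurable_fst_real)
    (abs_mul_fst_le abs_fst_le) hq⟩

lemma mom_sq_sub (H : TiltPair P τ ζ η) (b : ℝ) {q : ℝ × ℝ} (hq : ‖q‖ ≤ η / 8) :
    mom P τ ζ (fun ω => ((ζ ω : ℝ) - b * τ ω) ^ 2) q =
      mom P τ ζ (fun ω => (ζ ω : ℝ) * ζ ω) q - 2 * b * mom P τ ζ (fun ω => (τ ω : ℝ) * ζ ω) q +
        b ^ 2 * mom P τ ζ (fun ω => (τ ω : ℝ) * τ ω) q := by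
  obtain ⟨i1, i2, i3⟩ := H.integrable_quadratic hq
  have i4 : Integrable (fun ω => (ζ ω : ℝ) * ζ ω * dens τ ζ q ω -
      2 * b * ((τ ω : ℝ) * ζ ω * dens τ ζ q ω)) P := i1.sub (i2.const_mul _)
  simp only [mom]
  rw [← integral_const_mul, ← integral_const_mul, ← integral_sub i1 (i2.const_mul _),
    ← integral_add i4 (i3.const_mul _)]
  refine integral_congr_ae (ae_of_all _ fun ω => ?_)
  ring

lemma mom_sq_sub_pos (H : TiltPair P τ ζ η) (b : ℝ) :
    0 < mom P τ ζ (fun ω => ((ζ ω : ℝ) - b * τ ω) ^ 2) 0 := by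
  have hq : ‖(0 : ℝ × ℝ)‖ ≤ η / 8 := by have := H.η_pos; rw [norm_zero]; positivity
  obtain ⟨i1, i2, i3⟩ := H.integrable_quadratic hq
  have hi : Integrable (fun ω => ((ζ ω : ℝ) - b * τ ω) ^ 2 * dens τ ζ 0 ω) P := by
    refine ((i1.sub (i2.const_mul (2 * b))).add (i3.const_mul (b ^ 2))).congr
      (ae_of_all _ fun ω => ?_)
    simp only [Pi.add_apply, Pi.sub_apply]
    ring
  have hnn : ∀ ω, 0 ≤ ((ζ ω : ℝ) - b * τ ω) ^ 2 * dens τ ζ 0 ω :=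
    fun ω => mul_nonneg (sq_nonneg _) (dens_pos _ ω).le
  refine lt_of_le_of_ne (integral_nonneg hnn) fun h0 => ?_
  have h1 := (integral_eq_zero_iff_of_nonneg hnn hi).1 h0.symm
  have h2 : ∀ᵐ ω ∂P, -b * τ ω + 1 * ζ ω = 0 := by
    filter_upwards [h1] with ω hω
    have := pow_eq_zero_iff (two_ne_zero) |>.1
      ((mul_eq_zero.1 hω).resolve_right (dens_pos _ ω).ne')
    linarith
  exact one_ne_zero (H.eq_zero_of_ae h2).2

lemma exists_solution (H : TiltPair P τ ζ η) [IsProbabilityMeasure P] {ε : ℝ} (hε : 0 < ε) :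
    ∃ ρ > 0, ∃ q : ℝ → ℝ × ℝ, ∀ α : ℝ,
      |α - mom P τ ζ (fun ω => (ζ ω : ℝ)) 0 / mom P τ ζ (fun ω => (τ ω : ℝ)) 0| < ρ →
      ContinuousAt q α ∧ ‖q α‖ < ε ∧ mom P τ ζ (fun _ => 1) (q α) = 1 ∧
      mom P τ ζ (fun ω => (ζ ω : ℝ)) (q α) = α * mom P τ ζ (fun ω => (τ ω : ℝ)) (q α) := by
  have hη := H.η_pos
  have h0' : ‖(0 : ℝ × ℝ)‖ ≤ η / 8 := by rw [norm_zero]; positivity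
  set mτ := mom P τ ζ (fun ω => (τ ω : ℝ)) with hmτ
  set mζ := mom P τ ζ (fun ω => (ζ ω : ℝ)) with hmζ
  set m1 := mom P τ ζ (fun _ => 1) with hm1
  have hτ0 : 0 < mτ 0 := H.mom_fst_pos h0'
  set a := mζ 0 / mτ 0 with ha
  have d1 := H.hasStrictFDerivAt_mom (φ := fun _ => 1) (k := 0) measurable_const (by simp)
  have dτ := H.hasStrictFDerivAt_mom H.measurable_fst_real abs_fst_le
  have dζ := H.hasStrictFDerivAt_mom H.measurable_snd_real H.abs_snd_le
  have dinv := (hasStrictDerivAt_inv hτ0.ne').comp_hasStrictFDerivAt 0 dτ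
  obtain ⟨L, dG, hL⟩ : ∃ L : ℝ × ℝ →L[ℝ] ℝ × ℝ,
      HasStrictFDerivAt (fun q => (m1 q, mζ q * (mτ q)⁻¹)) L 0 ∧ ∀ dl dm : ℝ, L (dl, dm) =
        (mτ 0 * dl + mζ 0 * dm,
          (mom P τ ζ (fun ω => (τ ω : ℝ) * ζ ω) 0 * dl +
              mom P τ ζ (fun ω => (ζ ω : ℝ) * ζ ω) 0 * dm) * (mτ 0)⁻¹ -
            mζ 0 * ((mτ 0 ^ 2)⁻¹ * (mom P τ ζ (fun ω => (τ ω : ℝ) * τ ω) 0 * dl +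
              mom P τ ζ (fun ω => (τ ω : ℝ) * ζ ω) 0 * dm))) := by
    refine ⟨_, d1.prodMk (dζ.mul dinv), fun dl dm => ?_⟩
    have hcomm : (fun ω => (ζ ω : ℝ) * τ ω) = fun ω => (τ ω : ℝ) * ζ ω :=
      funext fun ω => mul_comm _ _
    simp [hcomm, ← hmτ, ← hmζ]
    ring
  have hinj : Function.Injective (L : ℝ × ℝ →ₗ[ℝ] ℝ × ℝ) := by
    rw [injective_iff_map_eq_zero]
    rintro ⟨dl, dm⟩ hz
    have hv := H.mom_sq_sub_pos a
    rw [H.mom_sq_sub a h0'] at hv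
    rw [ContinuousLinearMap.coe_coe, hL, Prod.mk_eq_zero] at hz
    obtain ⟨z1, z2⟩ := hz
    have hZ : mζ 0 = a * mτ 0 := by rw [ha]; field_simp
    rw [hZ] at z1 z2
    have hdl : dl = -a * dm := by
      have : mτ 0 * (dl + a * dm) = 0 := by linarith
      linarith [(mul_eq_zero.1 this).resolve_left hτ0.ne']
    rw [hdl] at z2 ⊢
    have hdm : dm = 0 := by
      refine (mul_eq_zero.1 (?_ : _ * dm = 0)).resolve_left hv.ne'
      rw [← mul_zero (mτ 0), ← z2]
      field_simp
      ring
    simp [hdm]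
  set e := (LinearEquiv.ofInjectiveEndo _ hinj).toContinuousLinearEquiv with he
  have dG' : HasStrictFDerivAt (fun q => (m1 q, mζ q * (mτ q)⁻¹)) (e : ℝ × ℝ →L[ℝ] ℝ × ℝ) 0 := by
    exact dG
  set g := dG'.toOpenPartialHomeomorph _ with hg
  have hgc : ∀ q, g q = (m1 q, mζ q * (mτ q)⁻¹) := fun q => rfl
  have h10 : m1 0 = 1 := by simp [hm1, mom, dens_zero]
  have hg0 : g 0 = (1, a) := by rw [hgc, h10, ha, div_eq_mul_inv]
  have h0s : (0 : ℝ × ℝ) ∈ g.source := dG'.mem_toOpenPartialHomeomorph_source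
  have hat : ((1 : ℝ), a) ∈ g.target := hg0 ▸ g.map_source h0s
  have hsa : g.symm (1, a) = 0 := by rw [← hg0, g.left_inv h0s]
  have hc : Continuous fun α : ℝ => ((1 : ℝ), α) := by fun_prop
  have ev1 : ∀ᶠ α in 𝓝 a, ((1 : ℝ), α) ∈ g.target :=
    hc.continuousAt.eventually (g.open_target.mem_nhds hat)
  have ev2 : ∀ᶠ α in 𝓝 a, ‖g.symm (1, α)‖ < min ε (η / 8) := by
    have : ContinuousAt (fun α : ℝ => g.symm (1, α)) a :=
      ContinuousAt.comp (f := fun α : ℝ => ((1 : ℝ), α)) (g.continuousAt_symm hat) hc.continuousAt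
    refine this.norm.eventually (gt_mem_nhds ?_)
    change ‖g.symm (1, a)‖ < _
    rw [hsa, norm_zero]
    positivity
  obtain ⟨ρ, hρ, hball⟩ := Metric.eventually_nhds_iff.1 (ev1.and ev2)
  refine ⟨ρ, hρ, fun α => g.symm (1, α), fun α hα => ?_⟩
  obtain ⟨h1, h2⟩ := hball (show dist α a < ρ from hα)
  have h3 := g.right_inv h1
  rw [hgc, Prod.mk.injEq] at h3
  refine ⟨ContinuousAt.comp (f := fun α : ℝ => ((1 : ℝ), α)) (g.continuousAt_symm h1)
    hc.continuousAt, h2.trans_le (min_le_left _ _), h3.1, ?_⟩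
  rw [← div_eq_mul_inv, div_eq_iff (H.mom_fst_pos (h2.le.trans (min_le_right _ _))).ne'] at h3
  exact h3.2

end TiltPair

lemma norm_cexp_sub_taylor_le {b θ U c : ℝ} (hb : 1 ≤ b) (hθ : |θ| ≤ 1) (hU : |U| ≤ b / 2)
    (hc : |c| ≤ θ ^ 2 * (b / 2)) :
    ‖Complex.exp (Complex.I * θ * U + c) - 1 - (Complex.I * θ * U + c - θ ^ 2 * U ^ 2 / 2)‖ ≤
      2 * (|θ| ^ 3 * b ^ 3 * Real.exp (|θ| * b)) := by
  set z : ℂ := Complex.I * θ * U with hz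
  have hzn : ‖z‖ ≤ |θ| * b / 2 := by
    simp only [hz, norm_mul, Complex.norm_I, one_mul, Complex.norm_real, Real.norm_eq_abs]
    rw [mul_div_assoc]; gcongr
  have hcn : ‖(c : ℂ)‖ ≤ |θ| ^ 2 * (b / 2) := by
    rw [Complex.norm_real, Real.norm_eq_abs, sq_abs]; exact hc
  have hcn' : ‖(c : ℂ)‖ ≤ |θ| * b / 2 := by
    refine hcn.trans ?_
    rw [mul_div_assoc]; gcongr
    exact pow_le_of_le_one (abs_nonneg _) hθ two_ne_zero
  have hX : ‖z + c‖ ≤ |θ| * b := (norm_add_le _ _).trans (by linarith)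
  have h1 := Complex.norm_exp_sub_sum_le_norm_mul_exp (z + c) 3
  have hz2 : z ^ 2 = -(θ ^ 2 * U ^ 2) := by
    rw [hz, mul_pow, mul_pow, Complex.I_sq]; ring
  have hsplit : Complex.exp (z + c) - 1 - (z + c - θ ^ 2 * U ^ 2 / 2) =
      (Complex.exp (z + c) - ∑ m ∈ Finset.range 3, (z + c) ^ m / m.factorial) +
        c * (2 * z + c) / 2 := by
    have : (θ : ℂ) ^ 2 * U ^ 2 = - z ^ 2 := by rw [hz2, neg_neg]
    rw [this]
    simp [Finset.sum_range_succ]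
    ring
  rw [hsplit]
  refine (norm_add_le _ _).trans ?_
  have h2 : ‖(c : ℂ) * (2 * z + c) / 2‖ ≤ |θ| ^ 3 * b ^ 3 * Real.exp (|θ| * b) := by
    have h3 : ‖2 * z + (c : ℂ)‖ ≤ 2 * (|θ| * b) := by
      refine (norm_add_le _ _).trans ?_
      rw [norm_mul, Complex.norm_ofNat]
      have : 0 ≤ |θ| * b := by positivity
      linarith
    rw [norm_div, norm_mul, Complex.norm_ofNat]
    calc _ ≤ |θ| ^ 2 * (b / 2) * (2 * (|θ| * b)) / 2 := by gcongr
      _ = |θ| ^ 3 * b ^ 2 * (1 / 2) := by ring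
      _ ≤ |θ| ^ 3 * b ^ 3 * Real.exp (|θ| * b) := by
        gcongr
        · norm_num
        · exact (by norm_num : (1 / 2 : ℝ) ≤ 1).trans (Real.one_le_exp (by positivity))
  have h4 : ‖z + (c : ℂ)‖ ^ 3 * Real.exp ‖z + (c : ℂ)‖ ≤
      |θ| ^ 3 * b ^ 3 * Real.exp (|θ| * b) := by
    rw [← mul_pow]; gcongr
  linarith

namespace TiltPair

variable {Ω : Type} {τ ζ : Ω → ℕ} {η : ℝ} [MeasurableSpace Ω] {P : Measure Ω}

lemma integrable_dens (H : TiltPair P τ ζ η) {q : ℝ × ℝ} (hq : ‖q‖ ≤ η / 8) :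
    Integrable (dens τ ζ q) P := by
  have := H.integrable_mul_dens (φ := fun _ => 1) (k := 0) measurable_const (by simp) hq
  simpa using this

lemma lintegral_dens (H : TiltPair P τ ζ η) {q : ℝ × ℝ} (hq : ‖q‖ ≤ η / 8)
    (h1 : mom P τ ζ (fun _ => 1) q = 1) : ∫⁻ ω, ENNReal.ofReal (dens τ ζ q ω) ∂P = 1 := by
  rw [← ofReal_integral_eq_lintegral_ofReal (H.integrable_dens hq)
    (ae_of_all _ fun ω => (dens_pos q ω).le)]
  simp only [mom, one_mul] at h1
  rw [h1, ENNReal.ofReal_one]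

/-- The tilt `q` maximizes `l + α m` over the sublevel set of the moment generating function. -/
lemma add_mul_le_of_lintegral_le (H : TiltPair P τ ζ η) [IsProbabilityMeasure P] {q : ℝ × ℝ}
    {α : ℝ} (hq : ‖q‖ ≤ η / 8) (h1 : mom P τ ζ (fun _ => 1) q = 1)
    (h2 : mom P τ ζ (fun ω => (ζ ω : ℝ)) q = α * mom P τ ζ (fun ω => (τ ω : ℝ)) q)
    {q' : ℝ × ℝ} (hq' : ∫⁻ ω, ENNReal.ofReal (dens τ ζ q' ω) ∂P ≤ 1) :
    q'.1 + α * q'.2 ≤ q.1 + α * q.2 ∧ (q'.1 + α * q'.2 = q.1 + α * q.2 → q' = q) := by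
  have hpos : 0 < mom P τ ζ (fun ω => (τ ω : ℝ)) q := H.mom_fst_pos hq
  have hi' : Integrable (dens τ ζ q') P := by
    refine ⟨(H.measurable_dens q').aestronglyMeasurable, ?_⟩
    rw [hasFiniteIntegral_iff_ofReal (ae_of_all _ fun ω => (dens_pos q' ω).le)]
    exact hq'.trans_lt ENNReal.one_lt_top
  have hle1 : ∫ ω, dens τ ζ q' ω ∂P ≤ 1 := by
    rw [← ofReal_integral_eq_lintegral_ofReal hi' (ae_of_all _ fun ω => (dens_pos q' ω).le)] at hq'
    exact ENNReal.ofReal_le_one.1 hq'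
  have i0 := H.integrable_dens hq
  have iτ := H.integrable_mul_dens H.measurable_fst_real abs_fst_le hq
  have iζ := H.integrable_mul_dens H.measurable_snd_real H.abs_snd_le hq
  set X : Ω → ℝ := fun ω => (q'.1 - q.1) * τ ω + (q'.2 - q.2) * ζ ω with hX
  have hdens : ∀ ω, dens τ ζ q' ω = dens τ ζ q ω * Real.exp (X ω) := fun ω => by
    rw [dens, dens, ← Real.exp_add]; congr 1; simp only [hX]; ring
  set f : Ω → ℝ := fun ω => dens τ ζ q' ω - (dens τ ζ q ω + ((q'.1 - q.1) * (τ ω * dens τ ζ q ω) +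
    (q'.2 - q.2) * (ζ ω * dens τ ζ q ω))) with hf
  have hfX : ∀ ω, f ω = dens τ ζ q ω * (Real.exp (X ω) - (X ω + 1)) := fun ω => by
    simp only [hf, hdens, hX]; ring
  have hf0 : ∀ ω, 0 ≤ f ω := fun ω => by
    rw [hfX]
    exact mul_nonneg (dens_pos q ω).le (sub_nonneg.2 (Real.add_one_le_exp _))
  have i3 : Integrable (fun ω => (q'.1 - q.1) * (τ ω * dens τ ζ q ω) +
    (q'.2 - q.2) * (ζ ω * dens τ ζ q ω)) P := (iτ.const_mul _).add (iζ.const_mul _)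
  have i4 : Integrable (fun ω => dens τ ζ q ω + ((q'.1 - q.1) * (τ ω * dens τ ζ q ω) +
    (q'.2 - q.2) * (ζ ω * dens τ ζ q ω))) P := i0.add i3
  have hintegral : ∫ ω, f ω ∂P = ∫ ω, dens τ ζ q' ω ∂P - (1 + (q'.1 + α * q'.2 - (q.1 + α * q.2)) *
      mom P τ ζ (fun ω => (τ ω : ℝ)) q) := by
    simp only [mom, one_mul] at h1 h2
    simp only [hf]
    rw [integral_sub hi' i4, integral_add i0 i3, integral_add (iτ.const_mul _) (iζ.const_mul _),
      integral_const_mul, integral_const_mul, h1, h2, mom]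
    ring
  have hge : 0 ≤ ∫ ω, f ω ∂P := integral_nonneg hf0
  have hmul : (q'.1 + α * q'.2 - (q.1 + α * q.2)) * mom P τ ζ (fun ω => (τ ω : ℝ)) q ≤ 0 := by
    linarith
  refine ⟨?_, fun heq => ?_⟩
  · by_contra! hlt
    exact absurd hmul (not_le.2 (mul_pos (sub_pos.2 hlt) hpos))
  · rw [heq, sub_self, zero_mul] at hintegral
    have h0 : ∫ ω, f ω ∂P = 0 := le_antisymm (by linarith) hge
    have h3 := (integral_eq_zero_iff_of_nonneg hf0 (hi'.sub i4)).1 h0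
    have h4 : ∀ᵐ ω ∂P, (q'.1 - q.1) * τ ω + (q'.2 - q.2) * ζ ω = 0 := by
      filter_upwards [h3] with ω hω
      rw [hfX, Pi.zero_apply, mul_eq_zero, or_iff_right (dens_pos q ω).ne'] at hω
      by_contra hne
      exact (Real.add_one_lt_exp hne).ne' (sub_eq_zero.1 hω)
    obtain ⟨e1, e2⟩ := H.eq_zero_of_ae h4
    exact Prod.ext (sub_eq_zero.1 e1) (sub_eq_zero.1 e2)

lemma exists_norm_one_sub_integral_le (H : TiltPair P τ ζ η) [IsProbabilityMeasure P] {B : ℝ}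
    (hB : 0 ≤ B) : ∃ C, ∃ θ0 > 0, ∀ (q : ℝ × ℝ) (α sg θ : ℝ), ‖q‖ ≤ η / 8 →
      mom P τ ζ (fun _ => 1) q = 1 →
      mom P τ ζ (fun ω => (ζ ω : ℝ)) q = α * mom P τ ζ (fun ω => (τ ω : ℝ)) q →
      mom P τ ζ (fun ω => ((ζ ω : ℝ) - α * τ ω) ^ 2) q = sg * mom P τ ζ (fun ω => (τ ω : ℝ)) q →
      |α| ≤ B → |sg| ≤ B → |θ| ≤ θ0 →
      ‖1 - ∫ ω, Complex.exp ((q.1 + (-(α * θ * Complex.I) + sg * θ ^ 2 / 2)) * τ ω +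
        (q.2 + θ * Complex.I) * ζ ω) ∂P‖ ≤ C * |θ| ^ 3 := by
  have hη := H.η_pos
  set K := 2 * (2 * (1 + B)) ^ 3 * Real.exp (η / 4) with hK
  refine ⟨∫ ω, K * (((τ ω : ℝ) + 1) ^ 3 * Real.exp (η / 2 * τ ω)) ∂P,
    min 1 (η / (8 * (1 + B))), by positivity, fun q α sg θ hq h1 h2 h3 hα hsg hθ => ?_⟩
  have hθ1 : |θ| ≤ 1 := hθ.trans (min_le_left _ _)
  have hθ2 : |θ| * (2 * (1 + B)) ≤ η / 4 := by
    have := hθ.trans (min_le_right _ _)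
    rw [le_div_iff₀ (by positivity)] at this
    linarith
  set U : Ω → ℝ := fun ω => (ζ ω : ℝ) - α * τ ω with hU
  set c : Ω → ℝ := fun ω => sg * θ ^ 2 / 2 * τ ω with hc
  set r : Ω → ℂ := fun ω => Complex.exp (Complex.I * θ * U ω + c ω) - 1 -
    (Complex.I * θ * U ω + c ω - θ ^ 2 * (U ω) ^ 2 / 2) with hr
  have hUm : Measurable U := H.measurable_snd_real.sub (H.measurable_fst_real.const_mul α)
  have hcm : Measurable c := H.measurable_fst_real.const_mul _
  have hdm := H.measurable_dens q
  have hrm : Measurable r := by fun_prop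
  have hrle : ∀ ω, ‖r ω * dens τ ζ q ω‖ ≤
      |θ| ^ 3 * (K * (((τ ω : ℝ) + 1) ^ 3 * Real.exp (η / 2 * τ ω))) := fun ω => by
    have hζ : (ζ ω : ℝ) ≤ τ ω := by exact_mod_cast H.snd_le ω
    have hτ : (0 : ℝ) ≤ τ ω := Nat.cast_nonneg _
    have e1 : |U ω| ≤ 2 * (1 + B) * (τ ω + 1) / 2 := by
      have : |U ω| ≤ |(ζ ω : ℝ)| + |α * τ ω| := abs_sub _ _
      rw [abs_mul, Nat.abs_cast, Nat.abs_cast] at this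
      nlinarith [mul_le_mul_of_nonneg_right hα hτ]
    have e2 : |c ω| ≤ θ ^ 2 * (2 * (1 + B) * (τ ω + 1) / 2) := by
      simp only [hc]
      rw [abs_mul, abs_div, abs_mul, Nat.abs_cast, abs_two, abs_of_nonneg (sq_nonneg θ)]
      calc _ ≤ B * θ ^ 2 / 2 * τ ω := by gcongr
        _ = θ ^ 2 * (B * τ ω / 2) := by ring
        _ ≤ _ := by gcongr ?_ * ?_; nlinarith
    have e3 := norm_cexp_sub_taylor_le (b := 2 * (1 + B) * (τ ω + 1)) (by nlinarith) hθ1 e1 e2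
    have e4 : |θ| * (2 * (1 + B) * (τ ω + 1)) ≤ η / 4 * (τ ω + 1) := by
      rw [← mul_assoc]; gcongr
    rw [norm_mul, Complex.norm_real, Real.norm_of_nonneg (dens_pos q ω).le]
    calc ‖r ω‖ * dens τ ζ q ω ≤ 2 * (|θ| ^ 3 * (2 * (1 + B) * (τ ω + 1)) ^ 3 *
          Real.exp (|θ| * (2 * (1 + B) * (τ ω + 1)))) * Real.exp (η / 4 * τ ω) :=
          mul_le_mul e3 (H.dens_le hq ω) (dens_pos q ω).le (by positivity)
      _ ≤ 2 * (|θ| ^ 3 * (2 * (1 + B) * (τ ω + 1)) ^ 3 *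
          Real.exp (η / 4 * (τ ω + 1))) * Real.exp (η / 4 * τ ω) := by
          gcongr
      _ = |θ| ^ 3 * (2 * (2 * (1 + B)) ^ 3 * (τ ω + 1) ^ 3 *
          (Real.exp (η / 4 * (τ ω + 1)) * Real.exp (η / 4 * τ ω))) := by ring
      _ = |θ| ^ 3 * (2 * (2 * (1 + B)) ^ 3 * (τ ω + 1) ^ 3 *
          (Real.exp (η / 4) * Real.exp (η / 2 * τ ω))) := by
          rw [← Real.exp_add, ← Real.exp_add]; ring_nf
      _ = _ := by rw [hK]; ring
  have hKi : Integrable (fun ω => K * (((τ ω : ℝ) + 1) ^ 3 * Real.exp (η / 2 * τ ω))) P :=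
    (H.integrable_pow_mul_exp 3).const_mul K
  have ir : Integrable (fun ω => r ω * dens τ ζ q ω) P :=
    (hKi.const_mul (|θ| ^ 3)).mono' (by fun_prop) (ae_of_all _ hrle)
  have i0 := H.integrable_dens hq
  have iτ := H.integrable_mul_dens H.measurable_fst_real abs_fst_le hq
  have iζ := H.integrable_mul_dens H.measurable_snd_real H.abs_snd_le hq
  obtain ⟨j1, j2, j3⟩ := H.integrable_quadratic hq
  have iU : Integrable (fun ω => U ω * dens τ ζ q ω) P :=
    (iζ.sub (iτ.const_mul α)).congr (ae_of_all _ fun ω => by simp only [Pi.sub_apply, hU]; ring)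
  have iU2 : Integrable (fun ω => U ω ^ 2 * dens τ ζ q ω) P :=
    ((j1.sub (j2.const_mul (2 * α))).add (j3.const_mul (α ^ 2))).congr
      (ae_of_all _ fun ω => by simp only [Pi.sub_apply, Pi.add_apply, hU]; ring)
  have iV : Integrable (fun ω => sg * (τ ω * dens τ ζ q ω) - U ω ^ 2 * dens τ ζ q ω) P :=
    (iτ.const_mul sg).sub iU2
  simp only [mom, one_mul] at h1 h2 h3
  have eU : ∫ ω, U ω * dens τ ζ q ω ∂P = 0 := by
    have : ∀ ω, U ω * dens τ ζ q ω = ζ ω * dens τ ζ q ω - α * (τ ω * dens τ ζ q ω) :=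
      fun ω => by simp only [hU]; ring
    simp only [this]
    rw [integral_sub iζ (iτ.const_mul α), integral_const_mul, h2, sub_self]
  have eV : ∫ ω, (sg * (τ ω * dens τ ζ q ω) - U ω ^ 2 * dens τ ζ q ω) ∂P = 0 := by
    rw [integral_sub (iτ.const_mul sg) iU2, integral_const_mul, h3, sub_self]
  have hsplit : ∀ ω, Complex.exp ((q.1 + (-(α * θ * Complex.I) + sg * θ ^ 2 / 2)) * τ ω +
      (q.2 + θ * Complex.I) * ζ ω) = ((dens τ ζ q ω : ℝ) : ℂ) +
      (Complex.I * θ * ((U ω * dens τ ζ q ω : ℝ) : ℂ) +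
      (θ ^ 2 / 2 * ((sg * (τ ω * dens τ ζ q ω) - U ω ^ 2 * dens τ ζ q ω : ℝ) : ℂ) +
      r ω * dens τ ζ q ω)) := fun ω => by
    have : Complex.exp ((q.1 + (-(α * θ * Complex.I) + sg * θ ^ 2 / 2)) * τ ω +
      (q.2 + θ * Complex.I) * ζ ω) =
        Complex.exp (Complex.I * θ * U ω + c ω) * ((dens τ ζ q ω : ℝ) : ℂ) := by
      rw [dens, Complex.ofReal_exp, ← Complex.exp_add]
      congr 1
      simp only [hU, hc]
      push_cast
      ring
    rw [this]
    simp only [hr, hc]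
    push_cast
    ring
  have k1 : Integrable (fun ω => θ ^ 2 / 2 *
      ((sg * (τ ω * dens τ ζ q ω) - U ω ^ 2 * dens τ ζ q ω : ℝ) : ℂ)) P := iV.ofReal.const_mul _
  have k2 : Integrable (fun ω => Complex.I * θ * ((U ω * dens τ ζ q ω : ℝ) : ℂ)) P :=
    iU.ofReal.const_mul _
  have k3 : Integrable (fun ω => θ ^ 2 / 2 *
      ((sg * (τ ω * dens τ ζ q ω) - U ω ^ 2 * dens τ ζ q ω : ℝ) : ℂ) + r ω * dens τ ζ q ω) P :=
    k1.add ir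
  have k4 : Integrable (fun ω => Complex.I * θ * ((U ω * dens τ ζ q ω : ℝ) : ℂ) + (θ ^ 2 / 2 *
      ((sg * (τ ω * dens τ ζ q ω) - U ω ^ 2 * dens τ ζ q ω : ℝ) : ℂ) + r ω * dens τ ζ q ω)) P :=
    k2.add k3
  have k0 : Integrable (fun ω => ((dens τ ζ q ω : ℝ) : ℂ)) P := i0.ofReal
  simp only [hsplit]
  rw [integral_add k0 k4, integral_add k2 k3, integral_add k1 ir, integral_const_mul,
    integral_const_mul, integral_complex_ofReal,
    integral_complex_ofReal, integral_complex_ofReal, h1, eU, eV]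
  simp only [Complex.ofReal_one, Complex.ofReal_zero, mul_zero, zero_add, sub_add_cancel_left,
    norm_neg]
  refine (norm_integral_le_of_norm_le (hKi.const_mul (|θ| ^ 3)) (ae_of_all _ hrle)).trans ?_
  rw [integral_const_mul, mul_comm]

end TiltPair

namespace BitChain

variable {Y : Type} (C : BitChain Y)

lemma norm_cw (l w : ℂ) (c : Bool) : ‖cw l w c‖ = ew l.re w.re c := by
  rw [cw, ew, Complex.norm_exp]
  cases c <;> simp

lemma re_tilt (l α sg θ : ℝ) :
    ((l : ℂ) + (-(α * θ * Complex.I) + sg * θ ^ 2 / 2)).re = l + sg * θ ^ 2 / 2 := by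
  have : (sg : ℂ) * (θ : ℂ) ^ 2 / 2 = ((sg * θ ^ 2 / 2 : ℝ) : ℂ) := by push_cast; ring
  rw [this, Complex.add_re, Complex.add_re, Complex.ofReal_re, Complex.ofReal_re]
  simp

lemma cw_ofReal (l m : ℝ) : cw l m = fun c => (ew l m c : ℂ) := by
  ext c
  cases c <;> simp [cw, ew]

lemma ew_lt_rad {q : ℝ × ℝ} (hq : ‖q‖ < Real.log C.rad / 2) (c : Bool) :
    ew q.1 q.2 c < C.rad := by
  have h1 := (le_abs_self q.1).trans (norm_fst_le q)
  have h2 := (le_abs_self q.2).trans (norm_snd_le q)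
  rw [ew, ← Real.lt_log_iff_exp_lt C.rad_pos]
  have h3 := norm_nonneg q
  cases c
  · simp only [Bool.false_eq_true, if_false]; linarith
  · simp only [if_true]; linarith

variable {Ω : Type} [MeasurableSpace Ω] {P : Measure Ω} [IsProbabilityMeasure P] {τ ζ : Ω → ℕ}
  {η : ℝ}

open TiltPair in
/-- The local limit theorem for the number of ones, when the generating function of the
regeneration vector is the moment generating function of `(τ, ζ)`. -/
theorem exists_local_limit (H : TiltPair P τ ζ η)
    (hh : ∀ l w : ℂ, (∀ c, ‖cw l w c‖ ≤ C.rad) →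
      ∫ ω, Complex.exp (l * τ ω + w * ζ ω) ∂P = C.h (cw l w) C.y0) :
    ∃ ρ > 0, ∃ q : ℝ → ℝ × ℝ, ∀ α : ℝ,
      |α - mom P τ ζ (fun ω => (ζ ω : ℝ)) 0 / mom P τ ζ (fun ω => (τ ω : ℝ)) 0| < ρ →
      (∀ c, ew (q α).1 (q α).2 c < C.rad) ∧
      ∫⁻ ω, ENNReal.ofReal (dens τ ζ (q α) ω) ∂P = 1 ∧
      (∀ q' : ℝ × ℝ, ∫⁻ ω, ENNReal.ofReal (dens τ ζ q' ω) ∂P ≤ 1 →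
        q'.1 + α * q'.2 ≤ (q α).1 + α * (q α).2 ∧
        (q'.1 + α * q'.2 = (q α).1 + α * (q α).2 → q' = q α)) ∧
      ∀ x : ℕ → ℕ, Tendsto (fun n => (x n : ℝ) / n) atTop (𝓝 α) → ∀ y, ∃ K, 0 < K ∧
        Tendsto (fun n : ℕ => √n * (Real.exp (n * (q (x n / n)).1 + (q (x n / n)).2 * x n) *
          C.Ex n (fun b => if b.count true = x n then 1 else 0) y)) atTop (𝓝 K) := by
  have hη := H.η_pos
  have hlog : 0 < Real.log C.rad := Real.log_pos C.one_lt_rad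
  obtain ⟨ρ, hρ, q, hq⟩ := H.exists_solution (ε := min (η / 8) (Real.log C.rad / 2))
    (by positivity)
  refine ⟨ρ, hρ, q, fun α hα => ?_⟩
  set a := mom P τ ζ (fun ω => (ζ ω : ℝ)) 0 / mom P τ ζ (fun ω => (τ ω : ℝ)) 0 with ha
  obtain ⟨hc, hn, h1, h2⟩ := hq α hα
  have hn8 := hn.trans_le (min_le_left _ _)
  have hrad : ∀ c, ew (q α).1 (q α).2 c < C.rad := C.ew_lt_rad (hn.trans_le (min_le_right _ _))
  refine ⟨hrad, H.lintegral_dens hn8.le h1, fun q' hq' =>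
    H.add_mul_le_of_lintegral_le hn8.le h1 h2 hq', fun x hx y => ?_⟩
  have hreal : ∀ q : ℝ × ℝ, ‖q‖ < min (η / 8) (Real.log C.rad / 2) →
      mom P τ ζ (fun _ => 1) q = 1 → C.h (ew q.1 q.2) C.y0 = 1 := fun q hq h1 => by
    have h3 := hh q.1 q.2 fun c => by
      rw [norm_cw, Complex.ofReal_re, Complex.ofReal_re]
      exact (C.ew_lt_rad (hq.trans_le (min_le_right _ _)) c).le
    rw [cw_ofReal, h_ofReal] at h3
    rw [← Complex.ofReal_inj, ← h3, ← h1, mom, ← integral_complex_ofReal]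
    refine integral_congr_ae (ae_of_all _ fun ω => ?_)
    simp [dens]
  have hev : ∀ᶠ n : ℕ in atTop, |(x n : ℝ) / n - a| < ρ :=
    ((hx.sub_const a).abs).eventually (gt_mem_nhds hα)
  set sg : ℝ → ℝ := fun α => (mom P τ ζ (fun ω => (ζ ω : ℝ) * ζ ω) (q α) -
    2 * α * mom P τ ζ (fun ω => (τ ω : ℝ) * ζ ω) (q α) +
    α ^ 2 * mom P τ ζ (fun ω => (τ ω : ℝ) * τ ω) (q α)) / mom P τ ζ (fun ω => (τ ω : ℝ)) (q α)
    with hsg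
  have hsgc : ContinuousAt sg α := by
    have c1 : ContinuousAt (mom P τ ζ fun ω => (ζ ω : ℝ) * ζ ω) (q α) :=
      H.continuousAt_mom (H.measurable_snd_real.mul H.measurable_snd_real)
        (H.abs_mul_snd_le H.abs_snd_le) hn8
    have c2 : ContinuousAt (mom P τ ζ fun ω => (τ ω : ℝ) * ζ ω) (q α) :=
      H.continuousAt_mom (H.measurable_fst_real.mul H.measurable_snd_real)
        (H.abs_mul_snd_le abs_fst_le) hn8
    have c3 : ContinuousAt (mom P τ ζ fun ω => (τ ω : ℝ) * τ ω) (q α) :=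
      H.continuousAt_mom (H.measurable_fst_real.mul H.measurable_fst_real)
        (abs_mul_fst_le abs_fst_le) hn8
    have c4 : ContinuousAt (mom P τ ζ fun ω => (τ ω : ℝ)) (q α) :=
      H.continuousAt_mom H.measurable_fst_real abs_fst_le hn8
    have d0 := (H.mom_fst_pos hn8.le).ne'
    have d1 : ContinuousAt (mom P τ ζ (fun ω => (ζ ω : ℝ) * ζ ω) ∘ q) α := c1.comp hc
    have d2 : ContinuousAt (mom P τ ζ (fun ω => (τ ω : ℝ) * ζ ω) ∘ q) α := c2.comp hc
    have d3 : ContinuousAt (mom P τ ζ (fun ω => (τ ω : ℝ) * τ ω) ∘ q) α := c3.comp hc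
    have d4 : ContinuousAt (mom P τ ζ (fun ω => (τ ω : ℝ)) ∘ q) α := c4.comp hc
    exact ((d1.sub ((continuousAt_const.mul continuousAt_id).mul d2)).add
      ((continuousAt_id.pow 2).mul d3)).div d4 d0
  have hqx : Tendsto (fun n : ℕ => q (x n / n)) atTop (𝓝 (q α)) := hc.tendsto.comp hx
  have hsgx : Tendsto (fun n : ℕ => sg (x n / n)) atTop (𝓝 (sg α)) := hsgc.tendsto.comp hx
  have hlam := (continuous_fst.tendsto _).comp hqx
  have hmu := (continuous_snd.tendsto _).comp hqx
  refine C.exists_tendsto_sqrt_mul_Ex hlam hmu hsgx hx hrad (hreal _ hn h1)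
    (hev.mono fun n hn => ?_) (fun s => ?_) y
  · obtain ⟨-, k1, k2, -⟩ := hq _ hn
    exact hreal _ k1 k2
  · obtain ⟨B, hB0, hBα, hBs⟩ : ∃ B : ℝ, 0 ≤ B ∧ |α| < B ∧ |sg α| < B :=
      ⟨max |α| |sg α| + 1, by positivity, by linarith [le_max_left |α| |sg α|],
        by linarith [le_max_right |α| |sg α|]⟩
    obtain ⟨K, θ0, hθ0, hK⟩ := H.exists_norm_one_sub_integral_le hB0
    have hθ : Tendsto (fun n : ℕ => s / √(n : ℝ)) atTop (𝓝 0) :=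
      tendsto_const_nhds.div_atTop
        (Real.tendsto_sqrt_atTop.comp tendsto_natCast_atTop_atTop)
    have e1 : ∀ᶠ n : ℕ in atTop, |s / √(n : ℝ)| < θ0 := by
      have := hθ.abs
      rw [abs_zero] at this
      exact this.eventually (gt_mem_nhds hθ0)
    have e2 := hx.abs.eventually (gt_mem_nhds hBα)
    have e3 := hsgx.abs.eventually (gt_mem_nhds hBs)
    have e4 : ∀ᶠ n : ℕ in atTop, ∀ c,
        ew ((q (x n / n)).1 + sg (x n / n) * (s / √n) ^ 2 / 2) (q (x n / n)).2 c < C.rad := by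
      rw [eventually_all]
      intro c
      have l1 : Tendsto (fun n : ℕ => (q (x n / n)).1 + sg (x n / n) * (s / √n) ^ 2 / 2) atTop
          (𝓝 (q α).1) := by
        simpa using hlam.add ((hsgx.mul (hθ.pow 2)).div_const 2)
      have l2 : Tendsto (fun n : ℕ => ew ((q (x n / n)).1 + sg (x n / n) * (s / √n) ^ 2 / 2)
          (q (x n / n)).2 c) atTop (𝓝 (ew (q α).1 (q α).2 c)) := by
        simp only [ew]
        refine (Real.continuous_exp.tendsto _).comp (l1.add ?_)
        cases c
        · simp
        · exact hmu
      exact l2.eventually (gt_mem_nhds (hrad c))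
    have hlim : Tendsto (fun n : ℕ => |K| * |s| ^ 3 * (1 / √(n : ℝ))) atTop (𝓝 0) := by
      have : Tendsto (fun n : ℕ => 1 / √(n : ℝ)) atTop (𝓝 0) := tendsto_const_nhds.div_atTop
        (Real.tendsto_sqrt_atTop.comp tendsto_natCast_atTop_atTop)
      simpa using this.const_mul (|K| * |s| ^ 3)
    refine squeeze_zero' (Eventually.of_forall fun n => by positivity) ?_ hlim
    filter_upwards [e1, e2, e3, e4, hev, eventually_gt_atTop 0] with n f1 f2 f3 f4 f5 f6
    obtain ⟨-, k1, k2, k3⟩ := hq _ f5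
    have k8 := (k1.trans_le (min_le_left _ _)).le
    have k4 := hK (q (x n / n)) (x n / n) (sg (x n / n)) (s / √n) k8 k2 k3
      (by rw [H.mom_sq_sub _ k8, hsg, div_mul_cancel₀ _ (H.mom_fst_pos k8).ne'])
      f2.le f3.le f1.le
    rw [hh _ _ fun c => ?_] at k4
    · calc _ ≤ n * (K * |s / √n| ^ 3) := by gcongr; exact k4
        _ ≤ n * (|K| * |s / √n| ^ 3) := by gcongr; exact le_abs_self K
        _ = |K| * |s| ^ 3 * (1 / √n) := by
          have h5 : (0 : ℝ) < √n := Real.sqrt_pos.2 (Nat.cast_pos.2 f6)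
          have h6 : (n : ℝ) = √n * √n := (Real.mul_self_sqrt (Nat.cast_nonneg n)).symm
          rw [abs_div, abs_of_pos h5]
          nth_rw 1 [h6]
          field_simp
    · rw [norm_cw]
      refine le_of_eq_of_le ?_ (f4 c).le
      congr 1
      · exact re_tilt _ _ _ _
      · simp

end BitChain

namespace BitChain

/-- `f` depends only on the bits `X 1, …, X n`. -/
def Adapted {Ω β : Type} (X : ℕ → Ω → Bool) (n : ℕ) (f : Ω → β) : Prop :=
  ∀ ω η, (∀ i : Fin n, X (i.1 + 1) ω = X (i.1 + 1) η) → f ω = f η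

/-- The bits `X 1, X 2, …` are emitted by the chain, whose states are `st 0, st 1, …`. -/
structure IsPath {Y : Type} (C : BitChain Y) {Ω : Type} [MeasurableSpace Ω] (P : Measure Ω)
    (X : ℕ → Ω → Bool) (st : ℕ → Ω → Y) (yI : Y) : Prop where
  measurable_bit : ∀ n, Measurable (X n)
  st_zero : ∀ ω, st 0 ω = yI
  st_succ : ∀ n ω, st (n + 1) ω = C.step (st n ω) (X (n + 1) ω)
  trans : ∀ (n : ℕ) (b : Fin n → Bool) (y : Y),
    (∀ ω, (∀ i : Fin n, X (i.1 + 1) ω = b i) → st n ω = y) →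
    P {ω | (∀ i : Fin n, X (i.1 + 1) ω = b i) ∧ X (n + 1) ω = true} =
      ENNReal.ofReal (C.pr y true) * P {ω | ∀ i : Fin n, X (i.1 + 1) ω = b i}

namespace Adapted

variable {Ω β : Type} {X : ℕ → Ω → Bool} {n : ℕ}

lemma mono {f : Ω → β} (h : Adapted X n f) {m : ℕ} (hnm : n ≤ m) : Adapted X m f :=
  fun ω ω' hω => h ω ω' fun i => hω ⟨i.1, i.2.trans_le hnm⟩

lemma comp {γ : Type} {f : Ω → β} (h : Adapted X n f) (g : β → γ) : Adapted X n fun ω => g (f ω) :=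
  fun ω ω' hω => congrArg g (h ω ω' hω)

lemma comp₂ {γ ε : Type} {f : Ω → β} {g : Ω → γ} (hf : Adapted X n f) (hg : Adapted X n g)
    (k : β → γ → ε) : Adapted X n fun ω => k (f ω) (g ω) :=
  fun ω ω' hω => congrArg₂ k (hf ω ω' hω) (hg ω ω' hω)

lemma const (b : β) : Adapted X n fun _ : Ω => b := fun _ _ _ => rfl

lemma bit {i : ℕ} (h0 : 0 < i) (hi : i ≤ n) : Adapted X n (X i) := fun ω ω' hω => by
  have := hω ⟨i - 1, by omega⟩
  rwa [show i - 1 + 1 = i by omega] at this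

lemma forall_nat {A : ℕ → Ω → Prop} (h : ∀ i, Adapted X n (A i)) :
    Adapted X n fun ω => ∀ i, A i ω :=
  fun ω ω' hω => propext (forall_congr' fun i => Eq.to_iff (h i ω ω' hω))

lemma eq_comp [Nonempty β] {f : Ω → β} (h : Adapted X n f) :
    ∃ g : (Fin n → Bool) → β, ∀ ω, f ω = g fun i => X (i.1 + 1) ω := by
  have hfac : Function.FactorsThrough f fun ω (i : Fin n) => X (i.1 + 1) ω :=
    fun ω ω' hω => h ω ω' fun i => congrFun hω i
  exact ⟨Function.extend (fun ω (i : Fin n) => X (i.1 + 1) ω) f fun _ => Classical.arbitrary β,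
    fun ω => (hfac.extend_apply _ ω).symm⟩

end Adapted

namespace IsPath

variable {Y : Type} {C : BitChain Y} {Ω : Type} [MeasurableSpace Ω] {P : Measure Ω}
  {X : ℕ → Ω → Bool} {st : ℕ → Ω → Y} {yI : Y} {n : ℕ}

lemma measurable_word (H : C.IsPath P X st yI) (n : ℕ) :
    Measurable fun ω (i : Fin n) => X (i.1 + 1) ω :=
  measurable_pi_lambda _ fun _ => H.measurable_bit _

lemma measurable_of_adapted (H : C.IsPath P X st yI) {β : Type} [MeasurableSpace β] [Nonempty β]
    {f : Ω → β} (h : Adapted X n f) : Measurable f := by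
  obtain ⟨g, hg⟩ := h.eq_comp
  rw [funext hg]
  exact (measurable_of_finite g).comp (H.measurable_word n)

lemma measurableSet_of_adapted (H : C.IsPath P X st yI) {A : Ω → Prop} (h : Adapted X n A) :
    MeasurableSet {ω | A ω} := measurableSet_setOfPred.2 (H.measurable_of_adapted h)

lemma integrable_of_adapted (H : C.IsPath P X st yI) [IsProbabilityMeasure P] {f : Ω → ℂ}
    (h : Adapted X n f) : Integrable f P := by
  obtain ⟨g, hg⟩ := h.eq_comp
  refine Integrable.of_bound (H.measurable_of_adapted h).aestronglyMeasurable (∑ b, ‖g b‖)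
    (ae_of_all _ fun ω => ?_)
  rw [hg]
  exact Finset.single_le_sum (f := fun b => ‖g b‖) (fun _ _ => norm_nonneg _) (Finset.mem_univ _)

lemma adapted_st (H : C.IsPath P X st yI) (n : ℕ) : Adapted X n (st n) := by
  induction n with
  | zero => exact fun ω ω' _ => by rw [H.st_zero, H.st_zero]
  | succ n ih =>
    have := (ih.mono n.le_succ).comp₂ (Adapted.bit n.succ_pos le_rfl) C.step
    exact fun ω ω' hω => by rw [H.st_succ, H.st_succ]; exact this ω ω' hω

lemma trans_bit (H : C.IsPath P X st yI) [IsProbabilityMeasure P] (b : Fin n → Bool) (y : Y)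
    (hy : ∀ ω, (∀ i : Fin n, X (i.1 + 1) ω = b i) → st n ω = y) (c : Bool) :
    P.real {ω | (∀ i : Fin n, X (i.1 + 1) ω = b i) ∧ X (n + 1) ω = c} =
      C.pr y c * P.real {ω | ∀ i : Fin n, X (i.1 + 1) ω = b i} := by
  have ht : P.real {ω | (∀ i : Fin n, X (i.1 + 1) ω = b i) ∧ X (n + 1) ω = true} =
      C.pr y true * P.real {ω | ∀ i : Fin n, X (i.1 + 1) ω = b i} := by
    rw [Measure.real, H.trans n b y hy, ENNReal.toReal_mul,
      ENNReal.toReal_ofReal (C.pr_nonneg y true), Measure.real]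
  cases c
  · have h1 : MeasurableSet {ω | X (n + 1) ω = true} :=
      H.measurable_bit _ (measurableSet_singleton true)
    have h2 := measureReal_inter_add_sdiff (μ := P)
      (s := {ω | ∀ i : Fin n, X (i.1 + 1) ω = b i}) h1
    have h3 : {ω | ∀ i : Fin n, X (i.1 + 1) ω = b i} \ {ω | X (n + 1) ω = true} =
        {ω | (∀ i : Fin n, X (i.1 + 1) ω = b i) ∧ X (n + 1) ω = false} := by
      ext ω; simp
    have h4 := C.sum_pr y
    rw [Fintype.sum_bool] at h4
    rw [h3, ← Set.ofPred_and, ht] at h2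
    rw [eq_sub_of_add_eq' h2, eq_sub_of_add_eq' h4]
    ring
  · exact ht

/-- The one-step Markov property. -/
lemma integral_mul_step (H : C.IsPath P X st yI) [IsProbabilityMeasure P] {F : Ω → ℂ}
    (hF : Adapted X n F) (c : Bool) :
    ∫ ω, F ω * (if X (n + 1) ω = c then 1 else 0) ∂P = ∫ ω, F ω * C.pr (st n ω) c ∂P := by
  set A : (Fin n → Bool) → Set Ω := fun b => {ω | ∀ i : Fin n, X (i.1 + 1) ω = b i} with hAdef
  have hA : ∀ b, MeasurableSet (A b) := fun b => by
    have : A b = (fun ω (i : Fin n) => X (i.1 + 1) ω) ⁻¹' {b} := by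
      ext ω; simp [hAdef, funext_iff]
    rw [this]
    exact H.measurable_word n (measurableSet_singleton b)
  have hU : ⋃ b, A b = Set.univ := Set.eq_univ_of_forall fun ω =>
    Set.mem_iUnion.2 ⟨fun i => X (i.1 + 1) ω, fun i => rfl⟩
  have hd : Pairwise (Function.onFun Disjoint A) := fun b b' hb =>
    Set.disjoint_left.2 fun ω h h' => hb (funext fun i => (h i).symm.trans (h' i))
  have hL : Adapted X (n + 1) fun ω => F ω * (if X (n + 1) ω = c then 1 else 0) :=
    (hF.mono n.le_succ).comp₂ (Adapted.bit n.succ_pos le_rfl)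
      fun z d => z * if d = c then 1 else 0
  have hR : Adapted X n fun ω => F ω * C.pr (st n ω) c :=
    hF.comp₂ (H.adapted_st n) fun z y => z * C.pr y c
  rw [← setIntegral_univ, ← setIntegral_univ (μ := P) (f := fun ω => F ω * _), ← hU,
    integral_iUnion_fintype hA hd fun b => (H.integrable_of_adapted hL).integrableOn,
    integral_iUnion_fintype hA hd fun b => (H.integrable_of_adapted hR).integrableOn]
  refine Finset.sum_congr rfl fun b _ => ?_
  rcases (A b).eq_empty_or_nonempty with h0 | ⟨ω0, hω0⟩
  · simp [h0]
  have hy : ∀ ω, ω ∈ A b → F ω = F ω0 ∧ st n ω = st n ω0 := fun ω hω =>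
    ⟨hF _ _ fun i => (hω i).trans (hω0 i).symm,
      H.adapted_st n _ _ fun i => (hω i).trans (hω0 i).symm⟩
  have hB : MeasurableSet {ω | X (n + 1) ω = c} := H.measurable_bit _ (measurableSet_singleton c)
  have e1 : ∫ ω in A b, F ω * (if X (n + 1) ω = c then 1 else 0) ∂P =
      ∫ ω in A b, Set.indicator {ω | X (n + 1) ω = c} (fun _ => F ω0) ω ∂P :=
    setIntegral_congr_fun (hA b) fun ω hω => by
      simp only [(hy ω hω).1, Set.indicator, Set.mem_ofPred_eq]
      split_ifs <;> simp
  have e2 : ∫ ω in A b, F ω * C.pr (st n ω) c ∂P = ∫ ω in A b, F ω0 * C.pr (st n ω0) c ∂P :=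
    setIntegral_congr_fun (hA b) fun ω hω => by simp only [(hy ω hω).1, (hy ω hω).2]
  rw [e1, e2, setIntegral_indicator hB, setIntegral_const, setIntegral_const]
  have := H.trans_bit b (st n ω0) (fun ω hω => (hy ω hω).2) c
  rw [Set.ofPred_and] at this
  rw [this, Complex.real_smul, Complex.real_smul]
  push_cast
  ring

lemma integral_mul_T (H : C.IsPath P X st yI) [IsProbabilityMeasure P] {F : Ω → ℂ}
    (hF : Adapted X n F) (a : Bool → ℂ) (f : Y → ℂ) :
    ∫ ω, F ω * (a (X (n + 1) ω) * f (st (n + 1) ω)) ∂P = ∫ ω, F ω * C.T a f (st n ω) ∂P := by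
  have hk : ∀ c, Adapted X n fun ω => F ω * (a c * f (C.step (st n ω) c)) := fun c =>
    hF.comp₂ (H.adapted_st n) fun z y => z * (a c * f (C.step y c))
  have e1 : ∀ ω, F ω * (a (X (n + 1) ω) * f (st (n + 1) ω)) =
      ∑ c, F ω * (a c * f (C.step (st n ω) c)) * if X (n + 1) ω = c then 1 else 0 := fun ω => by
    rw [H.st_succ]
    simp only [mul_ite, mul_one, mul_zero, Finset.sum_ite_eq, Finset.mem_univ, if_true]
  have e2 : ∀ ω, F ω * C.T a f (st n ω) =
      ∑ c, F ω * (a c * f (C.step (st n ω) c)) * C.pr (st n ω) c := fun ω => by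
    rw [T, Finset.mul_sum]
    exact Finset.sum_congr rfl fun c _ => by simp only [Complex.coe_algebraMap]; ring
  simp only [e1, e2]
  rw [integral_finsetSum, integral_finsetSum]
  · exact Finset.sum_congr rfl fun c _ => H.integral_mul_step (hk c) c
  · exact fun c _ => H.integrable_of_adapted ((hk c).comp₂ (H.adapted_st n) fun z y => z * C.pr y c)
  · exact fun c _ => H.integrable_of_adapted (((hk c).mono n.le_succ).comp₂
      (Adapted.bit n.succ_pos le_rfl) fun z d => z * if d = c then 1 else 0)

lemma integral_mul_Ex (H : C.IsPath P X st yI) [IsProbabilityMeasure P] (m : ℕ) {F : Ω → ℂ}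
    (hF : Adapted X n F) (f : List Bool → ℂ) :
    ∫ ω, F ω * f (List.ofFn fun i : Fin m => X (n + 1 + i.1) ω) ∂P =
      ∫ ω, F ω * C.Ex m f (st n ω) ∂P := by
  induction m generalizing n F f with
  | zero => simp [Ex_zero]
  | succ m ih =>
    have hk : ∀ c, Adapted X (n + 1) fun ω => F ω * if X (n + 1) ω = c then 1 else 0 := fun c =>
      (hF.mono n.le_succ).comp₂ (Adapted.bit n.succ_pos le_rfl)
        fun z d => z * if d = c then 1 else 0
    have e1 : ∀ ω, F ω * f (List.ofFn fun i : Fin (m + 1) => X (n + 1 + i.1) ω) =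
        ∑ c, (F ω * if X (n + 1) ω = c then 1 else 0) *
          f (c :: List.ofFn fun i : Fin m => X (n + 1 + 1 + i.1) ω) := fun ω => by
      simp only [List.ofFn_succ, mul_ite, mul_one, mul_zero, ite_mul, zero_mul, Finset.sum_ite_eq,
        Finset.mem_univ, if_true, Fin.val_zero, add_zero, Fin.val_succ]
      simp only [add_assoc, add_comm 1]
    have e2 : ∀ ω, F ω * C.Ex (m + 1) f (st n ω) = ∑ c, (F ω *
        C.Ex m (fun b => f (c :: b)) (C.step (st n ω) c)) * C.pr (st n ω) c := fun ω => by
      rw [Ex_succ, Finset.mul_sum]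
      exact Finset.sum_congr rfl fun c _ => by simp only [Complex.coe_algebraMap]; ring
    have hg : ∀ c, Adapted X n fun ω => F ω *
        C.Ex m (fun b => f (c :: b)) (C.step (st n ω) c) := fun c =>
      hF.comp₂ (H.adapted_st n) fun z y => z * C.Ex m (fun b => f (c :: b)) (C.step y c)
    have hw : Adapted X (n + 1 + m) fun ω => List.ofFn fun i : Fin m => X (n + 1 + 1 + i.1) ω :=
      fun ω ω' hω => congrArg List.ofFn (funext fun i =>
        Adapted.bit (n := n + 1 + m) (by omega) (by omega) ω ω' hω)
    simp only [e1, e2]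
    rw [integral_finsetSum, integral_finsetSum]
    · refine Finset.sum_congr rfl fun c _ => ?_
      rw [← H.integral_mul_step (hg c) c, ih (hk c) fun b => f (c :: b)]
      refine integral_congr_ae (ae_of_all _ fun ω => ?_)
      simp only [H.st_succ]
      split_ifs with h
      · rw [h]; ring
      · ring
    · exact fun c _ =>
        H.integrable_of_adapted ((hg c).comp₂ (H.adapted_st n) fun z y => z * C.pr y c)
    · exact fun c _ => H.integrable_of_adapted (((hk c).mono (Nat.le_add_right _ m)).comp₂ hw
        fun z b => z * f (c :: b))

end IsPath

end BitChain

namespace BitChain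

variable {Y : Type} (C : BitChain Y) {Ω : Type}

/-- The first time after `s` at which the state is `y0`; it is `0` if there is no such time. -/
def firstHit (st : ℕ → Ω → Y) (s : ℕ) (ω : Ω) : ℕ := sInf {n | s < n ∧ st n ω = C.y0}

/-- The state `y0` is not visited at the times `s + 1, …, s + m`. -/
def Avoids (st : ℕ → Ω → Y) (s m : ℕ) (ω : Ω) : Prop := ∀ i < m, st (s + 1 + i) ω ≠ C.y0

variable {C} {st : ℕ → Ω → Y} {s m : ℕ} {ω : Ω}

lemma firstHit_eq_iff :
    C.firstHit st s ω = s + 1 + m ↔ st (s + 1 + m) ω = C.y0 ∧ C.Avoids st s m ω := by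
  constructor
  · intro h
    have hne : {n | s < n ∧ st n ω = C.y0}.Nonempty :=
      Nat.nonempty_of_pos_sInf (by rw [firstHit] at h; omega)
    have h1 := Nat.sInf_mem hne
    rw [← firstHit, h] at h1
    refine ⟨h1.2, fun i hi h2 => ?_⟩
    have := Nat.sInf_le (s := {n | s < n ∧ st n ω = C.y0}) ⟨by omega, h2⟩
    rw [← firstHit, h] at this
    omega
  · rintro ⟨h1, h2⟩
    refine le_antisymm (Nat.sInf_le ⟨by omega, h1⟩) (le_csInf ⟨_, by omega, h1⟩ ?_)
    rintro n ⟨hn, h3⟩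
    by_contra! hlt
    refine h2 (n - (s + 1)) (by omega) ?_
    rwa [show s + 1 + (n - (s + 1)) = n by omega]

lemma firstHit_eq_zero_or : C.firstHit st s ω = 0 ∨ ∃ m, C.firstHit st s ω = s + 1 + m := by
  rcases Set.eq_empty_or_nonempty {n | s < n ∧ st n ω = C.y0} with h | h
  · left; rw [firstHit, h, Nat.sInf_empty]
  · right
    have h1 := (Nat.sInf_mem h).1
    exact ⟨C.firstHit st s ω - (s + 1), by rw [firstHit]; omega⟩

lemma avoids_of_firstHit_eq_zero (h : C.firstHit st s ω = 0) (m : ℕ) : C.Avoids st s m ω := by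
  intro i _ h2
  have hm := Nat.sInf_mem (s := {n | s < n ∧ st n ω = C.y0}) ⟨s + 1 + i, by omega, h2⟩
  have h1 := hm.1
  rw [← firstHit, h] at h1
  omega

lemma avoids_of_lt_firstHit (h : s + m < C.firstHit st s ω) : C.Avoids st s m ω := by
  intro i hi h2
  have := Nat.sInf_le (s := {n | s < n ∧ st n ω = C.y0}) ⟨by omega, h2⟩
  rw [← firstHit] at this
  omega

lemma avoids_succ :
    C.Avoids st s (m + 1) ω ↔ st (s + 1) ω ≠ C.y0 ∧ C.Avoids st (s + 1) m ω := by
  constructor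
  · exact fun h => ⟨h 0 m.succ_pos, fun i hi => by
      rw [show s + 1 + 1 + i = s + 1 + (i + 1) by ring]; exact h (i + 1) (by omega)⟩
  · rintro ⟨h1, h2⟩ (_ | i) hi
    · exact h1
    · rw [show s + 1 + (i + 1) = s + 1 + 1 + i by ring]; exact h2 i (by omega)

lemma firstHit_succ_iff : C.firstHit st s ω = s + 1 + (m + 1) ↔
    st (s + 1) ω ≠ C.y0 ∧ C.firstHit st (s + 1) ω = s + 1 + 1 + m := by
  rw [firstHit_eq_iff, firstHit_eq_iff, avoids_succ, show s + 1 + (m + 1) = s + 1 + 1 + m by ring]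
  tauto

namespace IsPath

variable [MeasurableSpace Ω] {P : Measure Ω} {X : ℕ → Ω → Bool} {yI : Y} {n : ℕ}

lemma adapted_avoids (H : C.IsPath P X st yI) (s m : ℕ) :
    Adapted X (s + m) (C.Avoids st s m) := by
  refine Adapted.forall_nat fun i => ?_
  by_cases hi : i < m
  · exact ((H.adapted_st (s + 1 + i)).mono (by omega)).comp fun y => i < m → y ≠ C.y0
  · simpa [hi] using Adapted.const True

lemma adapted_firstHit_eq (H : C.IsPath P X st yI) (s m : ℕ) :
    Adapted X (s + 1 + m) fun ω => C.firstHit st s ω = s + 1 + m := by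
  simp only [firstHit_eq_iff]
  exact (H.adapted_st _).comp₂ ((H.adapted_avoids s m).mono (by omega)) fun y q => y = C.y0 ∧ q

lemma measurable_firstHit (H : C.IsPath P X st yI) (s : ℕ) : Measurable (C.firstHit st s) := by
  have h1 : ∀ m, MeasurableSet {ω | C.firstHit st s ω = s + 1 + m} := fun m =>
    H.measurableSet_of_adapted (H.adapted_firstHit_eq s m)
  refine measurable_to_countable' fun k => ?_
  rcases Nat.eq_zero_or_pos k with rfl | hk
  · have : C.firstHit st s ⁻¹' {0} = (⋃ m, {ω | C.firstHit st s ω = s + 1 + m})ᶜ := by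
      ext ω
      simp only [Set.mem_preimage, Set.mem_singleton_iff, Set.mem_compl_iff, Set.mem_iUnion,
        Set.mem_ofPred_eq]
      constructor
      · rintro h ⟨m, hm⟩; omega
      · intro h
        exact firstHit_eq_zero_or.resolve_right h
    rw [this]
    exact (MeasurableSet.iUnion h1).compl
  · by_cases hs : s < k
    · obtain ⟨m, rfl⟩ := Nat.exists_eq_add_of_le (Nat.succ_le_of_lt hs)
      exact h1 m
    · convert MeasurableSet.empty
      ext ω
      simp only [Set.mem_preimage, Set.mem_singleton_iff, Set.mem_empty_iff_false, iff_false]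
      rcases firstHit_eq_zero_or (C := C) (st := st) (s := s) (ω := ω) with h | ⟨m, h⟩ <;> omega

open Classical in
/-- The strong Markov property at a first visit to `y0`. -/
lemma integral_mul_G (H : C.IsPath P X st yI) [IsProbabilityMeasure P] (a : Bool → ℂ) (m : ℕ)
    {F : Ω → ℂ} (hF : Adapted X n F) :
    ∫ ω, F ω * (if C.firstHit st n ω = n + 1 + m then
      ∏ i ∈ Finset.range (m + 1), a (X (n + 1 + i) ω) else 0) ∂P =
      ∫ ω, F ω * C.G a m (st n ω) ∂P := by
  induction m generalizing n F with
  | zero =>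
    rw [G_zero, ← H.integral_mul_T hF]
    refine integral_congr_ae (ae_of_all _ fun ω => ?_)
    have : C.firstHit st n ω = n + 1 + 0 ↔ st (n + 1) ω = C.y0 := by
      rw [firstHit_eq_iff]; simp [Avoids]
    simp only [this, ind]
    simp
  | succ m ih =>
    have hF' : Adapted X (n + 1) fun ω =>
        F ω * a (X (n + 1) ω) * if st (n + 1) ω = C.y0 then 0 else 1 :=
      ((hF.mono n.le_succ).comp₂ (Adapted.bit n.succ_pos le_rfl) fun z d => z * a d).comp₂
        (H.adapted_st (n + 1)) (fun z y => z * if y = C.y0 then 0 else 1)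
    rw [G_succ, ← H.integral_mul_T hF]
    refine Eq.trans ?_ ((ih hF').trans ?_)
    · refine integral_congr_ae (ae_of_all _ fun ω => ?_)
      have e : ∏ i ∈ Finset.range (m + 1 + 1), a (X (n + 1 + i) ω) =
          (∏ i ∈ Finset.range (m + 1), a (X (n + 1 + 1 + i) ω)) * a (X (n + 1) ω) := by
        rw [Finset.prod_range_succ' _ (m + 1), add_zero]
        congr 1
        exact Finset.prod_congr rfl fun i _ => by rw [add_right_comm (n + 1) 1 i]; rfl
      simp only [firstHit_succ_iff, e]
      by_cases h1 : st (n + 1) ω = C.y0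
      · simp [h1]
      · by_cases h2 : C.firstHit st (n + 1) ω = n + 1 + 1 + m
        · simp only [h1, h2, not_false_eq_true, ne_eq, and_self, if_true, if_false]; ring
        · simp [h2]
    · refine integral_congr_ae (ae_of_all _ fun ω => ?_)
      simp only [kill]
      split_ifs <;> ring

open Classical in
lemma integral_mul_tail (H : C.IsPath P X st yI) [IsProbabilityMeasure P] (m : ℕ)
    {F : Ω → ℂ} (hF : Adapted X n F) :
    ∫ ω, F ω * (if C.Avoids st n m ω then 1 else 0) ∂P = ∫ ω, F ω * C.tail m (st n ω) ∂P := by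
  induction m generalizing n F with
  | zero => simp [Avoids, tail]
  | succ m ih =>
    have hF' : Adapted X (n + 1) fun ω => F ω * if st (n + 1) ω = C.y0 then 0 else 1 :=
      (hF.mono n.le_succ).comp₂ (H.adapted_st (n + 1)) fun z y => z * if y = C.y0 then 0 else 1
    have e : ∀ y, (C.tail (m + 1) y : ℂ) =
        C.T (fun _ => 1) (fun y => ((C.kill (C.tail m) y : ℝ) : ℂ)) y :=
      fun y => by
        rw [tail_succ]
        simp [T]
    simp only [e]
    rw [← H.integral_mul_T hF]
    refine Eq.trans ?_ ((ih hF').trans ?_)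
    · refine integral_congr_ae (ae_of_all _ fun ω => ?_)
      simp only [avoids_succ]
      by_cases h1 : st (n + 1) ω = C.y0 <;> simp [h1]
    · refine integral_congr_ae (ae_of_all _ fun ω => ?_)
      simp only [kill]
      split_ifs <;> simp

lemma measure_and_avoids_le (H : C.IsPath P X st yI) [IsProbabilityMeasure P] (m : ℕ)
    {A : Ω → Prop} (hA : Adapted X n A) :
    P {ω | A ω ∧ C.Avoids st n m ω} ≤ ENNReal.ofReal (C.rateConst * C.rate ^ m) * P {ω | A ω} := by
  classical
  have hAm := H.measurableSet_of_adapted hA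
  have hB : Adapted X (n + m) fun ω => A ω ∧ C.Avoids st n m ω :=
    (hA.mono (Nat.le_add_right n m)).comp₂ (H.adapted_avoids n m) And
  have hBm := H.measurableSet_of_adapted hB
  have hK : 0 ≤ C.rateConst * C.rate ^ m := by
    have := C.rateConst_pos
    have := C.rate_pos
    positivity
  have h := H.integral_mul_tail m (hA.comp fun q => if q then (1 : ℂ) else 0)
  have e1 : ∫ ω, (if A ω then (1 : ℂ) else 0) * (if C.Avoids st n m ω then 1 else 0) ∂P =
      (P.real {ω | A ω ∧ C.Avoids st n m ω} : ℂ) := by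
    have := integral_indicator_const (μ := P) (1 : ℂ) hBm
    rw [Complex.real_smul, mul_one] at this
    rw [← this]
    refine integral_congr_ae (ae_of_all _ fun ω => ?_)
    by_cases h1 : A ω <;> by_cases h2 : C.Avoids st n m ω <;> simp [h1, h2]
  have e2 : P.real {ω | A ω ∧ C.Avoids st n m ω} ≤ C.rateConst * C.rate ^ m * P.real {ω | A ω} := by
    rw [← Complex.norm_of_nonneg (measureReal_nonneg (μ := P)), ← e1, h]
    have := integral_indicator_const (μ := P) (C.rateConst * C.rate ^ m) hAm
    rw [smul_eq_mul] at this
    rw [mul_comm, ← this]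
    refine norm_integral_le_of_norm_le ((integrable_const _).indicator hAm)
      (ae_of_all _ fun ω => ?_)
    by_cases h1 : A ω
    · simpa [h1, abs_of_nonneg (C.tail_nonneg m (st n ω))] using C.tail_le m (st n ω)
    · simp [h1]
  rw [← ofReal_measureReal, ← ofReal_measureReal (s := {ω | A ω}), ← ENNReal.ofReal_mul hK]
  exact ENNReal.ofReal_le_ofReal e2

end IsPath

end BitChain

namespace BitChain

variable {Y : Type} (C : BitChain Y) {Ω : Type}

/-- The second visit to `y0`. -/
def secondHit (st : ℕ → Ω → Y) (ω : Ω) : ℕ := C.firstHit st (C.firstHit st 0 ω) ω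

/-- The time between the first two visits to `y0`. -/
def gap (st : ℕ → Ω → Y) (ω : Ω) : ℕ := C.secondHit st ω - C.firstHit st 0 ω

/-- The number of ones between the first two visits to `y0`. -/
def gapOnes (X : ℕ → Ω → Bool) (st : ℕ → Ω → Y) (ω : Ω) : ℕ :=
  ∑ n ∈ Finset.Ioc (C.firstHit st 0 ω) (C.secondHit st ω), (X n ω).toNat

lemma sum_Ioc_eq_sum_range (f : ℕ → ℕ) (n m : ℕ) :
    ∑ i ∈ Finset.Ioc n (n + 1 + m), f i = ∑ i ∈ Finset.range (m + 1), f (n + 1 + i) := by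
  rw [← Finset.Ico_add_one_add_one_eq_Ioc, Finset.sum_Ico_eq_sum_range]
  congr 2
  omega

lemma sum_toNat_le (s : Finset ℕ) (f : ℕ → Bool) : ∑ i ∈ s, (f i).toNat ≤ s.card := by
  simpa using Finset.sum_le_card_nsmul s (fun i => (f i).toNat) 1 fun i _ => Bool.toNat_le _

lemma prod_cw (l w : ℂ) (k : ℕ) (x : ℕ → Bool) : ∏ i ∈ Finset.range k, cw l w (x i) =
    Complex.exp (l * k + w * (∑ i ∈ Finset.range k, (x i).toNat : ℕ)) := by
  induction k with
  | zero => simp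
  | succ k ih =>
    rw [Finset.prod_range_succ, ih, cw, ← Complex.exp_add, Finset.sum_range_succ]
    congr 1
    cases x k <;> simp <;> ring

/-- Exponential moments of a variable whose tails are those of the hitting times. -/
lemma integrable_exp_log_rad_mul [MeasurableSpace Ω] {P : Measure Ω} [IsProbabilityMeasure P]
    {N : Ω → ℕ} (hN : Measurable N)
    (h : ∀ n, P {ω | n < N ω} ≤ ENNReal.ofReal (C.rateConst * C.rate ^ n)) :
    Integrable (fun ω => Real.exp (Real.log C.rad * N ω)) P := by
  have hr := C.rad_pos
  have e : ∀ n : ℕ, Real.exp (Real.log C.rad * n) = C.rad ^ n := fun n => by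
    rw [mul_comm, Real.exp_nat_mul, Real.exp_log hr]
  refine ⟨(measurable_from_nat (f := fun n : ℕ => Real.exp (Real.log C.rad * n))).comp hN
    |>.aestronglyMeasurable, ?_⟩
  rw [hasFiniteIntegral_iff_ofReal (ae_of_all _ fun ω => (Real.exp_pos _).le)]
  simp only [e]
  have h1 := lintegral_map (μ := P) (f := fun n : ℕ => ENNReal.ofReal (C.rad ^ n))
    measurable_from_nat hN
  rw [← h1, lintegral_countable', tsum_eq_zero_add' ENNReal.summable]
  have h2 : ∀ n, ENNReal.ofReal (C.rad ^ (n + 1)) * (P.map N) {n + 1} ≤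
      ENNReal.ofReal (C.bd n) := by
    intro n
    rw [Measure.map_apply hN (measurableSet_singleton _)]
    calc _ ≤ ENNReal.ofReal (C.rad ^ (n + 1)) * ENNReal.ofReal (C.rateConst * C.rate ^ n) := by
          gcongr
          exact (measure_mono fun ω hω => by
            have : N ω = n + 1 := hω
            show n < N ω
            omega).trans (h n)
      _ = _ := by
          rw [← ENNReal.ofReal_mul (by positivity), bd]
          congr 1
          ring
  refine ENNReal.add_lt_top.2 ⟨ENNReal.mul_lt_top ENNReal.ofReal_lt_top ?_,
    (ENNReal.tsum_le_tsum h2).trans_lt C.summable_bd.tsum_ofReal_lt_top⟩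
  rw [Measure.map_apply hN (measurableSet_singleton _)]
  exact measure_lt_top _ _

variable {C}

lemma pairwise_disjoint_firstHit (st : ℕ → Ω → Y) :
    Pairwise (Function.onFun Disjoint fun s => {ω | C.firstHit st 0 ω = 0 + 1 + s}) :=
  fun s s' hs => Set.disjoint_left.2 fun ω h h' => hs (by
    have h1 : C.firstHit st 0 ω = 0 + 1 + s := h
    have h2 : C.firstHit st 0 ω = 0 + 1 + s' := h'
    omega)

lemma gapOnes_le (X : ℕ → Ω → Bool) (st : ℕ → Ω → Y) (ω : Ω) : C.gapOnes X st ω ≤ C.gap st ω :=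
  (sum_toNat_le _ fun n => X n ω).trans_eq (Nat.card_Ioc _ _)

lemma exp_add_mul_le {r : ℝ} {l m : ℝ} (h : ∀ c, ew l m c ≤ r) {a b : ℕ} (hab : b ≤ a) :
    Real.exp (l * a + m * b) ≤ Real.exp (Real.log r * a) := by
  have hr : 0 < r := (ew_pos l m true).trans_le (h true)
  have h1 : l ≤ Real.log r := by
    have := h false
    rwa [ew, ← Real.le_log_iff_exp_le hr, if_neg (by simp), add_zero] at this
  have h2 : l + m ≤ Real.log r := by
    have := h true
    rwa [ew, ← Real.le_log_iff_exp_le hr, if_pos rfl] at this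
  have h3 : (b : ℝ) ≤ a := Nat.cast_le.2 hab
  have h4 : (0 : ℝ) ≤ b := b.cast_nonneg
  rw [Real.exp_le_exp]
  nlinarith

namespace IsPath

variable [MeasurableSpace Ω] {P : Measure Ω} {X : ℕ → Ω → Bool} {st : ℕ → Ω → Y} {yI : Y} {n : ℕ}

lemma measurable_secondHit (H : C.IsPath P X st yI) : Measurable (C.secondHit st) := by
  have h : Measurable fun q : ℕ × Ω => C.firstHit st q.1 q.2 :=
    measurable_from_prod_countable_right fun s => H.measurable_firstHit s
  exact h.comp ((H.measurable_firstHit 0).prodMk measurable_id)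

lemma measurable_gapOnes (H : C.IsPath P X st yI) : Measurable (C.gapOnes X st) := by
  have h : Measurable fun q : (ℕ × ℕ) × Ω => ∑ n ∈ Finset.Ioc q.1.1 q.1.2, (X n q.2).toNat :=
    measurable_from_prod_countable_right fun s =>
      Finset.measurable_fun_sum (f := fun n ω => (X n ω).toNat)
        (Finset.Ioc s.1 s.2) fun n _ =>
        (measurable_of_finite Bool.toNat).comp (H.measurable_bit n)
  exact h.comp (((H.measurable_firstHit 0).prodMk H.measurable_secondHit).prodMk measurable_id)

lemma measurable_gap (H : C.IsPath P X st yI) : Measurable (C.gap st) :=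
  H.measurable_secondHit.sub (H.measurable_firstHit 0)

variable [IsProbabilityMeasure P]

lemma measure_and_firstHit_eq_zero (H : C.IsPath P X st yI) {A : Ω → Prop} (hA : Adapted X n A) :
    P {ω | A ω ∧ C.firstHit st n ω = 0} = 0 := by
  have h1 : ∀ m, P {ω | A ω ∧ C.firstHit st n ω = 0} ≤ ENNReal.ofReal (C.rateConst * C.rate ^ m) :=
    fun m => calc
      _ ≤ P {ω | A ω ∧ C.Avoids st n m ω} :=
        measure_mono fun ω hω => ⟨hω.1, avoids_of_firstHit_eq_zero hω.2 m⟩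
      _ ≤ _ := H.measure_and_avoids_le m hA
      _ ≤ _ := mul_le_of_le_one_right' prob_le_one
  have h2 : Tendsto (fun m : ℕ => ENNReal.ofReal (C.rateConst * C.rate ^ m)) atTop (𝓝 0) := by
    have := (tendsto_pow_atTop_nhds_zero_of_lt_one C.rate_pos.le C.rate_lt_one).const_mul
      C.rateConst
    rw [mul_zero] at this
    simpa using ENNReal.tendsto_ofReal this
  exact le_antisymm (ge_of_tendsto' h2 h1) zero_le

lemma measure_firstHit_eq_zero (H : C.IsPath P X st yI) : P {ω | C.firstHit st 0 ω = 0} = 0 := by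
  simpa using H.measure_and_firstHit_eq_zero (Adapted.const (n := 0) True)

lemma ae_firstHit (H : C.IsPath P X st yI) : ∀ᵐ ω ∂P, ∃ s, C.firstHit st 0 ω = 0 + 1 + s := by
  have h : ∀ᵐ ω ∂P, C.firstHit st 0 ω ≠ 0 := by
    rw [ae_iff]; simpa using H.measure_firstHit_eq_zero
  filter_upwards [h] with ω hω
  exact firstHit_eq_zero_or.resolve_left hω

lemma ae_secondHit (H : C.IsPath P X st yI) : ∀ᵐ ω ∂P, ∃ s m, C.firstHit st 0 ω = 0 + 1 + s ∧
    C.firstHit st (0 + 1 + s) ω = 0 + 1 + s + 1 + m := by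
  have h : ∀ᵐ ω ∂P, ∀ s, ¬ (C.firstHit st 0 ω = 0 + 1 + s ∧ C.firstHit st (0 + 1 + s) ω = 0) := by
    rw [ae_all_iff]
    intro s
    rw [ae_iff]
    simpa using H.measure_and_firstHit_eq_zero (H.adapted_firstHit_eq 0 s)
  filter_upwards [h, H.ae_firstHit] with ω h1 ⟨s, hs⟩
  obtain ⟨m, hm⟩ := firstHit_eq_zero_or.resolve_left fun h2 => h1 s ⟨hs, h2⟩
  exact ⟨s, m, hs, hm⟩

lemma measure_lt_firstHit_le (H : C.IsPath P X st yI) (m : ℕ) :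
    P {ω | m < C.firstHit st 0 ω} ≤ ENNReal.ofReal (C.rateConst * C.rate ^ m) := by
  have h := H.measure_and_avoids_le m (Adapted.const (n := 0) True)
  refine (measure_mono fun ω hω => ?_).trans (h.trans (mul_le_of_le_one_right' prob_le_one))
  exact ⟨trivial, avoids_of_lt_firstHit (by rwa [zero_add])⟩

lemma measure_lt_gap_le (H : C.IsPath P X st yI) (m : ℕ) :
    P {ω | m < C.gap st ω} ≤ ENNReal.ofReal (C.rateConst * C.rate ^ m) := by
  have hsub : {ω | m < C.gap st ω} ⊆ {ω | C.firstHit st 0 ω = 0} ∪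
      ⋃ s, {ω | C.firstHit st 0 ω = 0 + 1 + s ∧ C.Avoids st (0 + 1 + s) m ω} := by
    intro ω hω
    rcases firstHit_eq_zero_or (C := C) (st := st) (s := 0) (ω := ω) with h | ⟨s, hs⟩
    · exact Or.inl h
    · refine Or.inr (Set.mem_iUnion.2 ⟨s, hs, avoids_of_lt_firstHit ?_⟩)
      have : m < C.gap st ω := hω
      rw [gap, secondHit, hs] at this
      omega
  calc _ ≤ _ := measure_mono hsub
    _ ≤ _ := measure_union_le _ _
    _ ≤ 0 + ∑' s, P {ω | C.firstHit st 0 ω = 0 + 1 + s ∧ C.Avoids st (0 + 1 + s) m ω} := by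
      rw [H.measure_firstHit_eq_zero]
      gcongr
      exact measure_iUnion_le _
    _ ≤ ∑' s, ENNReal.ofReal (C.rateConst * C.rate ^ m) *
        P {ω | C.firstHit st 0 ω = 0 + 1 + s} := by
      rw [zero_add]
      exact ENNReal.tsum_le_tsum fun s => H.measure_and_avoids_le m (H.adapted_firstHit_eq 0 s)
    _ ≤ ENNReal.ofReal (C.rateConst * C.rate ^ m) * P Set.univ := by
      rw [ENNReal.tsum_mul_left]
      gcongr
      exact tsum_measure_le_measure_univ
        (fun s => (H.measurableSet_of_adapted (H.adapted_firstHit_eq 0 s)).nullMeasurableSet)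
        ((pairwise_disjoint_firstHit st).mono fun _ _ h => h.aedisjoint)
    _ = _ := by rw [measure_univ, mul_one]

lemma _root_.HasSum.mul_of_summable_norm {f g : ℕ → ℂ} {a b : ℂ} (hf : HasSum f a)
    (hg : HasSum g b) : HasSum (fun q : ℕ × ℕ => f q.1 * g q.2) (a * b) :=
  hf.mul hg (summable_mul_of_summable_norm hf.summable.norm hg.summable.norm)

/-- The moment generating function of the regeneration vector. -/
lemma integral_exp_gap (H : C.IsPath P X st yI) (l w : ℂ) (hlw : ∀ c, ‖cw l w c‖ ≤ C.rad) :
    ∫ ω, Complex.exp (l * C.gap st ω + w * C.gapOnes X st ω) ∂P = C.h (cw l w) C.y0 := by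
  classical
  set J : Ω → ℂ := fun ω => Complex.exp (l * C.gap st ω + w * C.gapOnes X st ω) with hJ
  have hJm : Measurable J := by
    have h1 : Measurable fun ω => (C.gap st ω : ℂ) := measurable_from_nat.comp H.measurable_gap
    have h2 : Measurable fun ω => (C.gapOnes X st ω : ℂ) :=
      measurable_from_nat.comp H.measurable_gapOnes
    exact ((h1.const_mul l).add (h2.const_mul w)).cexp
  have hJi : Integrable J P := by
    refine (C.integrable_exp_log_rad_mul H.measurable_gap H.measure_lt_gap_le).mono'
      hJm.aestronglyMeasurable (ae_of_all _ fun ω => ?_)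
    rw [hJ, Complex.norm_exp]
    simp only [norm_cw] at hlw
    refine le_of_eq_of_le ?_ (exp_add_mul_le hlw (gapOnes_le X st ω))
    simp
  set A : ℕ → Set Ω := fun s => {ω | C.firstHit st 0 ω = 0 + 1 + s}
  have hA : ∀ s, MeasurableSet (A s) := fun s =>
    H.measurableSet_of_adapted (H.adapted_firstHit_eq 0 s)
  set B : ℕ × ℕ → Set Ω := fun q =>
    {ω | C.firstHit st 0 ω = 0 + 1 + q.1 ∧ C.firstHit st (0 + 1 + q.1) ω = 0 + 1 + q.1 + 1 + q.2}
  have hB : ∀ q, MeasurableSet (B q) := fun q => (hA q.1).inter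
    (H.measurableSet_of_adapted (H.adapted_firstHit_eq (0 + 1 + q.1) q.2))
  have hBd : Pairwise (Function.onFun Disjoint B) := fun q q' hq =>
    Set.disjoint_left.2 fun ω h h' => hq (by
      have h1 : q.1 = q'.1 := by have := h.1; have := h'.1; omega
      have h2 := h.2
      have h3 := h'.2
      rw [← h1, h2] at h3
      exact Prod.ext h1 (by omega))
  have hsumA : HasSum (fun s => (P.real (A s) : ℂ)) 1 := by
    have h1 := hasSum_integral_iUnion hA (pairwise_disjoint_firstHit st)
      (integrable_const (μ := P) (1 : ℂ)).integrableOn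
    have h2 : (⋃ s, A s) =ᵐ[P] Set.univ := eventuallyEq_univ.2
      (H.ae_firstHit.mono fun ω hω => Set.mem_iUnion.2 hω)
    rw [setIntegral_congr_set h2] at h1
    simpa using h1
  have hsumG : HasSum (fun m => C.G (cw l w) m C.y0) (C.h (cw l w) C.y0) :=
    (C.summable_G hlw C.y0).hasSum
  have hprod := hsumA.mul_of_summable_norm hsumG
  have hBsum := hasSum_integral_iUnion hB hBd hJi.integrableOn
  have hU : (⋃ q, B q) =ᵐ[P] Set.univ := eventuallyEq_univ.2
    (H.ae_secondHit.mono fun ω ⟨s, m, hs, hm⟩ => Set.mem_iUnion.2 ⟨(s, m), hs, hm⟩)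
  rw [setIntegral_congr_set hU, setIntegral_univ] at hBsum
  rw [one_mul] at hprod
  refine hBsum.unique ((congrArg (fun f => HasSum f _) (funext ?_)).mpr hprod)
  rintro ⟨s, m⟩
  have hG := H.integral_mul_G (cw l w) m
    ((H.adapted_firstHit_eq 0 s).comp fun q => if q then (1 : ℂ) else 0)
  rw [← integral_indicator (hB _)]
  refine Eq.trans (integral_congr_ae (ae_of_all _ fun ω => ?_)) (hG.trans ?_)
  · by_cases h1 : C.firstHit st 0 ω = 0 + 1 + s
    · by_cases h2 : C.firstHit st (0 + 1 + s) ω = 0 + 1 + s + 1 + m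
      · rw [Set.indicator_of_mem (show ω ∈ B (s, m) from ⟨h1, h2⟩)]
        simp only [h1, h2, if_true, one_mul, prod_cw, hJ, gap, gapOnes, secondHit,
          sum_Ioc_eq_sum_range]
        congr 4
        omega
      · rw [Set.indicator_of_notMem fun h : ω ∈ B (s, m) => h2 h.2]
        simp [h2]
    · rw [Set.indicator_of_notMem fun h : ω ∈ B (s, m) => h1 h.1]
      simp only [h1, if_false, zero_mul]
  · have := integral_indicator_const (μ := P) (C.G (cw l w) m C.y0) (hA s)
    rw [Complex.real_smul] at this
    rw [← this]
    refine integral_congr_ae (ae_of_all _ fun ω => ?_)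
    by_cases h1 : C.firstHit st 0 ω = 0 + 1 + s
    · have h2 := (firstHit_eq_iff.1 h1).1
      simp only [h1, h2, if_true, one_mul]
      rw [Set.indicator_of_mem (show ω ∈ A s from h1)]
    · simp only [h1, if_false, zero_mul]
      rw [Set.indicator_of_notMem (show ω ∉ A s from h1)]

end IsPath

end BitChain

namespace BitChain

namespace IsPath

variable {Y : Type} {C : BitChain Y} {Ω : Type} [MeasurableSpace Ω] {P : Measure Ω}
  {X : ℕ → Ω → Bool} {st : ℕ → Ω → Y} {yI : Y} {n : ℕ}

lemma st_add_of_zeros (H : C.IsPath P X st yI) {n k : ℕ} {ω : Ω}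
    (h : ∀ i < k, X (n + 1 + i) ω = false) :
    st (n + k) ω = (List.replicate k false).foldl C.step (st n ω) := by
  induction k with
  | zero => rfl
  | succ k ih =>
    rw [List.replicate_succ', List.foldl_append, ← ih fun i hi => h i (by omega), ← add_assoc,
      H.st_succ, show n + k + 1 = n + 1 + k by ring, h k (by omega)]
    rfl

lemma firstHit_of_zeros (H : C.IsPath P X st yI) {k : ℕ}
    (hu : C.u = List.replicate k false ++ [true]) (hstep : ∀ y, C.step y false ≠ C.y0)
    {j s : ℕ} (hkj : k ≤ j) {ω : Ω} (h0 : ∀ i < j, X (s + 1 + i) ω = false)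
    (h1 : X (s + 1 + j) ω = true) : C.firstHit st s ω = s + 1 + j := by
  rw [firstHit_eq_iff]
  constructor
  · have h2 : st (s + (j - k) + k) ω = _ := H.st_add_of_zeros (k := k) fun i hi => by
      rw [show s + (j - k) + 1 + i = s + 1 + (j - k + i) by ring]
      exact h0 _ (by omega)
    rw [show s + (j - k) + k = s + j by omega] at h2
    rw [show s + 1 + j = s + j + 1 by ring, H.st_succ, show s + j + 1 = s + 1 + j by ring, h1, h2,
      ← C.foldl_u (st (s + (j - k)) ω), hu, List.foldl_append]
    rfl
  · intro i hi
    rw [show s + 1 + i = s + i + 1 by ring, H.st_succ, show s + i + 1 = s + 1 + i by ring, h0 i hi]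
    exact hstep _

variable [IsProbabilityMeasure P]

lemma measure_and_bit_ne_zero (H : C.IsPath P X st yI) {A : Ω → Prop} (hA : Adapted X n A)
    (hP : P {ω | A ω} ≠ 0) (c : Bool) : P {ω | A ω ∧ X (n + 1) ω = c} ≠ 0 := by
  classical
  intro h0
  have hF := hA.comp fun q => if q then (1 : ℂ) else 0
  have hintegral := H.integrable_of_adapted (hF.comp₂ (H.adapted_st n) fun z y => z * C.pr y c)
  have h1 := H.integral_mul_step hF c
  have h2 : ∀ᵐ ω ∂P, ¬ (A ω ∧ X (n + 1) ω = c) := by rw [ae_iff]; simpa using h0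
  have h3 : ∫ ω, (if A ω then (1 : ℂ) else 0) * (if X (n + 1) ω = c then 1 else 0) ∂P = 0 :=
    integral_eq_zero_of_ae (h2.mono fun ω hω => by
      simpa using fun hc hAω => hω ⟨hAω, hc⟩)
  have e : ∀ ω, (if A ω then (1 : ℂ) else 0) * C.pr (st n ω) c =
      ((if A ω then C.pr (st n ω) c else 0 : ℝ) : ℂ) := fun ω => by split_ifs <;> simp
  rw [h3] at h1
  simp only [e] at h1 hintegral
  rw [integral_complex_ofReal, eq_comm, Complex.ofReal_eq_zero,
    integral_eq_zero_iff_of_nonneg _ (by simpa using hintegral.re)] at h1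
  · refine hP ?_
    have h4 : ∀ᵐ ω ∂P, ¬ A ω := h1.mono fun ω hω hAω => by
      have hω' : (if A ω then C.pr (st n ω) c else 0) = 0 := hω
      rw [if_pos hAω] at hω'
      exact (C.pr_pos _ _).ne' hω'
    rw [ae_iff] at h4
    simpa using h4
  · intro ω
    show 0 ≤ if A ω then C.pr (st n ω) c else 0
    split_ifs
    · exact (C.pr_pos _ _).le
    · exact le_rfl

lemma measure_gap_eq_ne_zero (H : C.IsPath P X st yI) {k : ℕ}
    (hu : C.u = List.replicate k false ++ [true]) (hstep : ∀ y, C.step y false ≠ C.y0)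
    {j : ℕ} (hkj : k ≤ j) : P {ω | C.gap st ω = j + 1 ∧ C.gapOnes X st ω = 1} ≠ 0 := by
  obtain ⟨s, hs⟩ : ∃ s, P {ω | C.firstHit st 0 ω = 0 + 1 + s} ≠ 0 := by
    by_contra! h
    have h1 : ∀ᵐ ω ∂P, ∀ s, ¬ C.firstHit st 0 ω = 0 + 1 + s := by
      rw [ae_all_iff]
      intro s
      rw [ae_iff]
      simpa using h s
    obtain ⟨ω, h2, s, h3⟩ := (h1.and H.ae_firstHit).exists
    exact h2 s h3
  have hz : ∀ i, Adapted X (0 + 1 + s + i) (fun ω => C.firstHit st 0 ω = 0 + 1 + s ∧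
        ∀ i' < i, X (0 + 1 + s + 1 + i') ω = false) ∧
      P {ω | C.firstHit st 0 ω = 0 + 1 + s ∧ ∀ i' < i, X (0 + 1 + s + 1 + i') ω = false} ≠ 0 := by
    intro i
    induction i with
    | zero => simpa using ⟨H.adapted_firstHit_eq 0 s, hs⟩
    | succ i ih =>
      have e : ∀ ω, (C.firstHit st 0 ω = 0 + 1 + s ∧
          ∀ i' < i + 1, X (0 + 1 + s + 1 + i') ω = false) ↔
          (C.firstHit st 0 ω = 0 + 1 + s ∧ ∀ i' < i, X (0 + 1 + s + 1 + i') ω = false) ∧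
            X (0 + 1 + s + i + 1) ω = false := fun ω => by
        rw [Nat.forall_lt_succ_right, and_assoc,
          show 0 + 1 + s + i + 1 = 0 + 1 + s + 1 + i by ring]
      simp only [e]
      exact ⟨(ih.1.mono (by omega)).comp₂ (Adapted.bit (by omega) (by omega))
        fun q c => q ∧ c = false, H.measure_and_bit_ne_zero ih.1 ih.2 false⟩
  have h := H.measure_and_bit_ne_zero (hz j).1 (hz j).2 true
  refine fun h0 => h (measure_mono_null (fun ω hω => ?_) h0)
  obtain ⟨⟨h1, h2⟩, h3⟩ := hω
  rw [show 0 + 1 + s + j + 1 = 0 + 1 + s + 1 + j by ring] at h3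
  have h4 := H.firstHit_of_zeros hu hstep hkj h2 h3
  refine ⟨?_, ?_⟩
  · rw [gap, secondHit, h1, h4]
    omega
  · rw [gapOnes, secondHit, h1, h4, sum_Ioc_eq_sum_range, Finset.sum_range_succ, h3,
      Finset.sum_eq_zero fun i hi => by rw [h2 i (Finset.mem_range.1 hi)]; rfl]
    rfl

lemma tiltPair (H : C.IsPath P X st yI) {k : ℕ}
    (hu : C.u = List.replicate k false ++ [true]) (hstep : ∀ y, C.step y false ≠ C.y0) :
    TiltPair P (C.gap st) (C.gapOnes X st) (Real.log C.rad) where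
  measurable_fst := H.measurable_gap
  measurable_snd := H.measurable_gapOnes
  snd_le := gapOnes_le X st
  fst_pos := H.ae_secondHit.mono fun ω ⟨s, m, hs, hm⟩ => by
    rw [gap, secondHit, hs, hm]
    omega
  η_pos := Real.log_pos C.one_lt_rad
  integrable_exp := C.integrable_exp_log_rad_mul H.measurable_gap H.measure_lt_gap_le
  nondegenerate := ⟨k + 1, H.measure_gap_eq_ne_zero hu hstep le_rfl,
    H.measure_gap_eq_ne_zero hu hstep k.le_succ⟩

end IsPath

end BitChain

namespace VLMC

attribute [local instance] VLMC.mΩ VLMC.hprob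

/-- The word standing to the left of a new `1` appended to `k` zeros following a `1` whose left
word is `w`. -/
def push {m : ℕ} (k : ℕ) (w : Fin m → Bool) (j : Fin m) : Bool :=
  if h : j.1 + k + 1 < m then w ⟨j.1 + k + 1, h⟩ else decide (j.1 + k + 1 = m)

/-- The chain `Y` of the variable length memory model. -/
def chain {m : ℕ} (p : ℕ → (Fin m → Bool) → ℝ) (δ1 δ2 : ℝ) (h2 : 0 < δ2) (h1 : δ1 < 1)
    (hp : ∀ k w, δ2 ≤ p k w ∧ p k w ≤ δ1) : BitChain (ℕ × (Fin m → Bool)) where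
  step y c := if c then (0, push y.1 y.2) else (y.1 + 1, y.2)
  pr y c := if c then p y.1 y.2 else 1 - p y.1 y.2
  y0 := (0, fun _ => false)
  u := List.replicate m false ++ [true]
  δ := min δ2 (1 - δ1)
  δ_pos := lt_min h2 (sub_pos.2 h1)
  le_pr y c := by
    cases c
    · exact (min_le_right _ _).trans (sub_le_sub_left (hp _ _).2 1)
    · exact (min_le_left _ _).trans (hp _ _).1
  sum_pr y := by simp
  u_ne := by simp
  foldl_u y := by
    have h : ∀ k, (List.replicate k false).foldl
        (fun (y : ℕ × (Fin m → Bool)) c => if c then (0, push y.1 y.2) else (y.1 + 1, y.2)) y =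
        (y.1 + k, y.2) := fun k => by
      induction k with
      | zero => rfl
      | succ k ih => rw [List.replicate_succ', List.foldl_append, ih]; rfl
    rw [List.foldl_append, h]
    refine Prod.ext rfl (funext fun j => ?_)
    simp only [List.foldl_cons, List.foldl_nil, if_true, push]
    rw [dif_neg (by omega), decide_eq_false (by omega)]

variable {v : ℕ} {p : ℕ → (Fin (v - 1) → Bool) → ℝ} (S : VLMC v p)

/-- The state of the chain at time `n`. -/
def st (n : ℕ) (ω : S.Ω) : ℕ × (Fin (v - 1) → Bool) :=
  ((n - S.mpos ω n).toNat, fun j => S.cfg ω (S.mpos ω n - ((v : ℤ) - 1) + j.1))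

variable {S}

lemma mpos_eq {ω : S.Ω} {n : ℕ} {m : ℤ} (h1 : m ≤ n) (h2 : S.cfg ω m = true)
    (h3 : ∀ i : ℤ, m < i → i ≤ n → S.cfg ω i = false) : S.mpos ω n = m := by
  obtain ⟨h4, h5, h6⟩ := S.hmpos ω n
  rcases lt_trichotomy (S.mpos ω n) m with h | h | h
  · simp [h6 m h h1] at h2
  · exact h
  · simp [h3 _ h h4] at h5

lemma st_zero (ω ω' : S.Ω) : S.st 0 ω = S.st 0 ω' := by
  have hc : ∀ i : ℤ, i ≤ 0 → S.cfg ω i = S.cfg ω' i := fun i hi => by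
    rw [S.hcfg, S.hcfg, if_pos hi, if_pos hi]
  obtain ⟨h1, h2, h3⟩ := S.hmpos ω' 0
  have hm : S.mpos ω 0 = S.mpos ω' 0 := mpos_eq h1 (by rw [hc _ (by simpa using h1), h2])
    fun i hi hi' => by rw [hc _ (by simpa using hi'), h3 i hi hi']
  refine Prod.ext (by simp only [st, hm]) (funext fun j => ?_)
  simp only [st, hm]
  refine hc _ ?_
  have := j.2
  have := S.hv
  push_cast at h1
  omega

lemma cfg_natCast_add_one (ω : S.Ω) (n : ℕ) : S.cfg ω (n + 1) = S.X (n + 1) ω := by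
  rw [S.hcfg, if_neg (by omega)]
  rfl

variable {δ1 δ2 : ℝ} (h2 : 0 < δ2) (h1 : δ1 < 1) (hp : ∀ k w, δ2 ≤ p k w ∧ p k w ≤ δ1)

lemma st_succ (n : ℕ) (ω : S.Ω) :
    S.st (n + 1) ω = (chain p δ1 δ2 h2 h1 hp).step (S.st n ω) (S.X (n + 1) ω) := by
  obtain ⟨g1, g2, g3⟩ := S.hmpos ω n
  have hv := S.hv
  have hX := cfg_natCast_add_one ω n
  cases hx : S.X (n + 1) ω
  · have hm : S.mpos ω (n + 1) = S.mpos ω n := mpos_eq (by push_cast; omega) g2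
      fun i hi hi' => by
        rcases eq_or_lt_of_le hi' with rfl | h
        · push_cast; rw [hX, hx]
        · exact g3 i hi (by push_cast at h; omega)
    refine Prod.ext ?_ (funext fun j => ?_)
    · show ((n + 1 : ℕ) - S.mpos ω (n + 1)).toNat = ((n : ℤ) - S.mpos ω n).toNat + 1
      rw [hm]; push_cast; omega
    · show S.cfg ω _ = S.cfg ω _
      rw [hm]
  · have hm : S.mpos ω (n + 1) = n + 1 := mpos_eq (by push_cast; omega) (by rw [hX, hx])
      fun i hi hi' => by push_cast at hi'; omega
    refine Prod.ext ?_ (funext fun j => ?_)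
    · show ((n + 1 : ℕ) - S.mpos ω (n + 1)).toNat = 0
      rw [hm]; push_cast; omega
    · show S.cfg ω (S.mpos ω (n + 1) - ((v : ℤ) - 1) + j.1) =
        push (n - S.mpos ω n).toNat
          (fun j => S.cfg ω (S.mpos ω n - ((v : ℤ) - 1) + j.1)) j
      have hj := j.2
      obtain ⟨d, hd⟩ : ∃ d : ℕ, ((n : ℤ) - S.mpos ω n).toNat = d := ⟨_, rfl⟩
      rw [hm, hd, push]
      split_ifs with h
      · congr 1
        push_cast
        omega
      · by_cases h' : j.1 + d + 1 = v - 1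
        · rw [decide_eq_true h', ← g2]
          congr 1
          omega
        · rw [decide_eq_false h']
          exact g3 _ (by omega) (by omega)

lemma exists_isPath : ∃ yI, (chain p δ1 δ2 h2 h1 hp).IsPath S.P S.X S.st yI := by
  obtain ⟨ω₀⟩ : Nonempty S.Ω := nonempty_of_isProbabilityMeasure S.P
  refine ⟨S.st 0 ω₀, S.hXmeas, fun ω => st_zero ω ω₀, st_succ h2 h1 hp, fun n b y hy => ?_⟩
  refine S.htrans n b y.1 y.2 fun ω hω => ?_
  rw [← hy ω hω]
  refine ⟨?_, fun j => rfl⟩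
  have := (S.hmpos ω n).1
  simp only [st]
  omega

lemma hitY0_iff (ω : S.Ω) (n : ℕ) : S.hitY0 ω n ↔ S.st n ω = (chain p δ1 δ2 h2 h1 hp).y0 := by
  have h := (S.hmpos ω n).1
  constructor
  · rintro ⟨g1, g2⟩
    refine Prod.ext ?_ (funext fun j => ?_)
    · show ((n : ℤ) - S.mpos ω n).toNat = 0
      omega
    · show S.cfg ω _ = false
      rw [g1, g2]
  · intro g
    have g1 : ((n : ℤ) - S.mpos ω n).toNat = 0 := congrArg Prod.fst g
    have g2 : S.mpos ω n = n := by omega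
    refine ⟨g2, fun j => ?_⟩
    have := congrFun (congrArg Prod.snd g) j
    rwa [st, g2] at this

lemma T_succ (k : ℕ) (ω : S.Ω) :
    S.T (k + 1) ω = (chain p δ1 δ2 h2 h1 hp).firstHit S.st (S.T k ω) ω := by
  rw [T, BitChain.firstHit]
  simp only [hitY0_iff h2 h1 hp]

lemma T_one (ω : S.Ω) : S.T 1 ω = (chain p δ1 δ2 h2 h1 hp).firstHit S.st 0 ω :=
  T_succ h2 h1 hp 0 ω

lemma T_two (ω : S.Ω) : S.T 2 ω = (chain p δ1 δ2 h2 h1 hp).secondHit S.st ω := by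
  rw [T_succ h2 h1 hp 1 ω, T_one h2 h1 hp, BitChain.secondHit]

lemma tau_two : S.tau 2 = (chain p δ1 δ2 h2 h1 hp).gap S.st := funext fun ω => by
  rw [tau, T_two h2 h1 hp, T_one h2 h1 hp, BitChain.gap]

lemma zeta_two : S.zeta 2 = (chain p δ1 δ2 h2 h1 hp).gapOnes S.X S.st := funext fun ω => by
  rw [zeta, T_two h2 h1 hp, T_one h2 h1 hp, BitChain.gapOnes]

end VLMC

namespace VLMC

attribute [local instance] VLMC.mΩ VLMC.hprob

variable {v : ℕ} {p : ℕ → (Fin (v - 1) → Bool) → ℝ} {S : VLMC v p}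

lemma measurable_R (n : ℕ) : Measurable (S.R n) :=
  Finset.measurable_fun_sum (f := fun n ω => (S.X n ω).toNat) (Finset.Icc 1 n) fun k _ =>
    (measurable_of_finite Bool.toNat).comp (S.hXmeas k)

lemma R_le (n : ℕ) (ω : S.Ω) : S.R n ω ≤ n :=
  (BitChain.sum_toNat_le _ fun k => S.X k ω).trans_eq (by simp)

lemma R_eq_count (n : ℕ) (ω : S.Ω) :
    S.R n ω = (List.ofFn fun i : Fin n => S.X (0 + 1 + i.1) ω).count true := by
  induction n with
  | zero => simp [R]
  | succ n ih =>
    rw [R, Finset.sum_Icc_succ_top (by omega), ← R, ih, List.ofFn_succ', List.concat_eq_append,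
      List.count_append]
    simp only [Fin.val_castSucc, Fin.val_last, show 0 + 1 + n = n + 1 by ring]
    cases S.X (n + 1) ω <;> rfl

variable {δ1 δ2 : ℝ} {h2 : 0 < δ2} {h1 : δ1 < 1} {hp : ∀ k w, δ2 ≤ p k w ∧ p k w ≤ δ1}
  {yI : ℕ × (Fin (v - 1) → Bool)}

lemma toReal_measure_R_eq (H : (chain p δ1 δ2 h2 h1 hp).IsPath S.P S.X S.st yI) (n x : ℕ) :
    (S.P {ω | S.R n ω = x}).toReal =
      (chain p δ1 δ2 h2 h1 hp).Ex n (fun b => if b.count true = x then (1 : ℝ) else 0) yI := by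
  have h := H.integral_mul_Ex n (BitChain.Adapted.const (n := 0) (1 : ℂ))
    (fun b => ((if b.count true = x then (1 : ℝ) else 0 : ℝ) : ℂ))
  simp only [one_mul, ← R_eq_count, BitChain.Ex_ofReal, H.st_zero] at h
  rw [integral_complex_ofReal, integral_const, probReal_univ, one_smul, Complex.ofReal_inj] at h
  rw [← h]
  have hm : MeasurableSet {ω | S.R n ω = x} := measurable_R n (measurableSet_singleton x)
  have := integral_indicator_const (μ := S.P) (1 : ℝ) hm
  rw [smul_eq_mul, mul_one] at this
  rw [← Measure.real, ← this]
  refine integral_congr_ae (ae_of_all _ fun ω => ?_)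
  by_cases hω : S.R n ω = x <;> simp [hω]

lemma measurable_T_one (H : (chain p δ1 δ2 h2 h1 hp).IsPath S.P S.X S.st yI) :
    Measurable (S.T 1) := by
  rw [funext (T_one h2 h1 hp)]
  exact H.measurable_firstHit 0

lemma measure_lt_T_one_le (H : (chain p δ1 δ2 h2 h1 hp).IsPath S.P S.X S.st yI) (m : ℕ) :
    S.P {ω | m < S.T 1 ω} ≤ ENNReal.ofReal
      ((chain p δ1 δ2 h2 h1 hp).rateConst * (chain p δ1 δ2 h2 h1 hp).rate ^ m) := by
  simp only [T_one h2 h1 hp]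
  exact H.measure_lt_firstHit_le m

lemma psi1_pos (H : (chain p δ1 δ2 h2 h1 hp).IsPath S.P S.X S.st yI) {l m : ℝ}
    (hlm : ∀ c, BitChain.ew l m c < (chain p δ1 δ2 h2 h1 hp).rad) : 0 < S.psi1 l m := by
  have hT := measurable_T_one H
  have hz : Measurable (S.zeta 1) := by
    have h : Measurable fun q : ℕ × S.Ω => S.R q.1 q.2 :=
      measurable_from_prod_countable_right measurable_R
    exact h.comp (hT.prodMk measurable_id)
  have hm : Measurable fun ω => Real.exp (l * S.tau 1 ω + m * S.zeta 1 ω) := by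
    have g1 : Measurable fun ω => (S.tau 1 ω : ℝ) := measurable_from_nat.comp hT
    have g2 : Measurable fun ω => (S.zeta 1 ω : ℝ) := measurable_from_nat.comp hz
    exact ((g1.const_mul l).add (g2.const_mul m)).exp
  refine integral_exp_pos (((chain p δ1 δ2 h2 h1 hp).integrable_exp_log_rad_mul hT
    (measure_lt_T_one_le H)).mono' hm.aestronglyMeasurable (ae_of_all _ fun ω => ?_))
  rw [Real.norm_of_nonneg (Real.exp_pos _).le]
  exact BitChain.exp_add_mul_le (fun c => (hlm c).le) (R_le _ ω)

lemma integrable_exp_R (m : ℝ) (n : ℕ) :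
    Integrable (fun ω => Real.exp (m * S.R n ω)) S.P := by
  have h : Measurable fun ω => Real.exp (m * S.R n ω) :=
    (measurable_from_nat (f := fun k : ℕ => Real.exp (m * k))).comp (measurable_R n)
  refine Integrable.of_bound h.aestronglyMeasurable (Real.exp (|m| * n)) (ae_of_all _ fun ω => ?_)
  rw [Real.norm_of_nonneg (Real.exp_pos _).le, Real.exp_le_exp]
  exact mul_le_mul (le_abs_self m) (Nat.cast_le.2 (R_le n ω)) (Nat.cast_nonneg _) (abs_nonneg m)

lemma tsum_exp_R_pos (H : (chain p δ1 δ2 h2 h1 hp).IsPath S.P S.X S.st yI) {l m : ℝ}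
    (hlm : ∀ c, BitChain.ew l m c < (chain p δ1 δ2 h2 h1 hp).rad) :
    0 < ∑' k : ℕ, Real.exp (l * (k + 1)) *
      ∫ ω in {ω | k + 1 ≤ S.T 1 ω}, Real.exp (m * S.R (k + 1) ω) ∂S.P := by
  set C := chain p δ1 δ2 h2 h1 hp
  have hr := C.rad_pos
  have hnonneg : ∀ k : ℕ, 0 ≤ Real.exp (l * (k + 1)) *
      ∫ ω in {ω | k + 1 ≤ S.T 1 ω}, Real.exp (m * S.R (k + 1) ω) ∂S.P := fun k =>
    mul_nonneg (Real.exp_pos _).le (integral_nonneg fun ω => (Real.exp_pos _).le)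
  have hle : ∀ k : ℕ, Real.exp (l * (k + 1)) *
      ∫ ω in {ω | k + 1 ≤ S.T 1 ω}, Real.exp (m * S.R (k + 1) ω) ∂S.P ≤ C.bd k := fun k => by
    rw [← integral_const_mul]
    have hb : ∀ ω, ‖Real.exp (l * (k + 1)) * Real.exp (m * S.R (k + 1) ω)‖ ≤ C.rad ^ (k + 1) :=
      fun ω => by
        rw [← Real.exp_add, Real.norm_of_nonneg (Real.exp_pos _).le]
        have := BitChain.exp_add_mul_le (fun c => (hlm c).le) (R_le (k + 1) ω)
        rw [mul_comm (Real.log _), Real.exp_nat_mul, Real.exp_log hr] at this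
        exact_mod_cast this
    have hP : S.P.real {ω | k + 1 ≤ S.T 1 ω} ≤ C.rateConst * C.rate ^ k :=
      ENNReal.toReal_le_of_le_ofReal
        (mul_nonneg C.rateConst_pos.le (pow_nonneg C.rate_pos.le k)) (measure_lt_T_one_le H k)
    calc _ ≤ _ := le_abs_self _
      _ ≤ C.rad ^ (k + 1) * S.P.real {ω | k + 1 ≤ S.T 1 ω} :=
        norm_setIntegral_le_of_norm_le_const (measure_lt_top _ _) fun ω _ => hb ω
      _ ≤ C.rad ^ (k + 1) * (C.rateConst * C.rate ^ k) := by gcongr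
      _ = _ := by rw [BitChain.bd]; ring
  refine (C.summable_bd.of_nonneg_of_le hnonneg hle).tsum_pos hnonneg 0
    (mul_pos (Real.exp_pos _) ?_)
  have hU : {ω | 0 + 1 ≤ S.T 1 ω} =ᵐ[S.P] Set.univ := eventuallyEq_univ.2
    (H.ae_firstHit.mono fun ω ⟨s, hs⟩ => by
      show 0 + 1 ≤ S.T 1 ω
      rw [T_one h2 h1 hp, hs]
      omega)
  rw [setIntegral_congr_set hU, setIntegral_univ]
  exact integral_exp_pos (integrable_exp_R m _)

/-- The local limit theorem for the number of ones, in terms of the tilting parameters `q`. -/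
lemma exists_local_limit (S : VLMC v p) {δ1 δ2 : ℝ} (h2 : 0 < δ2) (h1 : δ1 < 1)
    (hp : ∀ k w, δ2 ≤ p k w ∧ p k w ≤ δ1) :
    ∃ ρ > 0, ∃ q : ℝ → ℝ × ℝ, ∀ α : ℝ, |α - S.a| < ρ →
      (∀ c, BitChain.ew (q α).1 (q α).2 c < (chain p δ1 δ2 h2 h1 hp).rad) ∧
      S.D α = (q α).1 + α * (q α).2 ∧
      (∀ l m : ℝ, S.psi l m = 1 → S.D α = l + α * m → q α = (l, m)) ∧
      ∀ x : ℕ → ℕ, Tendsto (fun n => (x n : ℝ) / n) atTop (𝓝 α) → ∃ K, 0 < K ∧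
        Tendsto (fun n : ℕ => √n * (Real.exp (n * (q (x n / n)).1 + (q (x n / n)).2 * x n) *
          (S.P {ω | S.R n ω = x n}).toReal)) atTop (𝓝 K) := by
  obtain ⟨yI, H⟩ := exists_isPath (S := S) h2 h1 hp
  have hT := H.tiltPair (k := v - 1) rfl fun y h => by
    have : y.1 + 1 = 0 := congrArg Prod.fst h
    omega
  obtain ⟨ρ, hρ, q, hq⟩ := (chain p δ1 δ2 h2 h1 hp).exists_local_limit hT H.integral_exp_gap
  have hpsi : ∀ l m, S.psi l m = ∫⁻ ω, ENNReal.ofReal (TiltPair.dens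
      ((chain p δ1 δ2 h2 h1 hp).gap S.st) ((chain p δ1 δ2 h2 h1 hp).gapOnes S.X S.st) (l, m) ω)
      ∂S.P := fun l m => by
    simp only [psi, tau_two h2 h1 hp, zeta_two h2 h1 hp, TiltPair.dens]
  have ha : S.a = TiltPair.mom S.P ((chain p δ1 δ2 h2 h1 hp).gap S.st)
      ((chain p δ1 δ2 h2 h1 hp).gapOnes S.X S.st)
      (fun ω => ((chain p δ1 δ2 h2 h1 hp).gapOnes S.X S.st ω : ℝ)) 0 /
      TiltPair.mom S.P ((chain p δ1 δ2 h2 h1 hp).gap S.st)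
      ((chain p δ1 δ2 h2 h1 hp).gapOnes S.X S.st)
      (fun ω => ((chain p δ1 δ2 h2 h1 hp).gap S.st ω : ℝ)) 0 := by
    simp [a, tau_two h2 h1 hp, zeta_two h2 h1 hp, TiltPair.mom, TiltPair.dens]
  refine ⟨ρ, hρ, q, fun α hα => ?_⟩
  obtain ⟨hrad, hone, hmax, hlim⟩ := hq α (ha ▸ hα)
  have hD : S.D α = (q α).1 + α * (q α).2 := by
    refine IsGreatest.csSup_eq ⟨⟨(q α).1, (q α).2, ((hpsi _ _).trans hone).le, by ring⟩, ?_⟩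
    rintro _ ⟨l, m, hlm, rfl⟩
    have := (hmax (l, m) ((hpsi l m).symm.trans_le hlm)).1
    simpa [mul_comm m] using this
  refine ⟨hrad, hD, fun l m hlm h => ?_, fun x hx => ?_⟩
  · exact ((hmax (l, m) ((hpsi l m).symm.trans hlm).le).2 (h.symm.trans hD)).symm
  · simpa only [toReal_measure_R_eq H] using hlim x hx yI

end VLMC

namespace VLMC

/-- Theorem 1.5(3): the local theorem in the regions of normal,
moderate and large deviations.  Here `S` is the chain with its given initial
configuration and `S'` is the same chain started from the state `y₀` (used to express
the conditional expectations `E(⋅ ∣ Y(0) = y₀)`); `lam` and `mu` are the functions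
`α ↦ (λ(α), μ(α))` characterized by `A(λ(α),μ(α)) = 0` (i.e. `ψ = 1`) and
`D(α) = λ(α) + α μ(α)`.  The constant is `ψ₁(λ(α₀),μ(α₀)) · C_H(1,α₀) · I(α₀)` with
`C_H(1,α₀) > 0` the constant of Mogulskii's local renewal theorem and
`I(α₀) = Σ_{l ≥ 1} e^{λ(α₀) l} E(e^{μ(α₀) R(l)}; τ ≥ l ∣ Y(0) = y₀)`, and the relation
`P(R(n) = x) = c·n^{-1/2} e^{-n D(x/n)}(1 + o(1))` is expressed as convergence of the
ratio to `1`. -/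
theorem statement2 {v : ℕ} {p : ℕ → (Fin (v - 1) → Bool) → ℝ} (S S' : VLMC v p)
    (δ1 δ2 : ℝ) (hA : S.CondA δ1 δ2) (hA' : S'.CondA δ1 δ2)
    (hstart : S'.StartsAtY0) :
    ∃ Δ > (0 : ℝ), ∀ lam mu : ℝ → ℝ,
      (∀ α : ℝ, |α - S.a| ≤ Δ →
        S.psi (lam α) (mu α) = 1 ∧ S.D α = lam α + α * mu α) →
      ∀ α0 : ℝ, |α0 - S.a| ≤ Δ →
      ∀ x : ℕ → ℕ, Filter.Tendsto (fun n : ℕ => (x n : ℝ) / n) Filter.atTop (nhds α0) →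
      ∃ CH > (0 : ℝ),
        Filter.Tendsto
          (fun n : ℕ =>
            (S.P {ω | S.R n ω = x n}).toReal /
              (S.psi1 (lam α0) (mu α0) * CH *
                  (∑' l : ℕ, Real.exp (lam α0 * (l + 1)) *
                    ∫ ω in {ω | l + 1 ≤ S'.T 1 ω},
                      Real.exp (mu α0 * S'.R (l + 1) ω) ∂S'.P) /
                Real.sqrt n * Real.exp (-(n : ℝ) * S.D ((x n : ℝ) / n))))
          Filter.atTop (nhds 1) := by
  obtain ⟨-, h2, -, h1, hp⟩ := hA
  obtain ⟨ρ, hρ, q, hq⟩ := S.exists_local_limit h2 h1 hp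
  refine ⟨ρ / 2, half_pos hρ, fun lam mu hlm α0 hα0 x hx => ?_⟩
  have hα0' : |α0 - S.a| < ρ := by linarith
  obtain ⟨hrad, -, huniq, hlim⟩ := hq α0 hα0'
  obtain ⟨hψ, hD⟩ := hlm α0 hα0
  rw [huniq _ _ hψ hD] at hrad
  obtain ⟨yI, H⟩ := exists_isPath (S := S) h2 h1 hp
  obtain ⟨yI', H'⟩ := exists_isPath (S := S') h2 h1 hp
  have hψ1 := psi1_pos H hrad
  have hI := tsum_exp_R_pos H' hrad
  obtain ⟨K, hK, hKlim⟩ := hlim x hx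
  set I := ∑' l : ℕ, Real.exp (lam α0 * (l + 1)) *
    ∫ ω in {ω | l + 1 ≤ S'.T 1 ω}, Real.exp (mu α0 * S'.R (l + 1) ω) ∂S'.P
  set ψ1 := S.psi1 (lam α0) (mu α0)
  refine ⟨K / (ψ1 * I), by positivity, ?_⟩
  have hev : ∀ᶠ n : ℕ in atTop, |(x n : ℝ) / n - S.a| < ρ :=
    (hx.sub_const S.a).abs.eventually_lt_const hα0'
  have hlim1 := hKlim.div_const K
  rw [div_self hK.ne'] at hlim1
  refine hlim1.congr' ?_
  filter_upwards [hev, eventually_gt_atTop 0] with n hn hn0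
  have hn0' : (0 : ℝ) < n := Nat.cast_pos.2 hn0
  rw [(hq _ hn).2.1, show ψ1 * (K / (ψ1 * I)) * I = K by field_simp, neg_mul, Real.exp_neg,
    show (n : ℝ) * ((q (x n / n)).1 + x n / n * (q (x n / n)).2) =
      n * (q (x n / n)).1 + (q (x n / n)).2 * x n by field_simp]
  have := Real.sqrt_pos.2 hn0'
  have := Real.exp_pos (n * (q (x n / n)).1 + (q (x n / n)).2 * x n)
  field_simp

end VLMC
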